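/- arXiv:2007.04909 — 10 statements merged into one kernel-verified Lean document; each statement's English description precedes it below -/
import Mathlib

section
/- Suppose Assumption A holds and investor 1 uses the strategy λ* with components λ*ₜⁿ = E(Rₜⁿ | F_{t-1}), while investors m = 2,…,M use arbitrary adapted Δ-valued investment-proportion sequences. Then the expected hitting time E τₗ¹ is finite for every level l > 0, and for every other investor m ∈ {2,…,M}, limsup_{l→∞} (E τₗ¹)/(E τₗᵐ) ≤ 1 (with the convention that the ratio is 0 when E τₗᵐ = ∞). -/
open MeasureTheory ProbabilityTheory Filter
open scoped ENNReal BigOperators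

/-- The standard simplex `Δ = {λ ∈ ℝ₊ᴺ : ∑ₙ λⁿ = 1}`. -/
def stdSimplex' (N : ℕ) : Set (Fin N → ℝ) := {x | (∀ n, 0 ≤ x n) ∧ ∑ n, x n = 1}

/-- The first time the wealth sequence `Y` reaches or exceeds the level `l`
(`= ∞` if this never happens), as an extended nonnegative real. -/
noncomputable def hitTime {Ω : Type*} (Y : ℕ → Ω → ℝ) (l : ℝ) (ω : Ω) : ℝ≥0∞ :=
  sInf ((fun t : ℕ => (t : ℝ≥0∞)) '' {t : ℕ | l ≤ Y t ω})

lemma aux_step {N : ℕ} {ε : ℝ} (hε : 0 < ε) (p R q : Fin N → ℝ)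
    (hp : p ∈ stdSimplex' N) (hpε : ∀ n, ε ≤ p n) (hR : R ∈ stdSimplex' N)
    (hq : ∀ n, 0 < q n) (hq1 : ∑ n, q n = 1) :
    ∑ n, R n * Real.log (p n / q n) ≤ Real.log (∑ n, p n / q n * R n) ∧
    0 ≤ ∑ n, p n * Real.log (p n / q n) ∧
    Real.log (∑ n, p n / q n * R n) ≤
      (∑ n, p n * Real.log (p n / q n) + Real.log (1 / ε)) / ε ∧
    ε ≤ ∑ n, p n / q n * R n := by
  have hpp : ∀ n, 0 < p n := fun n => hε.trans_le (hpε n)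
  have hqle : ∀ n, q n ≤ 1 := fun n => by
    rw [← hq1]
    exact Finset.single_le_sum (fun i _ => (hq i).le) (Finset.mem_univ n)
  have hratio : ∀ n, ε ≤ p n / q n := fun n => by
    rw [le_div_iff₀ (hq n)]
    nlinarith [hqle n, hpε n]
  have hsum : ε ≤ ∑ n, p n / q n * R n := by
    calc ε = ∑ n, ε * R n := by rw [← Finset.mul_sum, hR.2, mul_one]
      _ ≤ _ := Finset.sum_le_sum fun n _ => mul_le_mul_of_nonneg_right (hratio n) (hR.1 n)
  have hK : 0 ≤ ∑ n, p n * Real.log (p n / q n) := by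
    calc (0:ℝ) = ∑ n, (p n - q n) := by rw [Finset.sum_sub_distrib, hp.2, hq1, sub_self]
      _ ≤ _ := Finset.sum_le_sum fun n _ => by
        have h := Real.one_sub_inv_le_log_of_pos (div_pos (hpp n) (hq n))
        have h2 := mul_le_mul_of_nonneg_left h (hpp n).le
        have h3 : p n * (1 - (p n / q n)⁻¹) = p n - q n := by
          have := (hpp n).ne'
          have := (hq n).ne'
          field_simp
        linarith
  refine ⟨?_, hK, ?_, hsum⟩
  · have h := strictConcaveOn_log_Ioi.concaveOn.le_map_sum (t := Finset.univ) (w := R)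
      (p := fun n => p n / q n) (fun i _ => hR.1 i) hR.2
      (fun i _ => div_pos (hpp i) (hq i))
    simp only [smul_eq_mul] at h
    refine h.trans (le_of_eq ?_)
    congr 1
    exact Finset.sum_congr rfl fun n _ => mul_comm _ _
  · set B := (∑ n, p n * Real.log (p n / q n) + Real.log (1 / ε)) / ε with hB
    have ha : ∀ n, Real.log (p n / q n) ≤ B := fun n => by
      rw [hB, le_div_iff₀ hε]
      have e1 : ∑ k, p k * Real.log (p k / q k) + Real.log (1 / ε)
          = ∑ k, p k * (Real.log (p k / q k) + Real.log (1 / ε)) := by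
        simp only [mul_add, Finset.sum_add_distrib]
        rw [← Finset.sum_mul, hp.2, one_mul]
      have hb : ∀ k, 0 ≤ Real.log (p k / q k) + Real.log (1 / ε) := fun k => by
        have := Real.log_le_log hε (hratio k)
        rw [one_div, Real.log_inv]; linarith
      have hle : ε ≤ 1 := by
        refine (hpε n).trans ?_
        rw [← hp.2]
        exact Finset.single_le_sum (fun i _ => hp.1 i) (Finset.mem_univ n)
      have hc : 0 ≤ Real.log (1 / ε) := Real.log_nonneg (by rw [le_div_iff₀ hε]; linarith)
      have h2 := Finset.single_le_sum (f := fun k => p k * (Real.log (p k / q k) + Real.log (1 / ε)))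
        (fun i _ => mul_nonneg (hpp i).le (hb i)) (Finset.mem_univ n)
      have h3 := mul_le_mul_of_nonneg_right (hpε n) (hb n)
      rw [e1]
      nlinarith
    rw [← Real.log_exp B]
    refine Real.log_le_log (hε.trans_le hsum) ?_
    calc _ ≤ ∑ n, Real.exp B * R n := Finset.sum_le_sum fun n _ =>
          mul_le_mul_of_nonneg_right
            ((Real.log_le_iff_le_exp (div_pos (hpp n) (hq n))).1 (ha n)) (hR.1 n)
      _ = _ := by rw [← Finset.mul_sum, hR.2, mul_one]

open Classical in
noncomputable def chi (y : ℕ → ℝ) (l : ℝ) (t : ℕ) : ℝ := if ∀ s ≤ t, y s < l then 1 else 0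

lemma chi_nonneg (y l t) : 0 ≤ chi y l t := by unfold chi; split_ifs <;> norm_num
lemma chi_le_one (y l t) : chi y l t ≤ 1 := by unfold chi; split_ifs <;> norm_num

lemma chi_stop (y : ℕ → ℝ) (l : ℝ) (T : ℕ) :
    ∃ s ≤ T, (∀ u : ℕ → ℝ, ∑ t ∈ Finset.range T, chi y l t * u t = ∑ t ∈ Finset.range s, u t) ∧
      (∀ t < s, y t < l) ∧ (s = T ∨ l ≤ y s) := by
  induction T with
  | zero => exact ⟨0, le_rfl, by simp, by simp, Or.inl rfl⟩
  | succ T ih =>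
    obtain ⟨s, hs, h1, h2, h3⟩ := ih
    by_cases hc : ∀ s ≤ T, y s < l
    · have hsT : s = T := by
        rcases h3 with h | h
        · exact h
        · exact absurd (hc s hs) (not_lt.2 h)
      subst hsT
      refine ⟨s + 1, le_rfl, fun u => ?_, fun t ht => hc t (by omega), Or.inl rfl⟩
      rw [Finset.sum_range_succ, Finset.sum_range_succ, h1]
      rw [show chi y l s = 1 from if_pos hc, one_mul]
    · refine ⟨s, by omega, fun u => ?_, h2, ?_⟩
      · rw [Finset.sum_range_succ, h1]
        rw [show chi y l T = 0 from if_neg hc, zero_mul, add_zero]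
      · rcases h3 with h | h
        · subst h
          push Not at hc
          obtain ⟨r, hr, hr2⟩ := hc
          rcases hr.lt_or_eq with h | h
          · exact absurd (h2 r h) (not_lt.2 hr2)
          · subst h; exact Or.inr hr2
        · exact Or.inr h

lemma hitTime_eq {Ω : Type*} (Y : ℕ → Ω → ℝ) (l : ℝ) (ω : Ω) :
    hitTime Y l ω = ∑' t, ENNReal.ofReal (chi (fun s => Y s ω) l t) := by
  classical
  unfold hitTime
  by_cases h : ∃ t, l ≤ Y t ω
  · set s := Nat.find h with hs
    have h1 : ∀ t, chi (fun s => Y s ω) l t = if t < s then 1 else 0 := fun t => by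
      unfold chi
      congr 1
      rw [eq_iff_iff]
      constructor
      · intro h'
        by_contra hlt
        exact absurd (h' s (by omega)) (not_lt.2 (Nat.find_spec h))
      · intro hlt r hr
        exact not_le.1 (Nat.find_min h (by omega : r < s))
    rw [tsum_eq_sum (s := Finset.range s)]
    · apply le_antisymm
      · refine sInf_le ⟨s, Nat.find_spec h, ?_⟩
        rw [Finset.sum_congr rfl (g := fun _ => (1:ℝ≥0∞))]
        · simp
        · intro t ht
          rw [h1, if_pos (Finset.mem_range.1 ht)]; simp
      · refine le_sInf ?_
        rintro _ ⟨t, ht, rfl⟩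
        rw [Finset.sum_congr rfl (g := fun _ => (1:ℝ≥0∞))]
        · simp only [Finset.sum_const, Finset.card_range, nsmul_eq_mul, mul_one]
          exact_mod_cast Nat.find_min' h ht
        · intro t ht
          rw [h1, if_pos (Finset.mem_range.1 ht)]; simp
    · intro t ht
      rw [h1, if_neg (by simpa using ht)]; simp
  · have : {t : ℕ | l ≤ Y t ω} = ∅ := by
      ext t; simp only [Set.mem_ofPred_eq, Set.mem_empty_iff_false, iff_false]
      exact fun h' => h ⟨t, h'⟩
    rw [this, Set.image_empty, sInf_empty]
    push Not at h
    have h1 : ∀ t, chi (fun s => Y s ω) l t = 1 := fun t => by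
      unfold chi; rw [if_pos]; exact fun s _ => h s
    simp only [h1, ENNReal.ofReal_one]
    exact (ENNReal.tsum_const_eq_top_of_ne_zero one_ne_zero).symm

lemma aux_path {M N : ℕ} (ρ : ℕ → ℝ) (hρ : ∀ t, 0 < ρ (t + 1))
    (R : ℕ → Fin N → ℝ) {ε : ℝ} (hε : 0 < ε) 
    (hR : ∀ t, R (t + 1) ∈ stdSimplex' N)
    (Y0 : Fin M → ℝ) (hY0 : ∀ m, 0 < Y0 m)
    (lam : Fin M → ℕ → Fin N → ℝ)
    (hlam : ∀ m t, lam m (t + 1) ∈ stdSimplex' N)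
    (Y : Fin M → ℕ → ℝ) (W : ℕ → ℝ)
    (hW0 : W 0 = ∑ m, Y0 m) (hW : ∀ t, W (t + 1) = ρ (t + 1) * W t)
    (hY : ∀ m, Y m 0 = Y0 m)
    (hYrec : ∀ m t, Y m (t + 1) =
      ∑ n, lam m (t + 1) n * Y m t / (∑ k, lam k (t + 1) n * Y k t) *
        (ρ (t + 1) * R (t + 1) n * W t))
    (m1 : Fin M) (hst : ∀ t n, ε ≤ lam m1 (t + 1) n) (t : ℕ) :
    0 < W t ∧ (∀ m, 0 ≤ Y m t) ∧ ∑ m, Y m t = W t ∧ 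
    ε ^ t * (Y0 m1 / W 0) * W t ≤ Y m1 t ∧ 0 < Y m1 t ∧
    (∀ n, ε ^ (t + 1) * (Y0 m1 / W 0) ≤ (∑ k, lam k (t + 1) n * Y k t) / W t) ∧
    ∑ n, (∑ k, lam k (t + 1) n * Y k t) / W t = 1 ∧
    Y m1 (t + 1) = Y m1 t * (ρ (t + 1) * ∑ n, lam m1 (t + 1) n /
      ((∑ k, lam k (t + 1) n * Y k t) / W t) * R (t + 1) n) := by
  have hWpos : ∀ t, 0 < W t := by
    intro t
    induction t with
    | zero => rw [hW0]; exact Finset.sum_pos (fun m _ => hY0 m) ⟨m1, Finset.mem_univ _⟩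
    | succ t ih => rw [hW]; exact mul_pos (hρ t) ih
  have hr0 : 0 < Y0 m1 / W 0 := div_pos (hY0 m1) (hWpos 0)
  have key : ∀ t, (∀ m, 0 ≤ Y m t) → ∑ m, Y m t = W t →
    ε ^ t * (Y0 m1 / W 0) * W t ≤ Y m1 t → 
    0 < Y m1 t ∧ (∀ n, ε ^ (t + 1) * (Y0 m1 / W 0) ≤ (∑ k, lam k (t + 1) n * Y k t) / W t) ∧
    ∑ n, (∑ k, lam k (t + 1) n * Y k t) / W t = 1 ∧
    Y m1 (t + 1) = Y m1 t * (ρ (t + 1) * ∑ n, lam m1 (t + 1) n /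
      ((∑ k, lam k (t + 1) n * Y k t) / W t) * R (t + 1) n) := by
    intro t h1 h2 h3
    refine ⟨(by have := hWpos t; positivity : 0 < ε ^ t * (Y0 m1 / W 0) * W t).trans_le h3, ?_, ?_, ?_⟩
    · intro n
      rw [le_div_iff₀ (hWpos t)]
      have h4 := Finset.single_le_sum (f := fun k => lam k (t + 1) n * Y k t)
        (fun i _ => mul_nonneg ((hlam i t).1 n) (h1 i)) (Finset.mem_univ m1)
      refine le_trans ?_ h4
      have := mul_le_mul (hst t n) h3 (by have := hWpos t; positivity) ((hlam m1 t).1 n)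
      refine le_trans (le_of_eq ?_) this
      ring
    · rw [← Finset.sum_div, Finset.sum_comm]
      simp only [← Finset.sum_mul]
      simp only [(hlam _ t).2, one_mul, h2]
      exact div_self (hWpos t).ne'
    · rw [hYrec, Finset.mul_sum, Finset.mul_sum]
      refine Finset.sum_congr rfl fun n _ => ?_
      rw [div_div_eq_mul_div]
      ring
  have main : ∀ t, (∀ m, 0 ≤ Y m t) ∧ ∑ m, Y m t = W t ∧
    ε ^ t * (Y0 m1 / W 0) * W t ≤ Y m1 t := by
    intro t
    induction t with
    | zero =>
      refine ⟨fun m => by rw [hY]; exact (hY0 m).le, by simp only [hY, hW0], ?_⟩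
      rw [hY, pow_zero, one_mul, div_mul_cancel₀ _ (hWpos 0).ne']
    | succ t ih =>
      obtain ⟨h1, h2, h3⟩ := ih
      obtain ⟨k0, k1, k2, k3⟩ := key t h1 h2 h3
      have hq : ∀ n, 0 < (∑ k, lam k (t + 1) n * Y k t) / W t := fun n =>
        lt_of_lt_of_le (by positivity) (k1 n)
      have hG : ∀ n, 0 < ∑ k, lam k (t + 1) n * Y k t := fun n => by
        have := mul_pos (hq n) (hWpos t)
        rwa [div_mul_cancel₀ _ (hWpos t).ne'] at this
      refine ⟨?_, ?_, ?_⟩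
      · intro m
        rw [hYrec]
        refine Finset.sum_nonneg fun n _ => ?_
        have a1 := (hlam m t).1 n
        have a2 := h1 m
        have a3 := hG n
        have a4 := (hρ t)
        have a5 := (hR t).1 n
        have a6 := hWpos t
        positivity
      · simp only [hYrec]
        rw [Finset.sum_comm]
        simp only [← Finset.sum_mul, ← Finset.sum_div]
        rw [hW]
        calc _ = ∑ n, ρ (t + 1) * W t * R (t + 1) n := 
              Finset.sum_congr rfl fun n _ => by rw [div_self (hG n).ne']; ring
          _ = _ := by rw [← Finset.mul_sum, (hR t).2, mul_one]
      · have := (aux_step hε _ _ _ (hlam m1 t) (hst t) (hR t) hq k2).2.2.2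
        rw [k3, hW]
        have a4 := (hρ t)
        have a6 := hWpos t
        have := mul_le_mul h3 (mul_le_mul_of_nonneg_left this a4.le) (by positivity) k0.le
        refine le_trans (le_of_eq ?_) this
        ring
  obtain ⟨h1, h2, h3⟩ := main t
  obtain ⟨k0, k1, k2, k3⟩ := key t h1 h2 h3
  exact ⟨hWpos t, h1, h2, h3, k0, k1, k2, k3⟩

lemma chi_meas {Ω : Type*} {m0 : MeasurableSpace Ω} (ℱ : Filtration ℕ m0)
    (y : ℕ → Ω → ℝ) (hy : ∀ t, StronglyMeasurable[ℱ t] (y t)) (l : ℝ) (t : ℕ) :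
    StronglyMeasurable[ℱ t] (fun ω => chi (fun s => y s ω) l t) := by
  classical
  have hset : MeasurableSet[ℱ t] {ω | ∀ s ≤ t, y s ω < l} := by
    have : {ω | ∀ s ≤ t, y s ω < l} = ⋂ s, ⋂ (_ : s ≤ t), {ω | y s ω < l} := by
      ext ω; simp
    rw [this]
    refine MeasurableSet.iInter fun s => MeasurableSet.iInter fun hs => ?_
    exact ((hy s).mono (ℱ.mono hs)).measurable measurableSet_Iio
  unfold chi
  exact StronglyMeasurable.ite hset stronglyMeasurable_const stronglyMeasurable_const

lemma aux_indep {Ω : Type*} {m0 : MeasurableSpace Ω} (P : Measure Ω) [IsProbabilityMeasure P]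
    (m m' : MeasurableSpace Ω) (hm : m ≤ m0) (hm' : m' ≤ m0) (c f : Ω → ℝ)
    (hc : StronglyMeasurable[m] c) (hf : StronglyMeasurable[m'] f)
    (hind : Indep m' m P) (hc0 : ∀ ω, 0 ≤ c ω) (hc1 : ∀ ω, c ω ≤ 1) (hfi : Integrable f P) :
    Integrable (fun ω => c ω * f ω) P ∧ ∫ ω, c ω * f ω ∂P = (∫ ω, c ω ∂P) * ∫ ω, f ω ∂P := by
  have h : IndepFun c f P := by
    rw [IndepFun_iff_Indep]
    exact indep_of_indep_of_le_left (indep_of_indep_of_le_right hind.symm hf.measurable.comap_le)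
      hc.measurable.comap_le
  refine ⟨hfi.bdd_mul (c := 1) (hc.mono hm).aestronglyMeasurable
    (ae_of_all _ fun ω => by rw [Real.norm_eq_abs, abs_of_nonneg (hc0 ω)]; exact hc1 ω), ?_⟩
  exact h.integral_fun_mul_eq_mul_integral (hc.mono hm).aestronglyMeasurable
    (hf.mono hm').aestronglyMeasurable

lemma aux_rho {Ω : Type*} {m0 : MeasurableSpace Ω} (P : Measure Ω) [IsProbabilityMeasure P]
    (ℱ : Filtration ℕ m0) (ρ : ℕ → Ω → ℝ)
    (hρ_adapted : ∀ t, StronglyMeasurable[ℱ (t + 1)] (ρ (t + 1)))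
    (hρ_ident : ∀ t, IdentDistrib (ρ (t + 1)) (ρ 1) P P)
    (hρ_indep : ∀ t, Indep (MeasurableSpace.comap (ρ (t + 1)) inferInstance) (ℱ t) P)
    (g : ℝ → ℝ) (hg : Measurable g) (hgi : Integrable (fun ω => g (ρ 1 ω)) P)
    (t : ℕ) (c : Ω → ℝ) (hc : StronglyMeasurable[ℱ t] c)
    (hc0 : ∀ ω, 0 ≤ c ω) (hc1 : ∀ ω, c ω ≤ 1) :
    Integrable (fun ω => c ω * g (ρ (t + 1) ω)) P ∧
      ∫ ω, c ω * g (ρ (t + 1) ω) ∂P = (∫ ω, c ω ∂P) * ∫ ω, g (ρ 1 ω) ∂P := by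
  have hid : IdentDistrib (fun ω => g (ρ (t + 1) ω)) (fun ω => g (ρ 1 ω)) P P :=
    (hρ_ident t).comp hg
  have h := aux_indep P (ℱ t) (MeasurableSpace.comap (ρ (t + 1)) inferInstance) (ℱ.le t)
    (((hρ_adapted t).mono (ℱ.le _)).measurable.comap_le) c (fun ω => g (ρ (t + 1) ω)) hc
    ((hg.comp (comap_measurable (ρ (t + 1)))).stronglyMeasurable) (hρ_indep t) hc0 hc1
    (hid.integrable_iff.2 hgi)
  rw [hid.integral_eq] at h
  exact h

lemma aux_cond {Ω : Type*} {m0 : MeasurableSpace Ω} (P : Measure Ω) [IsProbabilityMeasure P]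
    (m : MeasurableSpace Ω) (hm : m ≤ m0) (h R : Ω → ℝ) (hh : StronglyMeasurable[m] h)
    (C : ℝ) (hC : ∀ᵐ ω ∂P, ‖h ω‖ ≤ C) (hR : Integrable R P) :
    ∫ ω, h ω * R ω ∂P = ∫ ω, h ω * (P[R|m]) ω ∂P := by
  have hi : Integrable (h * R) P := hR.bdd_mul (c := C) (hh.mono hm).aestronglyMeasurable hC
  have := condExp_mul_of_stronglyMeasurable_left hh hi hR
  calc _ = ∫ ω, (P[h * R|m]) ω ∂P := (integral_condExp hm).symm
    _ = _ := integral_congr_ae this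

lemma lint_hit {Ω : Type*} {m0 : MeasurableSpace Ω} (P : Measure Ω) [IsProbabilityMeasure P]
    (ℱ : Filtration ℕ m0)
    (y : ℕ → Ω → ℝ) (hy : ∀ t, StronglyMeasurable[ℱ t] (y t)) (l : ℝ) :
    ∫⁻ ω, hitTime y l ω ∂P =
      ∑' t, ENNReal.ofReal (∫ ω, chi (fun s => y s ω) l t ∂P) ∧
    ∀ t, Integrable (fun ω => chi (fun s => y s ω) l t) P := by
  have hint : ∀ t, Integrable (fun ω => chi (fun s => y s ω) l t) P := fun t =>
    Integrable.of_bound ((chi_meas ℱ y hy l t).mono (ℱ.le t)).aestronglyMeasurable 1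
      (ae_of_all _ fun ω => by
        rw [Real.norm_eq_abs, abs_of_nonneg (chi_nonneg _ _ _)]; exact chi_le_one _ _ _)
  refine ⟨?_, hint⟩
  simp only [hitTime_eq]
  rw [lintegral_tsum fun t =>
    ((chi_meas ℱ y hy l t).mono (ℱ.le t)).measurable.ennreal_ofReal.aemeasurable]
  congr 1
  ext t
  rw [ofReal_integral_eq_lintegral_ofReal (hint t) (ae_of_all _ fun ω => chi_nonneg _ _ _)]

lemma aux_lower {Ω : Type*} {m0 : MeasurableSpace Ω} (P : Measure Ω) [IsProbabilityMeasure P]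
    (ℱ : Filtration ℕ m0) (ρ : ℕ → Ω → ℝ)
    (hρ_adapted : ∀ t, StronglyMeasurable[ℱ (t + 1)] (ρ (t + 1)))
    (hρ_ident : ∀ t, IdentDistrib (ρ (t + 1)) (ρ 1) P P)
    (hρ_indep : ∀ t, Indep (MeasurableSpace.comap (ρ (t + 1)) inferInstance) (ℱ t) P)
    (hρ_growth : 0 < ∫ ω, Real.log (ρ 1 ω) ∂P)
    (W : ℕ → Ω → ℝ) (hW : ∀ t, StronglyMeasurable[ℱ t] (W t)) (w0 : ℝ)
    (hW0 : ∀ ω, W 0 ω = w0) (hWpos : ∀ t ω, 0 < W t ω)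
    (hWlog : ∀ t ω, Real.log (ρ (t + 1) ω) = Real.log (W (t + 1) ω) - Real.log (W t ω))
    (l : ℝ) (hl : 0 < l) :
    ENNReal.ofReal ((Real.log l - Real.log w0) / ∫ ω, Real.log (ρ 1 ω) ∂P) ≤
      ∫⁻ ω, hitTime W l ω ∂P := by
  set μ := ∫ ω, Real.log (ρ 1 ω) ∂P with hμ
  have hlogi : Integrable (fun ω => Real.log (ρ 1 ω)) P := by
    by_contra h
    rw [hμ, integral_undef h] at hρ_growth
    exact lt_irrefl _ hρ_growth
  obtain ⟨h1, h2⟩ := lint_hit P ℱ W hW l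
  by_cases htop : ∫⁻ ω, hitTime W l ω ∂P = ∞
  · rw [htop]; exact le_top
  have hA := fun t => aux_rho P ℱ ρ hρ_adapted hρ_ident hρ_indep Real.log Real.measurable_log hlogi
    t _ (chi_meas ℱ W hW l t) (fun ω => chi_nonneg _ _ _) (fun ω => chi_le_one _ _ _)
  have hB := fun t => aux_rho P ℱ ρ hρ_adapted hρ_ident hρ_indep (fun x => |Real.log x|)
    (continuous_abs.measurable.comp Real.measurable_log) hlogi.abs
    t _ (chi_meas ℱ W hW l t) (fun ω => chi_nonneg _ _ _) (fun ω => chi_le_one _ _ _)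
  have hchi0 : ∀ t, 0 ≤ ∫ ω, chi (fun s => W s ω) l t ∂P := fun t =>
    integral_nonneg fun ω => chi_nonneg _ _ _
  have hsum : Summable (fun t => ∫ ω, chi (fun s => W s ω) l t ∂P) := by
    rw [h1] at htop
    have := ENNReal.summable_toReal htop
    simpa only [ENNReal.toReal_ofReal (hchi0 _)] using this
  have hS := hasSum_integral_of_summable_integral_norm (μ := P)
    (F := fun t ω => chi (fun s => W s ω) l t * Real.log (ρ (t + 1) ω)) (fun t => (hA t).1) (by
      have : ∀ t, ∫ ω, ‖chi (fun s => W s ω) l t * Real.log (ρ (t + 1) ω)‖ ∂P =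
          (∫ ω, chi (fun s => W s ω) l t ∂P) * ∫ ω, |Real.log (ρ 1 ω)| ∂P := fun t => by
        rw [← (hB t).2]
        congr 1
        ext ω
        rw [Real.norm_eq_abs, abs_mul, abs_of_nonneg (chi_nonneg _ _ _)]
      exact (summable_congr this).2 (hsum.mul_right _))
  have hS2 : HasSum (fun t => ∫ ω, chi (fun s => W s ω) l t * Real.log (ρ (t + 1) ω) ∂P)
      ((∑' t, ∫ ω, chi (fun s => W s ω) l t ∂P) * μ) := by
    have hA2 : ∀ t, ∫ ω, chi (fun s => W s ω) l t * Real.log (ρ (t + 1) ω) ∂P =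
      (∫ ω, chi (fun s => W s ω) l t ∂P) * μ := fun t => (hA t).2
    rw [funext hA2]
    exact hsum.hasSum.mul_right μ
  have heq := hS.unique hS2
  have hfin : ∀ᵐ ω ∂P, hitTime W l ω < ∞ := by
    refine ae_lt_top' ?_ htop
    rw [show hitTime W l = _ from funext fun ω => hitTime_eq W l ω]
    exact AEMeasurable.ennreal_tsum fun t =>
      ((chi_meas ℱ W hW l t).mono (ℱ.le t)).measurable.ennreal_ofReal.aemeasurable
  have hpt : ∀ᵐ ω ∂P, Real.log l - Real.log w0 ≤
      ∑' t, chi (fun s => W s ω) l t * Real.log (ρ (t + 1) ω) := by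
    filter_upwards [hfin] with ω hω
    have hex : ∃ t, l ≤ W t ω := by
      by_contra hne
      push Not at hne
      have : {t : ℕ | l ≤ W t ω} = ∅ := by
        ext t; simp [hne t]
      simp [hitTime, this] at hω
    obtain ⟨T, hT⟩ := hex
    have hz : ∀ t ∉ Finset.range T, chi (fun s => W s ω) l t * Real.log (ρ (t + 1) ω) = 0 := by
      intro t ht
      have : chi (fun s => W s ω) l t = 0 := by
        refine if_neg fun h => ?_
        exact absurd (h T (by simpa using ht)) (not_lt.2 hT)
      rw [this, zero_mul]
    rw [tsum_eq_sum hz]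
    obtain ⟨s, hs, e1, e2, e3⟩ := chi_stop (fun s => W s ω) l T
    rw [e1]
    simp only [hWlog]
    rw [Finset.sum_range_sub (fun t => Real.log (W t ω)), hW0]
    have : l ≤ W s ω := by
      rcases e3 with h | h
      · rw [h]; exact hT
      · exact h
    linarith [Real.log_le_log hl this]
  have hfinal : Real.log l - Real.log w0 ≤ (∑' t, ∫ ω, chi (fun s => W s ω) l t ∂P) * μ := by
    rcases le_or_gt (Real.log l - Real.log w0) 0 with hneg | hpos'
    · exact hneg.trans (mul_nonneg (tsum_nonneg hchi0) hρ_growth.le)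
    have hwl : w0 < l := by
      by_contra hcon
      have hw := Real.log_le_log hl (not_lt.1 hcon)
      linarith
    have h0 : ∫ ω, chi (fun s => W s ω) l 0 ∂P = 1 := by
      have : ∀ ω, chi (fun s => W s ω) l 0 = 1 := fun ω => by
        refine if_pos fun s hs => ?_
        rw [Nat.le_zero.1 hs]; exact (hW0 ω).trans_lt hwl
      simp [this]
    have h1le := hsum.le_tsum 0 (fun j _ => hchi0 j)
    rw [h0] at h1le
    have hI : Integrable (fun ω => ∑' t, chi (fun s => W s ω) l t * Real.log (ρ (t + 1) ω)) P := by
      by_contra hni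
      rw [integral_undef hni] at heq
      have := mul_pos (zero_lt_one.trans_le h1le) hρ_growth
      linarith
    rw [← heq]
    have := integral_mono_ae (integrable_const _) hI hpt
    simpa using this
  rw [h1, ← ENNReal.ofReal_tsum_of_nonneg hchi0 hsum]
  exact ENNReal.ofReal_le_ofReal ((div_le_iff₀ hρ_growth).2 hfinal)

lemma aux_upper {Ω : Type*} {m0 : MeasurableSpace Ω} (P : Measure Ω) [IsProbabilityMeasure P]
    (ℱ : Filtration ℕ m0) (ρ : ℕ → Ω → ℝ)
    (hρ_adapted : ∀ t, StronglyMeasurable[ℱ (t + 1)] (ρ (t + 1)))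
    (hρ_ident : ∀ t, IdentDistrib (ρ (t + 1)) (ρ 1) P P)
    (hρ_indep : ∀ t, Indep (MeasurableSpace.comap (ρ (t + 1)) inferInstance) (ℱ t) P)
    (hρ_L2 : Integrable (fun ω => (Real.log (ρ 1 ω)) ^ 2) P)
    (hρ_growth : 0 < ∫ ω, Real.log (ρ 1 ω) ∂P)
    (y : ℕ → Ω → ℝ) (hy : ∀ t, StronglyMeasurable[ℱ t] (y t)) (y0 c ε U : ℝ)
    (hc : 0 ≤ c) (hε : 0 < ε)
    (d D K : ℕ → Ω → ℝ)
    (hD : ∀ t, Integrable (D t) P) (hK : ∀ t, Integrable (K t) P)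
    (hDK : ∀ t (x : Ω → ℝ), StronglyMeasurable[ℱ t] x → (∀ ω, 0 ≤ x ω) → (∀ ω, x ω ≤ 1) →
      ∫ ω, x ω * D t ω ∂P = ∫ ω, x ω * K t ω ∂P)
    (hae : ∀ᵐ ω ∂P, y 0 ω = y0 ∧ (∀ t, 0 < y t ω ∧
      Real.log (y (t + 1) ω) = Real.log (y t ω) + Real.log (ρ (t + 1) ω) + d t ω ∧
      D t ω ≤ d t ω ∧ 0 ≤ K t ω ∧ d t ω ≤ (K t ω + c) / ε ∧
      ∑ s ∈ Finset.range t, d s ω ≤ U))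
    (μ' : ℝ) (hμ' : 0 < μ') (hμμ' : μ' < ∫ ω, Real.log (ρ 1 ω) ∂P) :
    ∃ C : ℝ, ∀ l : ℝ, 0 < l → ∫⁻ ω, hitTime y l ω ∂P ≤
      ENNReal.ofReal ((max (Real.log l) (Real.log y0) + C) / μ') := by
  set μ := ∫ ω, Real.log (ρ 1 ω) ∂P with hμ
  set σ := ∫ ω, (Real.log (ρ 1 ω)) ^ 2 ∂P with hσ
  have hσ0 : 0 ≤ σ := integral_nonneg fun ω => sq_nonneg _
  have hlogi : Integrable (fun ω => Real.log (ρ 1 ω)) P := by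
    by_contra h
    rw [hμ, integral_undef h] at hρ_growth
    exact lt_irrefl _ hρ_growth
  obtain ⟨η, hη, hησ⟩ : ∃ η : ℝ, 0 < η ∧ μ' ≤ μ - η * σ := by
    refine ⟨(μ - μ') / (σ + 1), by have := sub_pos.2 hμμ'; positivity, ?_⟩
    have : (μ - μ') / (σ + 1) * σ ≤ μ - μ' := by
      rw [div_mul_eq_mul_div, div_le_iff₀ (by positivity)]
      nlinarith
    linarith
  refine ⟨1 / (4 * η) + c / ε + U / ε - Real.log y0, fun l hl => ?_⟩
  obtain ⟨h1, h2⟩ := lint_hit P ℱ y hy l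
  set L := max (Real.log l) (Real.log y0) with hL
  have hA : ∀ t, Integrable (fun ω => chi (fun s => y s ω) l t * Real.log (ρ (t + 1) ω)) P ∧
      ∫ ω, chi (fun s => y s ω) l t * Real.log (ρ (t + 1) ω) ∂P =
        (∫ ω, chi (fun s => y s ω) l t ∂P) * μ :=
    fun t => aux_rho P ℱ ρ hρ_adapted hρ_ident hρ_indep Real.log Real.measurable_log hlogi
    t _ (chi_meas ℱ y hy l t) (fun ω => chi_nonneg _ _ _) (fun ω => chi_le_one _ _ _)
  have hB : ∀ t, Integrable (fun ω => chi (fun s => y s ω) l t * (Real.log (ρ (t + 1) ω)) ^ 2) P ∧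
      ∫ ω, chi (fun s => y s ω) l t * (Real.log (ρ (t + 1) ω)) ^ 2 ∂P =
        (∫ ω, chi (fun s => y s ω) l t ∂P) * σ :=
    fun t => aux_rho P ℱ ρ hρ_adapted hρ_ident hρ_indep (fun x => Real.log x ^ 2)
    (Real.measurable_log.pow_const 2) hρ_L2
    t _ (chi_meas ℱ y hy l t) (fun ω => chi_nonneg _ _ _) (fun ω => chi_le_one _ _ _)
  have hbd : ∀ t (f : Ω → ℝ), Integrable f P →
      Integrable (fun ω => chi (fun s => y s ω) l t * f ω) P := fun t f hf =>
    hf.bdd_mul (c := 1) ((chi_meas ℱ y hy l t).mono (ℱ.le t)).aestronglyMeasurable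
    (ae_of_all _ fun ω => by
      rw [Real.norm_eq_abs, abs_of_nonneg (chi_nonneg _ _ _)]; exact chi_le_one _ _ _)
  have hDK' : ∀ t, ∫ ω, chi (fun s => y s ω) l t * D t ω ∂P =
      ∫ ω, chi (fun s => y s ω) l t * K t ω ∂P := fun t =>
    hDK t _ (chi_meas ℱ y hy l t) (fun ω => chi_nonneg _ _ _) (fun ω => chi_le_one _ _ _)
  have hchi0 : ∀ t, 0 ≤ ∫ ω, chi (fun s => y s ω) l t ∂P := fun t =>
    integral_nonneg fun ω => chi_nonneg _ _ _
  have hAD : ∀ t, Integrable (fun ω => chi (fun s => y s ω) l t * Real.log (ρ (t + 1) ω)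
          + chi (fun s => y s ω) l t * D t ω) P := fun t => (hA t).1.add (hbd t _ (hD t))
  have hBK : ∀ t, Integrable (fun ω => η * (chi (fun s => y s ω) l t * (Real.log (ρ (t + 1) ω)) ^ 2) +
            (1 / ε) * (chi (fun s => y s ω) l t * K t ω)) P := fun t =>
    ((hB t).1.const_mul η).add ((hbd t _ (hK t)).const_mul _)
  -- the bound on truncated sums
  have hT : ∀ T, ∑ t ∈ Finset.range T, ∫ ω, chi (fun s => y s ω) l t ∂P ≤
      (L + (1 / (4 * η) + c / ε + U / ε - Real.log y0)) / μ' := by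
    intro T
    set k := ∑ t ∈ Finset.range T, ∫ ω, chi (fun s => y s ω) l t * K t ω ∂P with hk
    set q := ∑ t ∈ Finset.range T, ∫ ω, chi (fun s => y s ω) l t ∂P with hq
    have hq0 : 0 ≤ q := Finset.sum_nonneg fun t _ => hchi0 t
    have hk0 : 0 ≤ k := Finset.sum_nonneg fun t _ => integral_nonneg_of_ae (by
      filter_upwards [hae] with ω hω
      exact mul_nonneg (chi_nonneg _ _ _) (hω.2 t).2.2.2.1)
    have hkU : k ≤ U := by
      have e : k = ∫ ω, ∑ t ∈ Finset.range T, chi (fun s => y s ω) l t * D t ω ∂P := by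
        rw [integral_finsetSum _ fun t _ => hbd t _ (hD t), hk]
        exact Finset.sum_congr rfl fun t _ => (hDK' t).symm
      rw [e]
      have : ∫ ω, ∑ t ∈ Finset.range T, chi (fun s => y s ω) l t * D t ω ∂P ≤ ∫ ω, U ∂P := by
        refine integral_mono_ae (integrable_finsetSum _ fun t _ => hbd t _ (hD t))
          (integrable_const _) ?_
        filter_upwards [hae] with ω hω
        obtain ⟨s, hs, e1, e2, e3⟩ := chi_stop (fun s => y s ω) l T
        rw [e1]
        exact (Finset.sum_le_sum fun t _ => (hω.2 t).2.2.1).trans (hω.2 s).2.2.2.2.2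
      simpa using this
    have hmain : ∫ ω, ∑ t ∈ Finset.range T, (chi (fun s => y s ω) l t * Real.log (ρ (t + 1) ω)
          + chi (fun s => y s ω) l t * D t ω) ∂P ≤
        ∫ ω, ((L - Real.log y0 + (1 / (4 * η) + c / ε)) + ∑ t ∈ Finset.range T,
          (η * (chi (fun s => y s ω) l t * (Real.log (ρ (t + 1) ω)) ^ 2) +
            (1 / ε) * (chi (fun s => y s ω) l t * K t ω))) ∂P := by
      refine integral_mono_ae
        (integrable_finsetSum _ fun t _ => hAD t)
        ((integrable_const _).add (integrable_finsetSum _ fun t _ =>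
          hBK t)) ?_
      filter_upwards [hae] with ω hω
      obtain ⟨s, hs, e1, e2, e3⟩ := chi_stop (fun s => y s ω) l T
      have f1 : ∑ t ∈ Finset.range T, (chi (fun s => y s ω) l t * Real.log (ρ (t + 1) ω)
          + chi (fun s => y s ω) l t * D t ω) =
          ∑ t ∈ Finset.range s, (Real.log (ρ (t + 1) ω) + D t ω) := by
        rw [← e1]; exact Finset.sum_congr rfl fun t _ => by ring
      have f2 : ∑ t ∈ Finset.range T,
          (η * (chi (fun s => y s ω) l t * (Real.log (ρ (t + 1) ω)) ^ 2) +
            (1 / ε) * (chi (fun s => y s ω) l t * K t ω)) =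
          ∑ t ∈ Finset.range s, (η * (Real.log (ρ (t + 1) ω)) ^ 2 + (1 / ε) * K t ω) := by
        rw [← e1]; exact Finset.sum_congr rfl fun t _ => by ring
      show _ ≤ _ + ∑ t ∈ Finset.range T, _
      rw [f1, f2]
      have f3 : ∑ t ∈ Finset.range s, (Real.log (ρ (t + 1) ω) + D t ω) ≤
          Real.log (y s ω) - Real.log y0 := by
        rw [← hω.1, ← Finset.sum_range_sub (fun t => Real.log (y t ω))]
        refine Finset.sum_le_sum fun t _ => ?_
        have := hω.2 t
        linarith [this.2.1, this.2.2.1]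
      have g0 : ∀ t, 0 ≤ η * (Real.log (ρ (t + 1) ω)) ^ 2 + (1 / ε) * K t ω := fun t => by
        have := (hω.2 t).2.2.2.1
        positivity
      rcases s with _ | s
      · have hle : Real.log y0 ≤ L := le_max_right _ _
        have : 0 ≤ 1 / (4 * η) + c / ε := by positivity
        simp only [Finset.range_zero, Finset.sum_empty]
        linarith
      · have f4 := Finset.single_le_sum (f := fun t =>
          η * (Real.log (ρ (t + 1) ω)) ^ 2 + (1 / ε) * K t ω) (fun i _ => g0 i)
          (Finset.mem_range.2 (Nat.lt_succ_self s))
        have f5 : Real.log (y s ω) ≤ L :=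
          (Real.log_le_log (hω.2 s).1 (e2 s (Nat.lt_succ_self s)).le).trans (le_max_left _ _)
        have f6 := (hω.2 s).2.1
        have f7 := (hω.2 s).2.2.2.2.1
        have f8 : (K s ω + c) / ε = 1 / ε * K s ω + c / ε := by ring
        have f9 : Real.log (ρ (s + 1) ω) ≤ 1 / (4 * η) + η * Real.log (ρ (s + 1) ω) ^ 2 := by
          have : 1 / (4 * η) + η * Real.log (ρ (s + 1) ω) ^ 2 - Real.log (ρ (s + 1) ω) =
            η * (Real.log (ρ (s + 1) ω) - 1 / (2 * η)) ^ 2 := by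
            field_simp; ring
          have h' : 0 ≤ η * (Real.log (ρ (s + 1) ω) - 1 / (2 * η)) ^ 2 := by positivity
          linarith
        linarith
    have hl1 : ∫ ω, ∑ t ∈ Finset.range T, (chi (fun s => y s ω) l t * Real.log (ρ (t + 1) ω)
          + chi (fun s => y s ω) l t * D t ω) ∂P = q * μ + k := by
      rw [integral_finsetSum _ fun t _ => hAD t, hq, hk, Finset.sum_mul,
        ← Finset.sum_add_distrib]
      refine Finset.sum_congr rfl fun t _ => ?_
      rw [integral_add (hA t).1 (hbd t _ (hD t)), (hA t).2, hDK']
    have hr1 : ∫ ω, ((L - Real.log y0 + (1 / (4 * η) + c / ε)) + ∑ t ∈ Finset.range T,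
          (η * (chi (fun s => y s ω) l t * (Real.log (ρ (t + 1) ω)) ^ 2) +
            (1 / ε) * (chi (fun s => y s ω) l t * K t ω))) ∂P =
        (L - Real.log y0 + (1 / (4 * η) + c / ε)) + (η * (q * σ) + (1 / ε) * k) := by
      rw [integral_add (integrable_const _) (integrable_finsetSum _ fun t _ =>
          hBK t),
        integral_finsetSum _ fun t _ =>
          hBK t]
      congr 1
      · simp
      · rw [hq, hk, Finset.sum_mul, Finset.mul_sum, Finset.mul_sum, ← Finset.sum_add_distrib]
        refine Finset.sum_congr rfl fun t _ => ?_
        rw [integral_add ((hB t).1.const_mul η) ((hbd t _ (hK t)).const_mul _),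
          integral_const_mul, integral_const_mul, (hB t).2]
    rw [hl1, hr1] at hmain
    rw [le_div_iff₀ hμ']
    have hkε : 1 / ε * k ≤ U / ε := by
      rw [one_div_mul_eq_div]; exact div_le_div_of_nonneg_right hkU hε.le
    nlinarith [mul_le_mul_of_nonneg_left hησ hq0]
  rw [h1, ENNReal.tsum_eq_iSup_nat]
  refine iSup_le fun T => ?_
  rw [← ENNReal.ofReal_sum_of_nonneg fun t _ => hchi0 t]
  exact ENNReal.ofReal_le_ofReal (hT T)

lemma aux_limsup (a b : ℝ → ℝ≥0∞) (μ w y0 : ℝ) (hμ : 0 < μ)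
    (hb : ∀ l, 0 < l → ENNReal.ofReal ((Real.log l - w) / μ) ≤ b l)
    (ha : ∀ μ', 0 < μ' → μ' < μ → ∃ C : ℝ, ∀ l, 0 < l →
      a l ≤ ENNReal.ofReal ((max (Real.log l) y0 + C) / μ')) :
    Filter.limsup (fun l => a l / b l) Filter.atTop ≤ 1 := by
  refine le_of_forall_gt fun z hz => ?_
  obtain ⟨z', hz1, hz2⟩ := exists_between hz
  refine lt_of_le_of_lt ?_ hz2
  have hz'top : z' ≠ ∞ := (hz2.trans_le le_top).ne
  set r := z'.toReal with hr
  have hr1 : 1 < r := by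
    have := (ENNReal.toReal_lt_toReal ENNReal.one_ne_top hz'top).2 hz1
    simpa using this
  have hzr : z' = ENNReal.ofReal r := (ENNReal.ofReal_toReal hz'top).symm
  -- choose the drift with slack
  obtain ⟨μ', h1, h2, h3⟩ : ∃ μ', 0 < μ' ∧ μ' < μ ∧ μ / μ' < r := by
    refine ⟨μ / ((1 + r) / 2), by positivity, ?_, ?_⟩
    · rw [div_lt_iff₀ (by positivity)]; nlinarith
    · rw [div_div_cancel₀ hμ.ne']; linarith
  obtain ⟨C, hC⟩ := ha μ' h1 h2
  have htend : Filter.Tendsto (fun x : ℝ => r * ((x - w) / μ) - (x + C) / μ') atTop atTop := by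
    have hpos : 0 < r / μ - 1 / μ' := by
      rw [sub_pos, div_lt_div_iff₀ h1 hμ]
      rw [div_lt_iff₀ h1] at h3
      linarith
    have : (fun x : ℝ => r * ((x - w) / μ) - (x + C) / μ') =
        fun x => (r / μ - 1 / μ') * x + (- r * w / μ - C / μ') := by
      ext x; ring
    rw [this]
    exact tendsto_atTop_add_const_right _ _ (tendsto_id.const_mul_atTop hpos)
  have hev := (htend.comp Real.tendsto_log_atTop).eventually_ge_atTop 0
  have hev2 := Real.tendsto_log_atTop.eventually_gt_atTop (max w y0)
  refine Filter.limsup_le_of_le (by isBoundedDefault) ?_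
  filter_upwards [hev, hev2, eventually_gt_atTop 0] with l e1 e2 e3
  have hw : w < Real.log l := (le_max_left _ _).trans_lt e2
  have hy : y0 < Real.log l := (le_max_right _ _).trans_lt e2
  simp only [Function.comp] at e1
  refine ENNReal.div_le_of_le_mul ?_
  calc a l ≤ ENNReal.ofReal ((max (Real.log l) y0 + C) / μ') := hC l e3
    _ ≤ ENNReal.ofReal (r * ((Real.log l - w) / μ)) := by
        refine ENNReal.ofReal_le_ofReal ?_
        rw [max_eq_left hy.le]; linarith
    _ = z' * ENNReal.ofReal ((Real.log l - w) / μ) := by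
        rw [ENNReal.ofReal_mul (by linarith), ← hzr]
    _ ≤ _ := mul_le_mul_right (hb l e3) _
/-- Theorem 1: under Assumption A, if investor 1 uses the strategy `λ*` with components
`λ*ₜⁿ = E(Rₜⁿ | F_{t-1})`, then `E τₗ¹ < ∞` for every `l > 0` and for every other
investor `m`, `limsup_{l→∞} (E τₗ¹)/(E τₗᵐ) ≤ 1` (in `ℝ≥0∞`, so that the ratio is `0`
when `E τₗᵐ = ∞`). -/
theorem asymptotically_minimal_expected_hitting_time
    {Ω : Type*} {m0 : MeasurableSpace Ω} (P : Measure Ω) [IsProbabilityMeasure P]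
    (ℱ : Filtration ℕ m0) {M N : ℕ} (hM : 2 ≤ M) (hN : 2 ≤ N)
    -- Assumption (A.1): the growth factors ρₜ
    (ρ : ℕ → Ω → ℝ)
    (hρ_adapted : ∀ t, StronglyMeasurable[ℱ (t + 1)] (ρ (t + 1)))
    (hρ_pos : ∀ t ω, 0 < ρ (t + 1) ω)
    (hρ_ident : ∀ t, IdentDistrib (ρ (t + 1)) (ρ 1) P P)
    (hρ_indep : ∀ t, Indep (MeasurableSpace.comap (ρ (t + 1)) inferInstance) (ℱ t) P)
    (hρ_L2 : Integrable (fun ω => (Real.log (ρ 1 ω)) ^ 2) P)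
    (hρ_growth : 0 < ∫ ω, Real.log (ρ 1 ω) ∂P)
    -- Assumption (A.2): the relative payoffs Rₜ
    (R : ℕ → Fin N → Ω → ℝ) (ε : ℝ) (hε : 0 < ε)
    (hR_adapted : ∀ t n, StronglyMeasurable[ℱ (t + 1)] (R (t + 1) n))
    (hR_simplex : ∀ t ω, (fun n => R (t + 1) n ω) ∈ stdSimplex' N)
    (hR_cond : ∀ t n, ∀ᵐ ω ∂P, ε ≤ (P[R (t + 1) n | ℱ t]) ω)
    -- initial wealths and investment proportions (predictable, Δ-valued)
    (Y0 : Fin M → ℝ) (hY0 : ∀ m, 0 < Y0 m)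
    (lam : Fin M → ℕ → Fin N → Ω → ℝ)
    (hlam_adapted : ∀ m t n, StronglyMeasurable[ℱ t] (lam m (t + 1) n))
    (hlam_simplex : ∀ m t ω, (fun n => lam m (t + 1) n ω) ∈ stdSimplex' N)
    -- the payoffs, generated as in Assumption A
    (X : ℕ → Fin N → Ω → ℝ)
    (hX1 : ∀ n ω, X 1 n ω = ρ 1 ω * R 1 n ω * ∑ m, Y0 m)
    (hXt : ∀ t n ω, X (t + 2) n ω = ρ (t + 2) ω * R (t + 2) n ω * ∑ i, X (t + 1) i ω)
    -- the wealth dynamics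
    (Y : Fin M → ℕ → Ω → ℝ)
    (hYinit : ∀ m ω, Y m 0 ω = Y0 m)
    (hYrec : ∀ m t ω, Y m (t + 1) ω =
      ∑ n, lam m (t + 1) n ω * Y m t ω / (∑ k, lam k (t + 1) n ω * Y k t ω) *
        X (t + 1) n ω)
    -- investor 1 uses the strategy λ*
    (m1 : Fin M) (hm1 : (m1 : ℕ) = 0)
    (hlamstar : ∀ t n ω, lam m1 (t + 1) n ω = (P[R (t + 1) n | ℱ t]) ω) :
    (∀ l : ℝ, 0 < l → ∫⁻ ω, hitTime (Y m1) l ω ∂P ≠ ∞) ∧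
    ∀ m : Fin M, m ≠ m1 →
      Filter.limsup
        (fun l : ℝ => (∫⁻ ω, hitTime (Y m1) l ω ∂P) / (∫⁻ ω, hitTime (Y m) l ω ∂P))
        Filter.atTop ≤ 1 := by
  classical
  set W : ℕ → Ω → ℝ := fun t ω => (∑ m, Y0 m) * ∏ s ∈ Finset.range t, ρ (s + 1) ω with hWdef
  set μ := ∫ ω, Real.log (ρ 1 ω) ∂P with hμ
  have hW0 : ∀ ω, W 0 ω = ∑ m, Y0 m := fun ω => by simp [hWdef]
  have hWs : ∀ t ω, W (t + 1) ω = ρ (t + 1) ω * W t ω := fun t ω => by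
    simp only [hWdef, Finset.prod_range_succ]; ring
  have hw0 : 0 < ∑ m, Y0 m := Finset.sum_pos (fun m _ => hY0 m) ⟨m1, Finset.mem_univ _⟩
  have hWpos : ∀ t ω, 0 < W t ω := fun t ω =>
    mul_pos hw0 (Finset.prod_pos fun s _ => hρ_pos s ω)
  have hX : ∀ t n ω, X (t + 1) n ω = ρ (t + 1) ω * R (t + 1) n ω * W t ω := by
    intro t
    induction t with
    | zero => intro n ω; rw [hW0]; exact hX1 n ω
    | succ t ih =>
      intro n ω
      rw [hXt t n ω]
      congr 1
      simp only [ih, hWs]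
      rw [← Finset.sum_mul, ← Finset.mul_sum, (hR_simplex t ω).2, mul_one]
  have hWm : ∀ t, StronglyMeasurable[ℱ t] (W t) := by
    intro t
    induction t with
    | zero =>
      have : W 0 = fun _ => ∑ m, Y0 m := funext hW0
      rw [this]; exact stronglyMeasurable_const
    | succ t ih =>
      have : W (t + 1) = fun ω => ρ (t + 1) ω * W t ω := funext (hWs t)
      rw [this]
      exact (hρ_adapted t).mul (ih.mono (ℱ.mono (Nat.le_succ t)))
  have hYm : ∀ t m, StronglyMeasurable[ℱ t] (Y m t) := by
    intro t
    induction t with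
    | zero =>
      intro m
      have : Y m 0 = fun _ => Y0 m := funext (hYinit m)
      rw [this]; exact stronglyMeasurable_const
    | succ t ih =>
      intro m
      have : Y m (t + 1) = fun ω => ∑ n, lam m (t + 1) n ω * Y m t ω /
          (∑ k, lam k (t + 1) n ω * Y k t ω) * (ρ (t + 1) ω * R (t + 1) n ω * W t ω) := by
        ext ω; rw [hYrec]; simp only [hX]
      rw [this]
      have hle := ℱ.mono (Nat.le_succ t)
      refine Finset.stronglyMeasurable_fun_sum _ fun n _ => ?_
      refine StronglyMeasurable.mul (StronglyMeasurable.div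
        (((hlam_adapted m t n).mul (ih m)).mono hle) ?_) ?_
      · exact Finset.stronglyMeasurable_fun_sum _ fun k _ =>
          ((hlam_adapted k t n).mul (ih k)).mono hle
      · exact ((hρ_adapted t).mul (hR_adapted t n)).mul ((hWm t).mono hle)
  set q : ℕ → Fin N → Ω → ℝ := fun t n ω => (∑ k, lam k (t + 1) n ω * Y k t ω) / W t ω with hq
  have hqm : ∀ t n, StronglyMeasurable[ℱ t] (q t n) := fun t n =>
    StronglyMeasurable.div (Finset.stronglyMeasurable_fun_sum _ fun k _ =>
          ((hlam_adapted k t n).mul (hYm t k))) (hWm t)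
  set a : ℕ → Fin N → Ω → ℝ := fun t n ω => Real.log (lam m1 (t + 1) n ω / q t n ω) with ha
  have ham : ∀ t n, StronglyMeasurable[ℱ t] (a t n) := fun t n =>
    (Real.measurable_log.comp
      ((hlam_adapted m1 t n).div (hqm t n)).measurable).stronglyMeasurable
  have hgood : ∀ᵐ ω ∂P, ∀ t n, ε ≤ lam m1 (t + 1) n ω := by
    rw [ae_all_iff]; intro t
    rw [ae_all_iff]; intro n
    filter_upwards [hR_cond t n] with ω hω
    rw [hlamstar]; exact hω
  have hpath : ∀ ω, (∀ t n, ε ≤ lam m1 (t + 1) n ω) → ∀ t,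
      (∀ m, 0 ≤ Y m t ω) ∧ ∑ m, Y m t ω = W t ω ∧ 0 < Y m1 t ω ∧
      (∀ n, ε ^ (t + 1) * (Y0 m1 / ∑ m, Y0 m) ≤ q t n ω) ∧ ∑ n, q t n ω = 1 ∧
      Y m1 (t + 1) ω = Y m1 t ω * (ρ (t + 1) ω *
        ∑ n, lam m1 (t + 1) n ω / q t n ω * R (t + 1) n ω) := by
    intro ω hω t
    have := aux_path (fun t => ρ t ω) (fun t => hρ_pos t ω) (fun t n => R t n ω) hε
      (fun t => hR_simplex t ω) Y0 hY0 (fun m t n => lam m t n ω) (fun m t => hlam_simplex m t ω)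
      (fun m t => Y m t ω) (fun t => W t ω) (hW0 ω) (fun t => hWs t ω) (fun m => hYinit m ω)
      (fun m t => by rw [hYrec]; simp only [hX]) m1 hω t
    obtain ⟨h1, h2, h3, h4, h5, h6, h7, h8⟩ := this
    rw [hW0] at h6
    exact ⟨h2, h3, h5, h6, h7, h8⟩
  have hr0 : 0 < Y0 m1 / ∑ m, Y0 m := div_pos (hY0 m1) hw0
  have hqpos : ∀ ω, (∀ t n, ε ≤ lam m1 (t + 1) n ω) → ∀ t n, 0 < q t n ω := fun ω hω t n =>
    lt_of_lt_of_le (by positivity) ((hpath ω hω t).2.2.2.1 n)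
  have hlam1 : ∀ t n ω, lam m1 (t + 1) n ω ≤ 1 := fun t n ω => by
    rw [← (hlam_simplex m1 t ω).2]
    exact Finset.single_le_sum (f := fun n => lam m1 (t + 1) n ω)
      (fun i _ => (hlam_simplex m1 t ω).1 i) (Finset.mem_univ n)
  have hR1 : ∀ t n ω, R (t + 1) n ω ≤ 1 := fun t n ω => by
    rw [← (hR_simplex t ω).2]
    exact Finset.single_le_sum (f := fun n => R (t + 1) n ω)
      (fun i _ => (hR_simplex t ω).1 i) (Finset.mem_univ n)
  have hε1 : ε ≤ 1 := by
    obtain ⟨ω, hω⟩ := hgood.exists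
    exact (hω 0 ⟨0, by omega⟩).trans (hlam1 _ _ _)
  have habd : ∀ t n, ∀ᵐ ω ∂P, ‖a t n ω‖ ≤
      |Real.log ε| + |Real.log (1 / (ε ^ (t + 1) * (Y0 m1 / ∑ m, Y0 m)))| := by
    intro t n
    filter_upwards [hgood] with ω hω
    have q0 := hqpos ω hω t
    have q1 : q t n ω ≤ 1 := by
      rw [← (hpath ω hω t).2.2.2.2.1]
      exact Finset.single_le_sum (f := fun n => q t n ω) (fun i _ => (q0 i).le) (Finset.mem_univ n)
    have b1 : ε ≤ lam m1 (t + 1) n ω / q t n ω := by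
      rw [le_div_iff₀ (q0 n)]; nlinarith [hω t n]
    have b2 : lam m1 (t + 1) n ω / q t n ω ≤ 1 / (ε ^ (t + 1) * (Y0 m1 / ∑ m, Y0 m)) :=
      div_le_div₀ zero_le_one (hlam1 t n ω) (by positivity) ((hpath ω hω t).2.2.2.1 n)
    have c1 := Real.log_le_log hε b1
    have c2 := Real.log_le_log (hε.trans_le b1) b2
    rw [Real.norm_eq_abs, abs_le]
    constructor
    · linarith [neg_abs_le (Real.log ε),
        abs_nonneg (Real.log (1 / (ε ^ (t + 1) * (Y0 m1 / ∑ m, Y0 m))))]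
    · linarith [abs_nonneg (Real.log ε),
        le_abs_self (Real.log (1 / (ε ^ (t + 1) * (Y0 m1 / ∑ m, Y0 m))))]
  have hRi : ∀ t n, Integrable (R (t + 1) n) P := fun t n =>
    Integrable.of_bound ((hR_adapted t n).mono (ℱ.le _)).aestronglyMeasurable 1
      (ae_of_all _ fun ω => by
        rw [Real.norm_eq_abs, abs_of_nonneg ((hR_simplex t ω).1 n)]; exact hR1 t n ω)
  have hli : ∀ t n, Integrable (lam m1 (t + 1) n) P := fun t n =>
    Integrable.of_bound ((hlam_adapted m1 t n).mono (ℱ.le _)).aestronglyMeasurable 1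
      (ae_of_all _ fun ω => by
        rw [Real.norm_eq_abs, abs_of_nonneg ((hlam_simplex m1 t ω).1 n)]; exact hlam1 t n ω)
  have hRa : ∀ t n, Integrable (fun ω => R (t + 1) n ω * a t n ω) P := fun t n => by
    have := (hRi t n).bdd_mul ((ham t n).mono (ℱ.le _)).aestronglyMeasurable (habd t n)
    refine this.congr (ae_of_all _ fun ω => mul_comm _ _)
  have hla : ∀ t n, Integrable (fun ω => lam m1 (t + 1) n ω * a t n ω) P := fun t n => by
    have := (hli t n).bdd_mul ((ham t n).mono (ℱ.le _)).aestronglyMeasurable (habd t n)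
    refine this.congr (ae_of_all _ fun ω => mul_comm _ _)
  have hupper := aux_upper P ℱ ρ hρ_adapted hρ_ident hρ_indep hρ_L2 hρ_growth (Y m1)
    (fun t => hYm t m1) (Y0 m1) (Real.log (1 / ε)) ε
    (Real.log (∑ m, Y0 m) - Real.log (Y0 m1))
    (Real.log_nonneg (by rw [le_div_iff₀ hε]; linarith)) hε
    (fun t ω => Real.log (∑ n, lam m1 (t + 1) n ω / q t n ω * R (t + 1) n ω))
    (fun t ω => ∑ n, R (t + 1) n ω * a t n ω)
    (fun t ω => ∑ n, lam m1 (t + 1) n ω * a t n ω)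
    (fun t => integrable_finsetSum _ fun n _ => hRa t n)
    (fun t => integrable_finsetSum _ fun n _ => hla t n)
    (by
      intro t x hx hx0 hx1
      have hxb : ∀ᵐ ω ∂P, ‖x ω‖ ≤ 1 := ae_of_all _ fun ω => by
        rw [Real.norm_eq_abs, abs_of_nonneg (hx0 ω)]; exact hx1 ω
      have hxm := (hx.mono (ℱ.le t)).aestronglyMeasurable (μ := P)
      simp only [Finset.mul_sum]
      rw [integral_finsetSum _ fun n _ => (hRa t n).bdd_mul hxm hxb,
        integral_finsetSum _ fun n _ => (hla t n).bdd_mul hxm hxb]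
      refine Finset.sum_congr rfl fun n _ => ?_
      have hc := aux_cond P (ℱ t) (ℱ.le t) (fun ω => x ω * a t n ω) (R (t + 1) n)
        (hx.mul (ham t n)) (|Real.log ε| + |Real.log (1 / (ε ^ (t + 1) * (Y0 m1 / ∑ m, Y0 m)))|)
        (by
          filter_upwards [habd t n, hxb] with ω h1 h2
          rw [norm_mul]
          calc ‖x ω‖ * ‖a t n ω‖ ≤ 1 * ‖a t n ω‖ :=
                mul_le_mul_of_nonneg_right h2 (norm_nonneg _)
            _ ≤ _ := by rw [one_mul]; exact h1) (hRi t n)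
      calc _ = ∫ ω, x ω * a t n ω * R (t + 1) n ω ∂P :=
            integral_congr_ae (ae_of_all _ fun ω => by simp only; ring)
        _ = _ := hc
        _ = _ := integral_congr_ae (ae_of_all _ fun ω => by simp only [hlamstar]; ring))
    (by
      filter_upwards [hgood] with ω hω
      have hstep := fun t => aux_step hε (fun n => lam m1 (t + 1) n ω) (fun n => R (t + 1) n ω)
        (fun n => q t n ω) (hlam_simplex m1 t ω) (hω t) (hR_simplex t ω) (hqpos ω hω t)
        (hpath ω hω t).2.2.2.2.1
      have hlog : ∀ t, Real.log (Y m1 (t + 1) ω) = Real.log (Y m1 t ω) + Real.log (ρ (t + 1) ω) +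
          Real.log (∑ n, lam m1 (t + 1) n ω / q t n ω * R (t + 1) n ω) := fun t => by
        have hS := hε.trans_le (hstep t).2.2.2
        rw [(hpath ω hω t).2.2.2.2.2, Real.log_mul (hpath ω hω t).2.2.1.ne'
          (mul_pos (hρ_pos t ω) hS).ne', Real.log_mul (hρ_pos t ω).ne' hS.ne']
        ring
      refine ⟨hYinit m1 ω, fun t => ⟨(hpath ω hω t).2.2.1, hlog t, (hstep t).1, (hstep t).2.1,
        (hstep t).2.2.1, ?_⟩⟩
      have hYW : Y m1 t ω ≤ W t ω := by
        rw [← (hpath ω hω t).2.1]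
        exact Finset.single_le_sum (f := fun m => Y m t ω)
          (fun i _ => (hpath ω hω t).1 i) (Finset.mem_univ m1)
      have hlle := Real.log_le_log (hpath ω hω t).2.2.1 hYW
      have htel : ∑ s ∈ Finset.range t,
          Real.log (∑ n, lam m1 (s + 1) n ω / q s n ω * R (s + 1) n ω) =
          (Real.log (Y m1 t ω) - Real.log (W t ω)) - (Real.log (Y m1 0 ω) - Real.log (W 0 ω)) := by
        rw [← Finset.sum_range_sub (fun t => Real.log (Y m1 t ω) - Real.log (W t ω))]
        refine Finset.sum_congr rfl fun s _ => ?_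
        rw [hlog s, hWs, Real.log_mul (hρ_pos s ω).ne' (hWpos s ω).ne']
        ring
      rw [htel, hYinit, hW0]
      linarith)
  refine ⟨fun l hl => ?_, fun m hm => ?_⟩
  · obtain ⟨C, hC⟩ := hupper (μ / 2) (half_pos hρ_growth) (half_lt_self hρ_growth)
    exact ((hC l hl).trans_lt ENNReal.ofReal_lt_top).ne
  · refine aux_limsup _ _ μ (Real.log (∑ m, Y0 m)) (Real.log (Y0 m1)) hρ_growth ?_ hupper
    intro l hl
    refine (aux_lower P ℱ ρ hρ_adapted hρ_ident hρ_indep hρ_growth W hWm _ hW0 hWpos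
      (fun t ω => by
        rw [hWs, Real.log_mul (hρ_pos t ω).ne' (hWpos t ω).ne']; ring) l hl).trans ?_
    refine lintegral_mono_ae ?_
    filter_upwards [hgood] with ω hω
    unfold hitTime
    refine sInf_le_sInf (Set.image_mono fun t ht => ?_)
    have hYW : Y m t ω ≤ W t ω := by
      rw [← (hpath ω hω t).2.1]
      exact Finset.single_le_sum (f := fun m => Y m t ω)
        (fun i _ => (hpath ω hω t).1 i) (Finset.mem_univ m)
    exact le_trans ht hYW
end

section
/- In the deterministic model with payoffs Xₜⁿ = Rⁿ ρᵗ (ρ > 1, R ∈ Δ with Rⁿ ≥ ε > 0 for all n, total initial wealth W₀ = 1), suppose investor 1 uses the strategy Λ*ₜ = R for all t and investor 2 uses a constant strategy λ̃ ∈ Δ. Then lim_{l→∞} τₗ¹ / τₗ² = 1. -/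
open Filter
open scoped ENNReal BigOperators

/-- The first time the (deterministic) wealth sequence `Y` reaches or exceeds the
level `l` (`= ∞` if this never happens). -/
noncomputable def dhit (Y : ℕ → ℝ) (l : ℝ) : ℝ≥0∞ :=
  sInf ((fun t : ℕ => (t : ℝ≥0∞)) '' {t : ℕ | l ≤ Y t})

lemma aux_geom (y : ℕ → ℝ) (hy : ∀ t, 0 < y t)
    (h : Tendsto (fun t => y (t+1) / y t) atTop (nhds 1)) (s : ℝ) (hs0 : 0 < s) (hs : s < 1) :
    ∃ C > 0, ∀ t, C * s ^ t ≤ y t := by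
  have h1 := h.eventually (lt_mem_nhds hs)
  obtain ⟨T, hT⟩ := eventually_atTop.1 h1
  have h2 : ∀ T : ℕ, ∃ C > 0, ∀ t ≤ T, C * s ^ t ≤ y t := by
    intro T
    induction T with
    | zero =>
      refine ⟨y 0, hy 0, ?_⟩
      intro t ht
      obtain rfl : t = 0 := by omega
      simp
    | succ k ih =>
      obtain ⟨C, hC, hk⟩ := ih
      refine ⟨min C (y (k+1) / s^(k+1)), lt_min hC (div_pos (hy _) (by positivity)), ?_⟩
      intro t ht
      rcases Nat.lt_or_ge k t with h | h
      · obtain rfl : t = k + 1 := by omega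
        calc _ ≤ (y (k+1) / s^(k+1)) * s^(k+1) := by gcongr; exact min_le_right _ _
          _ = _ := by field_simp
      · refine le_trans ?_ (hk t h)
        gcongr
        exact min_le_left _ _
  obtain ⟨C, hC, hk⟩ := h2 T
  refine ⟨C, hC, ?_⟩
  intro t
  rcases le_total t T with h | h
  · exact hk t h
  · induction t, h using Nat.le_induction with
    | base => exact hk T le_rfl
    | succ n hn ih =>
      have := hT n hn
      rw [lt_div_iff₀ (hy n)] at this
      calc C * s^(n+1) = s * (C * s^n) := by ring
        _ ≤ s * y n := by gcongr
        _ ≤ _ := this.le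

lemma aux_hit (ρ : ℝ) (hρ : 1 < ρ) (Y : ℕ → ℝ) (hle : ∀ t, Y t ≤ ρ ^ t)
    (hge : ∀ s : ℝ, 0 < s → s < 1 → ∃ C > 0, ∀ t, C * s ^ t ≤ Y t / ρ ^ t) :
    (∀ l, dhit Y l ≠ ⊤) ∧
    Tendsto (fun l => (dhit Y l).toReal / Real.log l) atTop (nhds (1 / Real.log ρ)) := by
  have hL : 0 < Real.log ρ := Real.log_pos hρ
  have hρ0 : 0 < ρ := by linarith
  have key : ∀ u : ℝ, 0 < u → u < Real.log ρ → ∃ K : ℝ, ∀ l : ℝ, 0 < l →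
      ∃ t : ℕ, l ≤ Y t ∧ (t : ℝ) ≤ max 0 ((Real.log l - K) / u) + 1 := by
    intro u hu0 hu
    obtain ⟨C, hC, h⟩ := hge (Real.exp u / ρ) (by positivity)
      (by rw [div_lt_one hρ0]; exact (Real.lt_log_iff_exp_lt hρ0).1 hu)
    refine ⟨Real.log C, fun l hl => ⟨⌈max 0 ((Real.log l - Real.log C) / u)⌉₊, ?_, ?_⟩⟩
    · set t := ⌈max 0 ((Real.log l - Real.log C) / u)⌉₊ with ht
      have h1 : (Real.log l - Real.log C) / u ≤ t := (le_max_right _ _).trans (Nat.le_ceil _)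
      rw [div_le_iff₀ hu0] at h1
      have h2 := h t
      rw [le_div_iff₀ (by positivity), div_pow, mul_assoc, div_mul_cancel₀ _ (by positivity),
        ← Real.exp_nat_mul] at h2
      refine le_trans ?_ h2
      rw [← Real.log_le_log_iff hl (by positivity), Real.log_mul hC.ne' (by positivity), Real.log_exp]
      linarith
    · exact (Nat.ceil_lt_add_one (le_max_left _ _)).le
  have hfin0 : ∀ l : ℝ, 0 < l → dhit Y l ≠ ⊤ := by
    intro l hl
    obtain ⟨K, hK⟩ := key (Real.log ρ / 2) (by linarith) (by linarith)
    obtain ⟨t, ht, -⟩ := hK l hl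
    have : dhit Y l ≤ (t : ℝ≥0∞) := sInf_le ⟨t, ht, rfl⟩
    exact ne_top_of_le_ne_top (ENNReal.natCast_ne_top t) this
  have hfin : ∀ l, dhit Y l ≠ ⊤ := by
    intro l
    refine ne_top_of_le_ne_top (hfin0 (max l 1) (by positivity)) ?_
    apply sInf_le_sInf
    apply Set.image_mono
    intro t ht
    exact le_trans (le_max_left l 1) (show max l 1 ≤ Y t from ht)
  refine ⟨hfin, ?_⟩
  have hlow : ∀ l : ℝ, 1 < l → 1 / Real.log ρ ≤ (dhit Y l).toReal / Real.log l := by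
    intro l hl
    have hl' := Real.log_pos hl
    rw [le_div_iff₀ hl']
    rw [← ENNReal.ofReal_le_iff_le_toReal (hfin l)]
    apply le_sInf
    rintro _ ⟨t, ht, rfl⟩
    simp only
    rw [← ENNReal.ofReal_natCast]
    apply ENNReal.ofReal_le_ofReal
    have h1 : l ≤ ρ ^ t := le_trans ht (hle t)
    have h2 := Real.log_le_log (by linarith) h1
    rw [Real.log_pow] at h2
    rw [one_div, inv_mul_le_iff₀ hL]
    linarith
  rw [tendsto_order]
  constructor
  · intro a ha
    filter_upwards [eventually_gt_atTop 1] with l hl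
    exact ha.trans_le (hlow l hl)
  · intro b hb
    have hb0 : 0 < b := lt_trans (by positivity) hb
    have hb' : 1 / b < Real.log ρ := by
      rw [div_lt_iff₀ hb0]; have := (div_lt_iff₀ hL).1 hb; linarith
    obtain ⟨u, hu1, hu2⟩ := exists_between hb'
    have hu0 : 0 < u := lt_trans (by positivity) hu1
    have hbu : 0 < b * u - 1 := by rw [div_lt_iff₀ hb0] at hu1; linarith
    obtain ⟨K, hK⟩ := key u hu0 hu2
    filter_upwards [eventually_gt_atTop 1,
      Real.tendsto_log_atTop.eventually_gt_atTop ((u - K) / (b * u - 1)),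
      Real.tendsto_log_atTop.eventually_gt_atTop (1 / b)] with l hl h1 h2
    obtain ⟨t, ht, ht2⟩ := hK l (by linarith)
    have h3 : (dhit Y l).toReal ≤ t := by
      have : dhit Y l ≤ (t : ℝ≥0∞) := sInf_le ⟨t, ht, rfl⟩
      simpa using ENNReal.toReal_mono (ENNReal.natCast_ne_top t) this
    rw [div_lt_iff₀ (Real.log_pos hl)]
    refine (h3.trans ht2).trans_lt ?_
    rw [div_lt_iff₀ hbu] at h1
    rw [div_lt_iff₀ hb0] at h2
    rw [← lt_sub_iff_add_lt, max_lt_iff]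
    constructor
    · linarith
    · rw [div_lt_iff₀ hu0]; linarith

lemma aux_ratio (y : ℕ → ℝ) (L : ℝ) (hL : L ≠ 0) (h : Tendsto y atTop (nhds L)) :
    Tendsto (fun t => y (t+1) / y t) atTop (nhds 1) := by
  have := ((tendsto_add_atTop_iff_nat 1).2 h).div h hL
  rwa [div_self hL] at this

/-- Proposition 1: in the deterministic model with payoffs `Xₜⁿ = Rⁿ ρᵗ`, if investor 1
uses the strategy `Λ*ₜ = R` and investor 2 uses a constant strategy `λ̃ ∈ Δ`, then
`lim_{l→∞} τₗ¹ / τₗ² = 1`. -/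
theorem deterministic_hitting_time_ratio
    {N : ℕ} (hN : 2 ≤ N) (ρ : ℝ) (hρ : 1 < ρ)
    (R : Fin N → ℝ) (ε : ℝ) (hε : 0 < ε) (hRε : ∀ n, ε ≤ R n)
    (hRΔ : R ∈ stdSimplex' N)
    -- investor 2's constant strategy
    (tlam : Fin N → ℝ) (htlam : tlam ∈ stdSimplex' N)
    -- initial wealths, with total initial wealth W₀ = 1
    (Y10 Y20 : ℝ) (hY10 : 0 < Y10) (hY20 : 0 < Y20) (hW0 : Y10 + Y20 = 1)
    -- wealth dynamics: payoffs Xₜⁿ = Rⁿ ρᵗ, investor 1 uses the strategy R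
    (Y1 Y2 : ℕ → ℝ) (hY1init : Y1 0 = Y10) (hY2init : Y2 0 = Y20)
    (hY1rec : ∀ t : ℕ, Y1 (t + 1) = ∑ n,
      R n * Y1 t / (R n * Y1 t + tlam n * Y2 t) * (R n * ρ ^ (t + 1)))
    (hY2rec : ∀ t : ℕ, Y2 (t + 1) = ∑ n,
      tlam n * Y2 t / (R n * Y1 t + tlam n * Y2 t) * (R n * ρ ^ (t + 1))) :
    Filter.Tendsto (fun l : ℝ => dhit Y1 l / dhit Y2 l) Filter.atTop (nhds 1) := by
  have hρ0 : 0 < ρ := by linarith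
  obtain ⟨-, hRs⟩ := hRΔ
  obtain ⟨hl0, hls⟩ := htlam
  have hR0 : ∀ n, 0 < R n := fun n => hε.trans_le (hRε n)
  -- basic invariants
  have inv : ∀ t, 0 < Y1 t ∧ 0 < Y2 t ∧ Y1 t + Y2 t = ρ ^ t := by
    intro t
    induction t with
    | zero => rw [hY1init, hY2init]; simp [hY10, hY20, hW0]
    | succ k ih =>
      obtain ⟨h1, h2, h3⟩ := ih
      have hq : ∀ n, 0 < R n * Y1 k + tlam n * Y2 k := fun n =>
        add_pos_of_pos_of_nonneg (mul_pos (hR0 n) h1) (mul_nonneg (hl0 n) h2.le)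
      refine ⟨?_, ?_, ?_⟩
      · rw [hY1rec]
        apply Finset.sum_pos
        · intro n _
          have := hq n; have := hR0 n
          positivity
        · exact ⟨⟨0, by omega⟩, Finset.mem_univ _⟩
      · rw [hY2rec]
        apply Finset.sum_pos'
        · intro n _
          have := hq n; have := hR0 n; have := hl0 n
          positivity
        · have : ∃ n ∈ Finset.univ, 0 < tlam n := by
            apply Finset.exists_lt_of_sum_lt
            simp [hls]
          obtain ⟨n, hn, hn'⟩ := this
          refine ⟨n, hn, ?_⟩
          have := hq n; have := hR0 n
          positivity
      · rw [hY1rec, hY2rec, ← Finset.sum_add_distrib]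
        have : ∀ n, R n * Y1 k / (R n * Y1 k + tlam n * Y2 k) * (R n * ρ ^ (k + 1)) +
            tlam n * Y2 k / (R n * Y1 k + tlam n * Y2 k) * (R n * ρ ^ (k + 1))
            = R n * ρ ^ (k+1) := by
          intro n
          rw [← add_mul, ← add_div, div_self (hq n).ne', one_mul]
        simp_rw [this]
        rw [← Finset.sum_mul, hRs, one_mul]
  -- shares
  obtain ⟨x, hx⟩ : ∃ x : ℕ → ℝ, x = fun t => Y1 t / ρ ^ t := ⟨_, rfl⟩
  obtain ⟨y, hy⟩ : ∃ y : ℕ → ℝ, y = fun t => Y2 t / ρ ^ t := ⟨_, rfl⟩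
  have hxp : ∀ t, 0 < x t := fun t => by rw [hx]; exact div_pos (inv t).1 (by positivity)
  have hyp : ∀ t, 0 < y t := fun t => by rw [hy]; exact div_pos (inv t).2.1 (by positivity)
  have hxy : ∀ t, x t + y t = 1 := fun t => by
    rw [hx, hy]; simp only; rw [← add_div, (inv t).2.2, div_self (by positivity)]
  have hYx : ∀ t, Y1 t = x t * ρ ^ t := fun t => by
    rw [hx]; simp only; field_simp
  have hYy : ∀ t, Y2 t = y t * ρ ^ t := fun t => by
    rw [hy]; simp only; field_simp
  have hq : ∀ t n, 0 < R n * x t + tlam n * y t := fun t n =>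
        add_pos_of_pos_of_nonneg (mul_pos (hR0 n) (hxp t)) (mul_nonneg (hl0 n) (hyp t).le)
  have hxrec : ∀ t, x (t+1) = x t * ∑ n, R n ^ 2 / (R n * x t + tlam n * y t) := by
    intro t
    have h := hY1rec t
    rw [hYx (t+1), hYx t, hYy t] at h
    have hp : ρ ^ (t+1) ≠ 0 := by positivity
    apply mul_right_cancel₀ hp
    rw [h, Finset.mul_sum, Finset.sum_mul]
    apply Finset.sum_congr rfl
    intro n _
    have h1 := (hq t n).ne'
    have h2 : R n * (x t * ρ ^ t) + tlam n * (y t * ρ ^ t) = (R n * x t + tlam n * y t) * ρ ^ t := by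
      ring
    rw [h2]
    field_simp
  have hyrec : ∀ t, y (t+1) = y t * ∑ n, tlam n * R n / (R n * x t + tlam n * y t) := by
    intro t
    have h := hY2rec t
    rw [hYy (t+1), hYx t, hYy t] at h
    have hp : ρ ^ (t+1) ≠ 0 := by positivity
    apply mul_right_cancel₀ hp
    rw [h, Finset.mul_sum, Finset.sum_mul]
    apply Finset.sum_congr rfl
    intro n _
    have h1 := (hq t n).ne'
    have h2 : R n * (x t * ρ ^ t) + tlam n * (y t * ρ ^ t) = (R n * x t + tlam n * y t) * ρ ^ t := by
      ring
    rw [h2]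
    field_simp
  have hmono : Monotone x := by
    apply monotone_nat_of_le_succ
    intro t
    rw [hxrec]
    apply le_mul_of_one_le_right (hxp t).le
    have hqs : ∑ n, (R n * x t + tlam n * y t) = 1 := by
      rw [Finset.sum_add_distrib, ← Finset.sum_mul, ← Finset.sum_mul, hRs, hls]
      linarith [hxy t]
    have := Finset.sq_sum_div_le_sum_sq_div Finset.univ R (fun n _ => hq t n)
    rw [hqs, hRs] at this
    simpa using this
  have hxlim : Tendsto x atTop (nhds (⨆ t, x t)) := by
    apply tendsto_atTop_ciSup hmono
    refine ⟨1, ?_⟩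
    rintro _ ⟨t, rfl⟩
    linarith [hxy t, hyp t]
  obtain ⟨X, hX⟩ : ∃ X, X = ⨆ t, x t := ⟨_, rfl⟩
  rw [← hX] at hxlim
  have hX0 : 0 < X := (hxp 0).trans_le (hmono.ge_of_tendsto hxlim 0)
  have hylim : Tendsto y atTop (nhds (1 - X)) := by
    have : y = fun t => 1 - x t := by funext t; linarith [hxy t]
    rw [this]
    exact tendsto_const_nhds.sub hxlim
  have hxr := aux_ratio x X hX0.ne' hxlim
  have hyr : Tendsto (fun t => y (t+1) / y t) atTop (nhds 1) := by
    by_cases hX1 : 1 - X = 0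
    · have e : (fun t => y (t+1) / y t) =
          fun t => ∑ n, tlam n * R n / (R n * x t + tlam n * y t) := by
        funext t
        rw [hyrec, mul_div_cancel_left₀ _ (hyp t).ne']
      rw [e]
      have hX2 : X = 1 := by linarith
      rw [hX1] at hylim
      rw [hX2] at hxlim
      have e2 : (1:ℝ) = ∑ n, tlam n * R n / (R n * 1 + tlam n * 0) := by
        refine hls.symm.trans ?_
        apply Finset.sum_congr rfl
        intro n _
        have := (hR0 n).ne'
        rw [mul_one, mul_zero, add_zero, mul_div_cancel_right₀ _ this]
      rw [e2]
      apply tendsto_finsetSum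
      intro n _
      apply Tendsto.div tendsto_const_nhds
      · exact (hxlim.const_mul _).add (hylim.const_mul _)
      · simpa using (hR0 n).ne'
    · exact aux_ratio y _ hX1 hylim
  obtain ⟨f1, T1⟩ := aux_hit ρ hρ Y1 (fun t => by linarith [(inv t).2.1, (inv t).2.2])
    (fun s h0 h1 => by
      have := aux_geom x hxp hxr s h0 h1
      rwa [hx] at this)
  obtain ⟨f2, T2⟩ := aux_hit ρ hρ Y2 (fun t => by linarith [(inv t).1, (inv t).2.2])
    (fun s h0 h1 => by
      have := aux_geom y hyp hyr s h0 h1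
      rwa [hy] at this)
  have hLp := Real.log_pos hρ
  have hne : 1 / Real.log ρ ≠ 0 := by positivity
  have T3 := T1.div T2 hne
  rw [div_self hne] at T3
  have T4 := ENNReal.tendsto_ofReal T3
  rw [ENNReal.ofReal_one] at T4
  refine T4.congr' ?_
  filter_upwards [eventually_gt_atTop 1, T2.eventually (lt_mem_nhds (show 0 < 1 / Real.log ρ by positivity))] with l hl h2
  have hl' := Real.log_pos hl
  have h3 : 0 < (dhit Y2 l).toReal := by
    have := mul_pos h2 hl'
    rwa [div_mul_cancel₀ _ hl'.ne'] at this
  simp only [Pi.div_apply]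
  rw [div_div_div_cancel_right₀ hl'.ne', ENNReal.ofReal_div_of_pos h3, ENNReal.ofReal_toReal (f1 l),
    ENNReal.ofReal_toReal (f2 l)]
end

section
/- Suppose x, y ∈ ℝᴺ have strictly positive coordinates and |x| = 1. Then ∑ₙ xⁿ (ln xⁿ − ln yⁿ) ≥ (1/4) ‖x − y/|y|‖² − ln |y|. -/
open scoped BigOperators

/-- L¹ norm of a vector in ℝᴺ: `|x| = ∑ₙ |xⁿ|`. -/
noncomputable def l1norm {N : ℕ} (x : Fin N → ℝ) : ℝ := ∑ n, |x n|

/-- Euclidean (L²) norm of a vector in ℝᴺ: `‖x‖ = (∑ₙ (xⁿ)²)^{1/2}`. -/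
noncomputable def l2norm {N : ℕ} (x : Fin N → ℝ) : ℝ := Real.sqrt (∑ n, (x n) ^ 2)

theorem gibbs_aux (a b : ℝ) (ha : 0 < a) (hb : 0 < b) (ha1 : a ≤ 1) (hb1 : b ≤ 1) :
    a - b + (1 / 4) * (a - b) ^ 2 ≤ a * (Real.log a - Real.log b) := by
  obtain ⟨s, hs, rfl⟩ : ∃ s : ℝ, 0 < s ∧ a = s ^ 2 :=
    ⟨Real.sqrt a, Real.sqrt_pos.2 ha, (Real.sq_sqrt ha.le).symm⟩
  obtain ⟨t, ht, rfl⟩ : ∃ t : ℝ, 0 < t ∧ b = t ^ 2 :=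
    ⟨Real.sqrt b, Real.sqrt_pos.2 hb, (Real.sq_sqrt hb.le).symm⟩
  have hs1 : s ≤ 1 := by nlinarith
  have ht1 : t ≤ 1 := by nlinarith
  have h := Real.log_le_sub_one_of_pos (div_pos ht hs)
  rw [Real.log_div ht.ne' hs.ne'] at h
  have h2 := mul_le_mul_of_nonneg_left h (sq_nonneg s)
  have h3 : s ^ 2 * (t / s - 1) = s * t - s ^ 2 := by field_simp
  rw [h3] at h2
  rw [Real.log_pow, Real.log_pow]
  push_cast
  have h4 : (s + t) ^ 2 ≤ 4 := by nlinarith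
  have h5 := mul_le_mul_of_nonneg_left h4 (sq_nonneg (s - t))
  nlinarith

/-- Lemma 1 (Gibbs-type inequality): if `x, y ∈ ℝᴺ` have strictly positive
coordinates and `|x| = 1`, then
`∑ₙ xⁿ (ln xⁿ − ln yⁿ) ≥ (1/4) ‖x − y/|y|‖² − ln |y|`. -/
theorem gibbs_inequality {N : ℕ} (x y : Fin N → ℝ)
    (hx : ∀ n, 0 < x n) (hy : ∀ n, 0 < y n) (hx1 : l1norm x = 1) :
    ∑ n, x n * (Real.log (x n) - Real.log (y n)) ≥
      (1 / 4) * (l2norm (fun n => x n - y n / l1norm y)) ^ 2 - Real.log (l1norm y) := by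
  have hX : ∑ n, x n = 1 := by
    rw [← hx1]; exact Finset.sum_congr rfl fun n _ => (abs_of_pos (hx n)).symm
  have hY : l1norm y = ∑ n, y n :=
    Finset.sum_congr rfl fun n _ => abs_of_pos (hy n)
  have hx_le : ∀ n, x n ≤ 1 := fun n => by
    rw [← hX]; exact Finset.single_le_sum (fun i _ => (hx i).le) (Finset.mem_univ n)
  have hy_le : ∀ n, y n ≤ l1norm y := fun n => by
    rw [hY]; exact Finset.single_le_sum (fun i _ => (hy i).le) (Finset.mem_univ n)
  have hS : 0 < l1norm y := by
    rcases Nat.eq_zero_or_pos N with h | h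
    · subst h; simp at hX
    · exact (hy ⟨0, h⟩).trans_le (hy_le _)
  set S := l1norm y with hSdef
  have hq : ∑ n, y n / S = 1 := by
    rw [← Finset.sum_div, ← hY, div_self hS.ne']
  have key : ∑ n, (x n - y n / S + (1 / 4) * (x n - y n / S) ^ 2) ≤
      ∑ n, (x n * (Real.log (x n) - Real.log (y n)) + x n * Real.log S) := by
    refine Finset.sum_le_sum fun n _ => ?_
    have h := gibbs_aux (x n) (y n / S) (hx n) (div_pos (hy n) hS) (hx_le n)
      ((div_le_one hS).2 (hy_le n))
    rw [Real.log_div (hy n).ne' hS.ne'] at h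
    linarith
  rw [Finset.sum_add_distrib, Finset.sum_add_distrib, Finset.sum_sub_distrib, hX, hq,
    ← Finset.mul_sum, ← Finset.sum_mul, hX] at key
  unfold l2norm
  rw [Real.sq_sqrt (Finset.sum_nonneg fun n _ => sq_nonneg _)]
  linarith
end

section
/- Let (Ω, F, (Fₜ)_{t≥0}, P) be a filtered probability space and Xₜ, t ≥ 1, an adapted sequence of identically distributed random variables such that Xₜ is independent of F_{t-1} and E Xₜ² < ∞ for all t ≥ 1. Denote μ = E Xₜ and σ² = Var Xₜ. Then for any stopping time τ ≥ 1, E X_τ ≤ μ + 2σ √(E τ). -/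
open MeasureTheory ProbabilityTheory Filter
open scoped ENNReal
theorem expectation_at_stopping_time_bound
    {Ω : Type*} {m0 : MeasurableSpace Ω} (P : Measure Ω) [IsProbabilityMeasure P]
    (ℱ : Filtration ℕ m0) (X : ℕ → Ω → ℝ)
    (hadapted : ∀ t : ℕ, StronglyMeasurable[ℱ (t + 1)] (X (t + 1)))
    (hident : ∀ t : ℕ, IdentDistrib (X (t + 1)) (X 1) P P)
    (hindep : ∀ t : ℕ, Indep (MeasurableSpace.comap (X (t + 1)) inferInstance) (ℱ t) P)
    (hL2 : Integrable (fun ω => (X 1 ω) ^ 2) P)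
    (τ : Ω → ℕ) (hτ : IsStoppingTime ℱ (fun ω => WithTop.some (τ ω))) (hτ1 : ∀ ω, 1 ≤ τ ω) :
    ∫⁻ ω, (τ ω : ℝ≥0∞) ∂P ≠ ∞ →
      ∫ ω, X (τ ω) ω ∂P ≤
        (∫ ω, X 1 ω ∂P) +
          2 * Real.sqrt (variance (X 1) P) * Real.sqrt ((∫⁻ ω, (τ ω : ℝ≥0∞) ∂P).toReal) := by
  intro hfin
  set μ := ∫ ω, X 1 ω ∂P with hμ
  have hXm : ∀ t, Measurable (X (t+1)) := fun t => ((hadapted t).mono (ℱ.le _)).measurable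
  have hX1 : MemLp (X 1) 2 P := (memLp_two_iff_integrable_sq (hXm 0).aestronglyMeasurable).2 hL2
  have hset : ∀ t, MeasurableSet[ℱ t] {ω | t < τ ω} := by
    intro t
    have h := (hτ t).compl
    convert h using 1
    ext ω
    simp
  have hτm : Measurable τ := by
    refine measurable_of_Ioi fun t => ?_
    exact ℱ.le t _ (hset t)
  have hXτm : Measurable (fun ω => X (τ ω) ω) := by
    have h1 : Measurable (fun p : ℕ × Ω => X (p.1 - 1 + 1) p.2) :=
      measurable_from_prod_countable_right fun n => hXm (n-1)
    have h2 := h1.comp (hτm.prodMk measurable_id)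
    convert h2 using 2 with ω
    have := hτ1 ω
    simp [Nat.sub_add_cancel this]
  have hvar : ∀ t, ∫⁻ ω, ‖X (t+1) ω - μ‖ₑ ^ 2 ∂P = evariance (X 1) P := by
    intro t
    have hh : IdentDistrib (fun ω => ‖X (t+1) ω - μ‖ₑ ^ 2) (fun ω => ‖X 1 ω - μ‖ₑ ^ 2) P P :=
      (hident t).comp (u := fun x : ℝ => ‖x - μ‖ₑ ^ 2) (by fun_prop)
    rw [hh.lintegral_eq]; rfl
  have hterm : ∀ t, ∫⁻ ω, ({ω | t < τ ω}.indicator (fun _ => (1:ℝ≥0∞)) ω) * ‖X (t+1) ω - μ‖ₑ ^ 2 ∂P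
      = (∫⁻ ω, {ω | t < τ ω}.indicator (fun _ => (1:ℝ≥0∞)) ω ∂P) * evariance (X 1) P := by
    intro t
    rw [← hvar t]
    refine lintegral_mul_eq_lintegral_mul_lintegral_of_independent_measurableSpace (ℱ.le t)
      (hXm t).comap_le (hindep t).symm (measurable_const.indicator (hset t)) ?_
    have : Measurable (fun x : ℝ => ‖x - μ‖ₑ ^ 2) := by fun_prop
    exact this.comp (comap_measurable _)
  have hsum : ∀ ω, ∑' t, {ω | t < τ ω}.indicator (fun _ => (1:ℝ≥0∞)) ω = τ ω := by
    intro ω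
    rw [tsum_eq_sum (s := Finset.range (τ ω))]
    · rw [Finset.sum_congr rfl (g := fun _ => (1:ℝ≥0∞))]
      · simp
      · intro t ht
        simpa [Set.indicator_apply] using ht
    · intro t ht
      simpa [Set.indicator_apply] using ht
  have key : ∫⁻ ω, ‖X (τ ω) ω - μ‖ₑ ^ 2 ∂P ≤ (∫⁻ ω, (τ ω : ℝ≥0∞) ∂P) * evariance (X 1) P := by
    have hm : ∀ t, Measurable ({ω | t < τ ω}.indicator (fun _ => (1:ℝ≥0∞))) := fun t =>
      measurable_const.indicator (ℱ.le t _ (hset t))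
    calc ∫⁻ ω, ‖X (τ ω) ω - μ‖ₑ ^ 2 ∂P 
        ≤ ∫⁻ ω, ∑' t, ({ω | t < τ ω}.indicator (fun _ => (1:ℝ≥0∞)) ω) * ‖X (t+1) ω - μ‖ₑ ^ 2 ∂P := by
          refine lintegral_mono fun ω => ?_
          refine le_trans ?_ (ENNReal.le_tsum (τ ω - 1))
          have := hτ1 ω
          have h2 : τ ω - 1 < τ ω := by omega
          simp [Nat.sub_add_cancel this, Set.indicator_apply, h2]
      _ = _ := by
          have hm2 : ∀ t, AEMeasurable (fun ω => ({ω | t < τ ω}.indicator (fun _ => (1:ℝ≥0∞)) ω) *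
              ‖X (t+1) ω - μ‖ₑ ^ 2) P := fun t =>
            ((hm t).mul ((((hXm t).sub_const μ).enorm).pow_const 2)).aemeasurable
          rw [lintegral_tsum hm2]
          simp_rw [hterm, ENNReal.tsum_mul_right]
          rw [← lintegral_tsum fun t => (hm t).aemeasurable]
          simp_rw [hsum]
  have hev : evariance (X 1) P ≠ ∞ := hX1.evariance_lt_top.ne
  have hkt := (key.trans_lt (ENNReal.mul_lt_top hfin.lt_top hev.lt_top))
  have hZm : Measurable (fun ω => X (τ ω) ω - μ) := hXτm.sub_const μ
  have hofr : ∀ x : ℝ, ENNReal.ofReal (x ^ 2) = ‖x‖ₑ ^ 2 := fun x => by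
    rw [← sq_abs, ENNReal.ofReal_pow (abs_nonneg _), Real.enorm_eq_ofReal_abs]
  have hZ2 : Integrable (fun ω => (X (τ ω) ω - μ) ^ 2) P := by
    refine ⟨(hZm.pow_const 2).aestronglyMeasurable, ?_⟩
    rw [HasFiniteIntegral]
    simpa [enorm_pow] using hkt
  have hZ : MemLp (fun ω => X (τ ω) ω - μ) 2 P :=
    (memLp_two_iff_integrable_sq hZm.aestronglyMeasurable).2 hZ2
  have hZi : Integrable (fun ω => X (τ ω) ω - μ) P := hZ.integrable (by norm_num)
  have e1 : ∫ ω, X (τ ω) ω ∂P = μ + ∫ ω, (X (τ ω) ω - μ) ∂P := by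
    have : ∫ ω, X (τ ω) ω ∂P = ∫ ω, (μ + (X (τ ω) ω - μ)) ∂P := by simp
    rw [this, integral_add (integrable_const _) hZi]; simp
  have e2 : (∫ ω, (X (τ ω) ω - μ) ∂P) ^ 2 ≤ ∫ ω, (X (τ ω) ω - μ) ^ 2 ∂P := by
    have h := variance_nonneg (fun ω => X (τ ω) ω - μ) P
    rw [variance_eq_sub hZ] at h
    simpa using h
  have e3 : ∫ ω, (X (τ ω) ω - μ) ^ 2 ∂P ≤ variance (X 1) P * (∫⁻ ω, (τ ω : ℝ≥0∞) ∂P).toReal := by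
    rw [integral_eq_lintegral_of_nonneg_ae (ae_of_all _ fun ω => sq_nonneg _) hZ2.1]
    simp_rw [hofr]
    rw [variance, mul_comm, ← ENNReal.toReal_mul]
    exact ENNReal.toReal_mono (ENNReal.mul_ne_top hfin hev) key
  have e4 := Real.le_sqrt_of_sq_le (e2.trans e3)
  rw [Real.sqrt_mul (variance_nonneg _ _)] at e4
  have e5 : 0 ≤ √(variance (X 1) P) * √((∫⁻ ω, (τ ω : ℝ≥0∞) ∂P).toReal) := by positivity
  rw [e1]
  linarith
end

section
/- In the two-investor relative wealth dynamics, the process ln rₜ is a submartingale; more precisely, for every t ≥ 1, E(ln rₜ | F_{t-1}) − ln r_{t-1} ≥ ∑ₙ λₜⁿ (ln λₜⁿ − ln βₜⁿ) ≥ (1/4)(1 − r_{t-1})² ‖λₜ − λ̃ₜ‖² ≥ 0, where βₜⁿ = r_{t-1} λₜⁿ + (1 − r_{t-1}) λ̃ₜⁿ. -/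
open MeasureTheory ProbabilityTheory Filter
open scoped ENNReal BigOperators

theorem aux_kl {l b : ℝ} (hl : 0 < l) (hl1 : l ≤ 1) (hb : 0 < b) (hb1 : b ≤ 1) :
    l - b + (l - b) ^ 2 / 4 ≤ l * (Real.log l - Real.log b) := by
  obtain ⟨x, hx, rfl⟩ : ∃ x : ℝ, 0 < x ∧ l = x ^ 2 :=
    ⟨Real.sqrt l, Real.sqrt_pos.2 hl, (Real.sq_sqrt hl.le).symm⟩
  obtain ⟨y, hy, rfl⟩ : ∃ y : ℝ, 0 < y ∧ b = y ^ 2 :=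
    ⟨Real.sqrt b, Real.sqrt_pos.2 hb, (Real.sq_sqrt hb.le).symm⟩
  have hx1 : x ≤ 1 := by nlinarith
  have hy1 : y ≤ 1 := by nlinarith
  have h := Real.log_le_sub_one_of_pos (div_pos hy hx)
  rw [Real.log_div hy.ne' hx.ne'] at h
  rw [Real.log_pow, Real.log_pow]
  have h2 : x ^ 2 * (1 - y / x) ≤ x ^ 2 * (Real.log x - Real.log y) :=
    mul_le_mul_of_nonneg_left (by linarith) (by positivity)
  have h3 : x ^ 2 * (1 - y / x) = x ^ 2 - x * y := by field_simp
  have h4 : (x + y) ^ 2 ≤ 4 := by nlinarith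
  have h5 : (x - y) ^ 2 * (x + y) ^ 2 ≤ (x - y) ^ 2 * 4 :=
    mul_le_mul_of_nonneg_left h4 (sq_nonneg _)
  push_cast
  nlinarith

theorem aux_beta {N : ℕ} {lam tl : Fin N → ℝ} {r ε c : ℝ} (hε : 0 < ε)
    (hlam : lam ∈ stdSimplex' N) (hlε : ∀ n, ε ≤ lam n) (htl : tl ∈ stdSimplex' N)
    (hc : 0 < c) (hcr : c ≤ r) (hr1 : r ≤ 1) (n : Fin N) :
    lam n ≤ 1 ∧ c * ε ≤ r * lam n + (1 - r) * tl n ∧ r * lam n + (1 - r) * tl n ≤ 1 ∧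
      r * lam n ≤ r * lam n + (1 - r) * tl n := by
  have h1 : lam n ≤ 1 := hlam.2 ▸ Finset.single_le_sum (fun i _ => hlam.1 i) (Finset.mem_univ n)
  have h2 : tl n ≤ 1 := htl.2 ▸ Finset.single_le_sum (fun i _ => htl.1 i) (Finset.mem_univ n)
  have h3 := htl.1 n
  have h4 := hlε n
  have h5 : 0 ≤ (1 - r) * tl n := mul_nonneg (by linarith) h3
  refine ⟨h1, ?_, ?_, by linarith⟩
  · have : c * ε ≤ r * lam n := mul_le_mul hcr h4 hε.le (by linarith)
    linarith
  · nlinarith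

theorem aux_step_s5 {N : ℕ} {lam tl R : Fin N → ℝ} {r ε c : ℝ} (hε : 0 < ε)
    (hlam : lam ∈ stdSimplex' N) (hlε : ∀ n, ε ≤ lam n) (htl : tl ∈ stdSimplex' N)
    (hR : R ∈ stdSimplex' N) (hc : 0 < c) (hcr : c ≤ r) (hr1 : r ≤ 1) :
    c * ε ≤ r * ∑ n, lam n * R n / (r * lam n + (1 - r) * tl n) ∧
    r * ∑ n, lam n * R n / (r * lam n + (1 - r) * tl n) ≤ 1 ∧
    Real.log r + ∑ n, R n * (Real.log (lam n) - Real.log (r * lam n + (1 - r) * tl n)) ≤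
      Real.log (r * ∑ n, lam n * R n / (r * lam n + (1 - r) * tl n)) ∧
    (1 / 4) * (1 - r) ^ 2 * (l2norm (fun n => lam n - tl n)) ^ 2 ≤
      ∑ n, lam n * (Real.log (lam n) - Real.log (r * lam n + (1 - r) * tl n)) := by
  have hb := aux_beta hε hlam hlε htl hc hcr hr1
  have hr : 0 < r := by linarith
  have hl : ∀ n, 0 < lam n := fun n => by linarith [hlε n]
  have hbp : ∀ n, 0 < r * lam n + (1 - r) * tl n := fun n =>
    lt_of_lt_of_le (by positivity) (hb n).2.1
  have hsum : ∑ n, (r * lam n + (1 - r) * tl n) = 1 := by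
    rw [Finset.sum_add_distrib, ← Finset.mul_sum, ← Finset.mul_sum, hlam.2, htl.2]; ring
  have h1 : c * ε ≤ r * ∑ n, lam n * R n / (r * lam n + (1 - r) * tl n) := by
    have : ε ≤ ∑ n, lam n * R n / (r * lam n + (1 - r) * tl n) := by
      calc ε = ∑ n, ε * R n := by rw [← Finset.mul_sum, hR.2, mul_one]
        _ ≤ _ := by
          refine Finset.sum_le_sum fun n _ => ?_
          rw [le_div_iff₀ (hbp n)]
          have := hR.1 n
          have h5 : ε * R n ≤ lam n * R n := mul_le_mul_of_nonneg_right (hlε n) this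
          have h6 : 0 ≤ ε * R n := mul_nonneg hε.le this
          nlinarith [(hb n).2.2.1]
    exact mul_le_mul hcr this hε.le hr.le
  refine ⟨h1, ?_, ?_, ?_⟩
  · rw [Finset.mul_sum]
    refine le_trans ?_ hR.2.le
    refine Finset.sum_le_sum fun n _ => ?_
    rw [← mul_div_assoc, div_le_iff₀ (hbp n)]
    nlinarith [hR.1 n, mul_le_mul_of_nonneg_right (hb n).2.2.2 (hR.1 n)]
  · have hpos : 0 < ∑ n, lam n * R n / (r * lam n + (1 - r) * tl n) := by
      have : 0 < r * ∑ n, lam n * R n / (r * lam n + (1 - r) * tl n) :=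
        lt_of_lt_of_le (by positivity) h1
      exact (mul_pos_iff_of_pos_left hr).1 this
    rw [Real.log_mul hr.ne' hpos.ne']
    have := strictConcaveOn_log_Ioi.concaveOn.le_map_sum (t := Finset.univ) (w := R)
      (p := fun n => lam n / (r * lam n + (1 - r) * tl n)) (fun i _ => hR.1 i) hR.2
      (fun i _ => div_pos (hl i) (hbp i))
    simp only [smul_eq_mul] at this
    have e1 : ∀ n, R n * (lam n / (r * lam n + (1 - r) * tl n)) =
      lam n * R n / (r * lam n + (1 - r) * tl n) := fun n => by ring
    have e2 : ∀ n, Real.log (lam n / (r * lam n + (1 - r) * tl n)) =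
      Real.log (lam n) - Real.log (r * lam n + (1 - r) * tl n) := fun n =>
        Real.log_div (hl n).ne' (hbp n).ne'
    simp only [e1, e2] at this
    linarith
  · have hn : (l2norm (fun n => lam n - tl n)) ^ 2 = ∑ n, (lam n - tl n) ^ 2 := by
      unfold l2norm
      exact Real.sq_sqrt (Finset.sum_nonneg fun i _ => sq_nonneg _)
    rw [hn]
    calc _ = ∑ n, (lam n - (r * lam n + (1 - r) * tl n) +
          (lam n - (r * lam n + (1 - r) * tl n)) ^ 2 / 4) := by
          rw [Finset.sum_add_distrib, Finset.sum_sub_distrib, hsum, hlam.2, Finset.mul_sum,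
            sub_self, zero_add]
          exact Finset.sum_congr rfl fun n _ => by ring
      _ ≤ _ := Finset.sum_le_sum fun n _ => aux_kl (hl n) (hb n).1 (hbp n) (hb n).2.2.1

theorem aux_abs_log {a x : ℝ} (ha : 0 < a) (hx : a ≤ x) (hx1 : x ≤ 1) :
    |Real.log x| ≤ -Real.log a := by
  rw [abs_of_nonpos (Real.log_nonpos (by linarith) hx1)]
  linarith [Real.log_le_log ha hx]

/-- In the two-investor relative wealth dynamics, `ln rₜ` is a submartingale; more
precisely, for every `t ≥ 1`,
`E(ln rₜ | F_{t-1}) − ln r_{t-1} ≥ ∑ₙ λₜⁿ (ln λₜⁿ − ln βₜⁿ) ≥ (1/4)(1 − r_{t-1})² ‖λₜ − λ̃ₜ‖² ≥ 0`,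
where `βₜⁿ = r_{t-1} λₜⁿ + (1 − r_{t-1}) λ̃ₜⁿ`. -/
theorem log_relative_wealth_submartingale
    {Ω : Type*} {m0 : MeasurableSpace Ω} (P : Measure Ω) [IsProbabilityMeasure P]
    (ℱ : Filtration ℕ m0) {N : ℕ} (hN : 2 ≤ N)
    (R : ℕ → Fin N → Ω → ℝ) (ε : ℝ) (hε : 0 < ε)
    (hRadapted : ∀ t n, StronglyMeasurable[ℱ (t + 1)] (R (t + 1) n))
    (hRsimplex : ∀ t ω, (fun n => R (t + 1) n ω) ∈ stdSimplex' N)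
    (hRcond : ∀ t n, ∀ᵐ ω ∂P, ε ≤ (P[R (t + 1) n | ℱ t]) ω)
    -- investor 1 uses the strategy `λₜⁿ = E(Rₜⁿ | F_{t-1})`
    (lam : ℕ → Fin N → Ω → ℝ)
    (hlam : ∀ t n ω, lam (t + 1) n ω = (P[R (t + 1) n | ℱ t]) ω)
    -- investor 2 uses an adapted Δ-valued sequence `λ̃ₜ`
    (tlam : ℕ → Fin N → Ω → ℝ)
    (htlam_adapted : ∀ t n, StronglyMeasurable[ℱ t] (tlam (t + 1) n))
    (htlam_simplex : ∀ t ω, (fun n => tlam (t + 1) n ω) ∈ stdSimplex' N)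
    -- relative wealth of investor 1
    (r : ℕ → Ω → ℝ) (r0 : ℝ) (hr0pos : 0 < r0) (hr0lt : r0 < 1)
    (hr0 : ∀ ω, r 0 ω = r0)
    (hrec : ∀ t ω, r (t + 1) ω =
      r t ω * ∑ n, lam (t + 1) n ω * R (t + 1) n ω /
        (r t ω * lam (t + 1) n ω + (1 - r t ω) * tlam (t + 1) n ω)) :
    Submartingale (fun t ω => Real.log (r t ω)) ℱ P ∧
    ∀ t : ℕ, ∀ᵐ ω ∂P,
      (P[fun ω' => Real.log (r (t + 1) ω') | ℱ t]) ω - Real.log (r t ω) ≥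
          ∑ n, lam (t + 1) n ω *
            (Real.log (lam (t + 1) n ω) -
             Real.log (r t ω * lam (t + 1) n ω + (1 - r t ω) * tlam (t + 1) n ω)) ∧
      ∑ n, lam (t + 1) n ω *
          (Real.log (lam (t + 1) n ω) -
           Real.log (r t ω * lam (t + 1) n ω + (1 - r t ω) * tlam (t + 1) n ω)) ≥
        (1 / 4) * (1 - r t ω) ^ 2 *
          (l2norm (fun n => lam (t + 1) n ω - tlam (t + 1) n ω)) ^ 2 ∧
      (1 / 4) * (1 - r t ω) ^ 2 *
          (l2norm (fun n => lam (t + 1) n ω - tlam (t + 1) n ω)) ^ 2 ≥ 0 := by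
  have hRint : ∀ t n, Integrable (R (t + 1) n) P := fun t n => by
    refine Integrable.of_bound
      ((hRadapted t n).mono (ℱ.le _)).aestronglyMeasurable 1 (Eventually.of_forall fun ω => ?_)
    have h := hRsimplex t ω
    rw [Real.norm_eq_abs, abs_of_nonneg (h.1 n)]
    exact h.2 ▸ Finset.single_le_sum (f := fun n => R (t + 1) n ω)
      (fun i _ => h.1 i) (Finset.mem_univ n)
  have hlam' : ∀ t n, lam (t + 1) n = P[R (t + 1) n | ℱ t] := fun t n => funext (hlam t n)
  have hlamsm : ∀ t n, StronglyMeasurable[ℱ t] (lam (t + 1) n) := fun t n => by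
    rw [hlam']; exact stronglyMeasurable_condExp
  have hlε : ∀ t, ∀ᵐ ω ∂P, ∀ n, ε ≤ lam (t + 1) n ω := fun t => by
    rw [ae_all_iff]
    intro n
    filter_upwards [hRcond t n] with ω hω
    rw [hlam]; exact hω
  have hlsim : ∀ t, ∀ᵐ ω ∂P, (fun n => lam (t + 1) n ω) ∈ stdSimplex' N := fun t => by
    have h1 : P[∑ n, R (t + 1) n | ℱ t] =ᵐ[P] ∑ n, P[R (t + 1) n | ℱ t] :=
      condExp_finsetSum (fun n _ => hRint t n) _
    have h2 : (∑ n, R (t + 1) n) = fun _ => (1 : ℝ) := by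
      funext ω
      rw [Finset.sum_apply]; exact (hRsimplex t ω).2
    rw [h2, condExp_const (ℱ.le t)] at h1
    filter_upwards [h1, hlε t] with ω h3 h4
    refine ⟨fun n => hε.le.trans (h4 n), ?_⟩
    rw [Finset.sum_apply] at h3
    simp only [hlam]
    exact h3.symm
  have hrb : ∀ t, ∃ c, 0 < c ∧ ∀ᵐ ω ∂P, c ≤ r t ω ∧ r t ω ≤ 1 := by
    intro t
    induction t with
    | zero => exact ⟨r0, hr0pos, Eventually.of_forall fun ω => by rw [hr0]; exact ⟨le_rfl, hr0lt.le⟩⟩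
    | succ t ih =>
      obtain ⟨c, hc, h⟩ := ih
      refine ⟨c * ε, by positivity, ?_⟩
      filter_upwards [h, hlε t, hlsim t] with ω h1 h2 h3
      have := aux_step_s5 hε h3 h2 (htlam_simplex t ω) (hRsimplex t ω) hc h1.1 h1.2
      rw [hrec]
      exact ⟨this.1, this.2.1⟩
  have hrm : ∀ t, Measurable[ℱ t] (r t) := by
    intro t
    induction t with
    | zero =>
      have : r 0 = fun _ => r0 := funext hr0
      rw [this]; exact measurable_const
    | succ t ih =>
      have hle := ℱ.mono (Nat.le_succ t)
      have e : r (t + 1) = fun ω => r t ω * ∑ n, lam (t + 1) n ω * R (t + 1) n ω /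
        (r t ω * lam (t + 1) n ω + (1 - r t ω) * tlam (t + 1) n ω) := funext (hrec t)
      rw [e]
      have m1 : Measurable[ℱ (t + 1)] (r t) := ih.mono hle le_rfl
      have m2 := fun n => ((hlamsm t n).mono hle).measurable
      have m3 := fun n => ((htlam_adapted t n).mono hle).measurable
      have m4 := fun n => (hRadapted t n).measurable
      exact m1.mul (Finset.measurable_fun_sum _ fun n _ =>
        ((m2 n).mul (m4 n)).div ((m1.mul (m2 n)).add ((measurable_const.sub m1).mul (m3 n))))
  have hlogsm : ∀ t, StronglyMeasurable[ℱ t] (fun ω => Real.log (r t ω)) := fun t =>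
    (Real.measurable_log.comp (hrm t)).stronglyMeasurable
  have hlogint : ∀ t, Integrable (fun ω => Real.log (r t ω)) P := fun t => by
    obtain ⟨c, hc, h⟩ := hrb t
    refine Integrable.of_bound ((hlogsm t).mono (ℱ.le t)).aestronglyMeasurable (-Real.log c) ?_
    filter_upwards [h] with ω hω
    exact aux_abs_log hc hω.1 hω.2
  have main : ∀ t : ℕ, ∀ᵐ ω ∂P,
      (P[fun ω' => Real.log (r (t + 1) ω') | ℱ t]) ω - Real.log (r t ω) ≥
          ∑ n, lam (t + 1) n ω *
            (Real.log (lam (t + 1) n ω) -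
             Real.log (r t ω * lam (t + 1) n ω + (1 - r t ω) * tlam (t + 1) n ω)) ∧
      ∑ n, lam (t + 1) n ω *
          (Real.log (lam (t + 1) n ω) -
           Real.log (r t ω * lam (t + 1) n ω + (1 - r t ω) * tlam (t + 1) n ω)) ≥
        (1 / 4) * (1 - r t ω) ^ 2 *
          (l2norm (fun n => lam (t + 1) n ω - tlam (t + 1) n ω)) ^ 2 ∧
      (1 / 4) * (1 - r t ω) ^ 2 *
          (l2norm (fun n => lam (t + 1) n ω - tlam (t + 1) n ω)) ^ 2 ≥ 0 := by
    intro t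
    obtain ⟨c, hc, h⟩ := hrb t
    let g : Fin N → Ω → ℝ := fun n ω => Real.log (lam (t + 1) n ω) -
             Real.log (r t ω * lam (t + 1) n ω + (1 - r t ω) * tlam (t + 1) n ω)
    have gsm : ∀ n, StronglyMeasurable[ℱ t] (g n) := fun n => by
      have m2 := (hlamsm t n).measurable
      have m3 := (htlam_adapted t n).measurable
      have m1 := hrm t
      exact ((Real.measurable_log.comp m2).sub (Real.measurable_log.comp
        ((m1.mul m2).add ((measurable_const.sub m1).mul m3)))).stronglyMeasurable
    have gbd : ∀ n, ∀ᵐ ω ∂P, ‖g n ω‖ ≤ -Real.log ε + -Real.log (c * ε) := fun n => by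
      filter_upwards [h, hlε t, hlsim t] with ω h1 h2 h3
      have hb := aux_beta hε h3 h2 (htlam_simplex t ω) hc h1.1 h1.2 n
      exact (abs_sub _ _).trans (add_le_add (aux_abs_log hε (h2 n) hb.1)
        (aux_abs_log (by positivity) hb.2.1 hb.2.2.1))
    have hint : ∀ n, Integrable (R (t + 1) n * g n) P := fun n =>
      (hRint t n).mul_bdd ((gsm n).mono (ℱ.le t)).aestronglyMeasurable (gbd n)
    have hpull : ∀ n, P[R (t + 1) n * g n | ℱ t] =ᵐ[P] P[R (t + 1) n | ℱ t] * g n := fun n =>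
      condExp_mul_of_stronglyMeasurable_right (gsm n) (hint n) (hRint t n)
    have hsumint : Integrable (∑ n, R (t + 1) n * g n) P :=
      integrable_finsetSum' _ fun n _ => hint n
    have hcs : P[∑ n, R (t + 1) n * g n | ℱ t] =ᵐ[P] ∑ n, P[R (t + 1) n * g n | ℱ t] :=
      condExp_finsetSum (fun n _ => hint n) _
    have hadd := condExp_add (hlogint t) hsumint (ℱ t)
    have hself : P[fun ω => Real.log (r t ω) | ℱ t] = fun ω => Real.log (r t ω) :=
      condExp_of_stronglyMeasurable (ℱ.le t) (hlogsm t) (hlogint t)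
    have hmono : P[(fun ω => Real.log (r t ω)) + ∑ n, R (t + 1) n * g n | ℱ t] ≤ᵐ[P]
        P[fun ω' => Real.log (r (t + 1) ω') | ℱ t] := by
      refine condExp_mono ((hlogint t).add hsumint) (hlogint (t + 1)) ?_
      filter_upwards [h, hlε t, hlsim t] with ω h1 h2 h3
      have := (aux_step_s5 hε h3 h2 (htlam_simplex t ω) (hRsimplex t ω) hc h1.1 h1.2).2.2.1
      simp only [Pi.add_apply, Finset.sum_apply, Pi.mul_apply, g]
      rw [hrec]
      exact this
    filter_upwards [h, hlε t, hlsim t, hmono, hadd, hcs, ae_all_iff.2 hpull]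
      with ω h1 h2 h3 h4 h5 h6 h7
    refine ⟨?_, (aux_step_s5 hε h3 h2 (htlam_simplex t ω) (hRsimplex t ω) hc h1.1 h1.2).2.2.2,
      by positivity⟩
    rw [h5, Pi.add_apply, hself, h6, Finset.sum_apply, Finset.sum_congr rfl fun n _ => h7 n] at h4
    simp only [Pi.mul_apply, ← hlam, g] at h4
    linarith
  refine ⟨submartingale_nat (fun t => hlogsm t) hlogint fun t => ?_, main⟩
  filter_upwards [main t] with ω hω
  linarith [hω.1, hω.2.1, hω.2.2]
end

section
/- In the two-investor relative wealth dynamics, with probability 1 the limit lim_{t→∞} ln rₜ exists and is finite, and consequently inf_{t≥0} rₜ > 0 almost surely (i.e. λ* is a survival strategy). -/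
open MeasureTheory ProbabilityTheory Filter
open scoped ENNReal BigOperators

lemma survival_step {N : ℕ} (R l u : Fin N → ℝ) (r ε : ℝ) (hε : 0 < ε)
    (hR : R ∈ stdSimplex' N) (hu : u ∈ stdSimplex' N) (hl : ∀ n, ε ≤ l n)
    (h0 : 0 < r) (h1 : r ≤ 1) (r' : ℝ)
    (hr' : r' = r * ∑ n, l n * R n / (r * l n + (1 - r) * u n)) :
    0 < r' ∧ r' ≤ 1 ∧ r'⁻¹ - 1 ≤ (r⁻¹ - 1) * ∑ n, u n / l n * R n := by
  obtain ⟨hR0, hR1⟩ := hR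
  obtain ⟨hu0, hu1⟩ := hu
  have hlp : ∀ n, 0 < l n := fun n => hε.trans_le (hl n)
  have hd : ∀ n, 0 < r * l n + (1 - r) * u n := fun n => by
    have := mul_pos h0 (hlp n)
    have := mul_nonneg (sub_nonneg.2 h1) (hu0 n)
    linarith
  have hcs : (∑ n, R n) ^ 2 ≤ (∑ n, l n * R n / (r * l n + (1 - r) * u n)) *
      ∑ n, R n * (r * l n + (1 - r) * u n) / l n := by
    apply Finset.sum_sq_le_sum_mul_sum_of_sq_le_mul
    · intro n _
      exact div_nonneg (mul_nonneg (hlp n).le (hR0 n)) (hd n).le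
    · intro n _
      exact div_nonneg (mul_nonneg (hR0 n) (hd n).le) (hlp n).le
    · intro n _
      have hd' := (hd n).ne'
      have hl' := (hlp n).ne'
      generalize r * l n + (1 - r) * u n = d at hd' ⊢
      apply le_of_eq
      field_simp
  have hB : ∑ n, R n * (r * l n + (1 - r) * u n) / l n
      = r + (1 - r) * ∑ n, u n / l n * R n := by
    have hr : r = ∑ n, r * R n := by rw [← Finset.mul_sum, hR1, mul_one]
    conv_rhs => rw [Finset.mul_sum]; lhs; rw [hr]
    rw [← Finset.sum_add_distrib]
    refine Finset.sum_congr rfl fun n _ => ?_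
    have := (hlp n).ne'
    field_simp
  rw [hR1, hB] at hcs
  set A := ∑ n, l n * R n / (r * l n + (1 - r) * u n) with hA
  set G := ∑ n, u n / l n * R n with hG
  have hA0 : 0 ≤ A := Finset.sum_nonneg fun n _ =>
    div_nonneg (mul_nonneg (hlp n).le (hR0 n)) (hd n).le
  have hApos : 0 < A := by
    rcases hA0.eq_or_lt with h | h
    · rw [← h] at hcs; norm_num at hcs
    · exact h
  have hrA : 0 < r * A := mul_pos h0 hApos
  refine ⟨hr' ▸ hrA, ?_, ?_⟩
  · rw [hr', hA, Finset.mul_sum]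
    refine le_trans ?_ hR1.le
    refine Finset.sum_le_sum fun n _ => ?_
    rw [← mul_div_assoc, div_le_iff₀ (hd n)]
    nlinarith [mul_nonneg (hR0 n) (mul_nonneg (sub_nonneg.2 h1) (hu0 n))]
  · have h2 : r'⁻¹ ≤ r⁻¹ * (r + (1 - r) * G) := by
      rw [hr', mul_inv]
      refine mul_le_mul_of_nonneg_left ?_ (inv_nonneg.2 h0.le)
      rw [inv_le_iff_one_le_mul₀' hApos]
      linarith
    have h3 : r⁻¹ * (r + (1 - r) * G) = 1 + (r⁻¹ - 1) * G := by
      field_simp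
    linarith

/-- In the two-investor relative wealth dynamics, with probability 1 the limit
`lim_{t→∞} ln rₜ` exists and is finite, and consequently `inf_{t≥0} rₜ > 0`
almost surely (i.e. `λ*` is a survival strategy). -/
theorem survival_strategy
    {Ω : Type*} {m0 : MeasurableSpace Ω} (P : Measure Ω) [IsProbabilityMeasure P]
    (ℱ : Filtration ℕ m0) {N : ℕ} (hN : 2 ≤ N)
    (R : ℕ → Fin N → Ω → ℝ) (ε : ℝ) (hε : 0 < ε)
    (hRadapted : ∀ t n, StronglyMeasurable[ℱ (t + 1)] (R (t + 1) n))
    (hRsimplex : ∀ t ω, (fun n => R (t + 1) n ω) ∈ stdSimplex' N)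
    (hRcond : ∀ t n, ∀ᵐ ω ∂P, ε ≤ (P[R (t + 1) n | ℱ t]) ω)
    -- investor 1 uses the strategy `λₜⁿ = E(Rₜⁿ | F_{t-1})`
    (lam : ℕ → Fin N → Ω → ℝ)
    (hlam : ∀ t n ω, lam (t + 1) n ω = (P[R (t + 1) n | ℱ t]) ω)
    -- investor 2 uses an adapted Δ-valued sequence `λ̃ₜ`
    (tlam : ℕ → Fin N → Ω → ℝ)
    (htlam_adapted : ∀ t n, StronglyMeasurable[ℱ t] (tlam (t + 1) n))
    (htlam_simplex : ∀ t ω, (fun n => tlam (t + 1) n ω) ∈ stdSimplex' N)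
    -- relative wealth of investor 1
    (r : ℕ → Ω → ℝ) (r0 : ℝ) (hr0pos : 0 < r0) (hr0lt : r0 < 1)
    (hr0 : ∀ ω, r 0 ω = r0)
    (hrec : ∀ t ω, r (t + 1) ω =
      r t ω * ∑ n, lam (t + 1) n ω * R (t + 1) n ω /
        (r t ω * lam (t + 1) n ω + (1 - r t ω) * tlam (t + 1) n ω)) :
    ∀ᵐ ω ∂P,
      (∃ L : ℝ, Filter.Tendsto (fun t => Real.log (r t ω)) Filter.atTop (nhds L)) ∧
      0 < ⨅ t : ℕ, r t ω := by
  have hR01 : ∀ t n ω, 0 ≤ R (t + 1) n ω ∧ R (t + 1) n ω ≤ 1 := fun t n ω => by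
    obtain ⟨h0, h1⟩ := hRsimplex t ω
    exact ⟨h0 n, h1 ▸ Finset.single_le_sum (f := fun n => R (t + 1) n ω)
      (fun i _ => h0 i) (Finset.mem_univ n)⟩
  have hu01 : ∀ t n ω, 0 ≤ tlam (t + 1) n ω ∧ tlam (t + 1) n ω ≤ 1 := fun t n ω => by
    obtain ⟨h0, h1⟩ := htlam_simplex t ω
    exact ⟨h0 n, h1 ▸ Finset.single_le_sum (f := fun n => tlam (t + 1) n ω)
      (fun i _ => h0 i) (Finset.mem_univ n)⟩
  have hlmeas : ∀ t n, Measurable[ℱ t] (lam (t + 1) n) := fun t n => by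
    have : lam (t + 1) n = P[R (t + 1) n | ℱ t] := funext (hlam t n)
    rw [this]
    exact stronglyMeasurable_condExp.measurable
  have hrmeas : ∀ t, Measurable[ℱ t] (r t) := by
    intro t
    induction t with
    | zero =>
      have : r 0 = fun _ => r0 := funext hr0
      rw [this]
      exact measurable_const
    | succ t ih =>
      have hle : ℱ t ≤ ℱ (t + 1) := ℱ.mono (Nat.le_succ t)
      have e : r (t + 1) = fun ω => r t ω * ∑ n, lam (t + 1) n ω * R (t + 1) n ω /
        (r t ω * lam (t + 1) n ω + (1 - r t ω) * tlam (t + 1) n ω) := funext (hrec t)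
      rw [e]
      have h1 := ih.mono hle le_rfl
      have h2 := fun n => (hlmeas t n).mono hle le_rfl
      have h3 := fun n => (htlam_adapted t n).measurable.mono hle le_rfl
      have h4 := fun n => (hRadapted t n).measurable
      refine h1.mul (Finset.measurable_fun_sum _ fun n _ => ?_)
      exact ((h2 n).mul (h4 n)).div ((h1.mul (h2 n)).add ((measurable_const.sub h1).mul (h3 n)))
  have hlae : ∀ᵐ ω ∂P, ∀ t n, ε ≤ lam (t + 1) n ω := by
    rw [ae_all_iff]; intro t
    rw [ae_all_iff]; intro n
    filter_upwards [hRcond t n] with ω h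
    rwa [hlam]
  have hr01 : ∀ᵐ ω ∂P, ∀ t, 0 < r t ω ∧ r t ω ≤ 1 := by
    filter_upwards [hlae] with ω h t
    induction t with
    | zero => rw [hr0]; exact ⟨hr0pos, hr0lt.le⟩
    | succ t ih =>
      have := survival_step _ _ _ _ ε hε (hRsimplex t ω) (htlam_simplex t ω) (h t) ih.1 ih.2 _
        (hrec t ω)
      exact ⟨this.1, this.2.1⟩
  have hstep : ∀ᵐ ω ∂P, ∀ t, (r (t + 1) ω)⁻¹ - 1 ≤
      ∑ n, ((r t ω)⁻¹ - 1) * (tlam (t + 1) n ω / lam (t + 1) n ω) * R (t + 1) n ω := by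
    filter_upwards [hlae, hr01] with ω h h' t
    have := (survival_step _ _ _ _ ε hε (hRsimplex t ω) (htlam_simplex t ω) (h t) (h' t).1
      (h' t).2 _ (hrec t ω)).2.2
    rw [Finset.mul_sum] at this
    simpa only [mul_assoc] using this
  have hX0 : ∀ᵐ ω ∂P, ∀ t, 0 ≤ (r t ω)⁻¹ - 1 := by
    filter_upwards [hr01] with ω h t
    exact sub_nonneg.2 ((one_le_inv₀ (h t).1).2 (h t).2)
  have hq : ∀ᵐ ω ∂P, ∀ t n, 0 ≤ tlam (t + 1) n ω / lam (t + 1) n ω ∧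
      tlam (t + 1) n ω / lam (t + 1) n ω ≤ 1 / ε := by
    filter_upwards [hlae] with ω h t n
    have hp := hε.trans_le (h t n)
    exact ⟨div_nonneg (hu01 t n ω).1 hp.le,
      div_le_div₀ zero_le_one (hu01 t n ω).2 hε (h t n)⟩
  have hXbd : ∀ t, ∃ C, 0 ≤ C ∧ ∀ᵐ ω ∂P, (r t ω)⁻¹ - 1 ≤ C := by
    intro t
    induction t with
    | zero =>
      refine ⟨r0⁻¹ - 1, sub_nonneg.2 ((one_le_inv₀ hr0pos).2 hr0lt.le), ?_⟩
      filter_upwards with ω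
      rw [hr0]
    | succ t ih =>
      obtain ⟨C, hC, h⟩ := ih
      refine ⟨∑ _n : Fin N, C * (1 / ε) * 1, by positivity, ?_⟩
      filter_upwards [h, hstep, hq, hX0] with ω h1 h2 h3 h4
      refine (h2 t).trans (Finset.sum_le_sum fun n _ => ?_)
      have a := h3 t n
      have b := hR01 t n ω
      exact mul_le_mul (mul_le_mul h1 a.2 a.1 hC) b.2 b.1 (by positivity)
  let X : ℕ → Ω → ℝ := fun t ω => (r t ω)⁻¹ - 1
  have hXm : ∀ t, StronglyMeasurable[ℱ t] (X t) := fun t =>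
    ((hrmeas t).inv.sub measurable_const).stronglyMeasurable
  have hXi : ∀ t, Integrable (X t) P := fun t => by
    obtain ⟨C, hC, h⟩ := hXbd t
    refine Integrable.of_bound ((hXm t).mono (ℱ.le t)).aestronglyMeasurable C ?_
    filter_upwards [h, hX0] with ω h1 h2
    rw [Real.norm_eq_abs, abs_of_nonneg (h2 t)]
    exact h1
  have hRi : ∀ t n, Integrable (R (t + 1) n) P := fun t n => by
    refine Integrable.of_bound ((hRadapted t n).mono (ℱ.le _)).aestronglyMeasurable 1 ?_
    filter_upwards with ω
    rw [Real.norm_eq_abs, abs_of_nonneg (hR01 t n ω).1]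
    exact (hR01 t n ω).2
  let Y : ℕ → Fin N → Ω → ℝ := fun t n ω => X t ω * (tlam (t + 1) n ω / lam (t + 1) n ω)
  have hYm : ∀ t n, StronglyMeasurable[ℱ t] (Y t n) := fun t n =>
    ((hXm t).measurable.mul ((htlam_adapted t n).measurable.div (hlmeas t n))).stronglyMeasurable
  have hYR : ∀ t n, Integrable (Y t n * R (t + 1) n) P := fun t n => by
    obtain ⟨C, hC, h⟩ := hXbd t
    refine Integrable.of_bound (((hYm t n).mono (ℱ.le t)).mul
      ((hRadapted t n).mono (ℱ.le _))).aestronglyMeasurable (C * (1 / ε) * 1) ?_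
    filter_upwards [h, hX0, hq] with ω h1 h2 h3
    have a := h3 t n
    have b := hR01 t n ω
    have c := h2 t
    have : 0 ≤ (Y t n * R (t + 1) n) ω := mul_nonneg (mul_nonneg c a.1) b.1
    rw [Real.norm_eq_abs, abs_of_nonneg this]
    exact mul_le_mul (mul_le_mul h1 a.2 a.1 hC) b.2 b.1 (by positivity)
  have hsuper : Supermartingale X ℱ P := by
    refine supermartingale_nat hXm hXi fun t => ?_
    have h1 : P[X (t + 1) | ℱ t] ≤ᵐ[P] P[∑ n, Y t n * R (t + 1) n | ℱ t] := by
      refine condExp_mono (hXi _) (integrable_finsetSum' _ fun n _ => hYR t n) ?_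
      filter_upwards [hstep] with ω h
      rw [Finset.sum_apply]
      exact h t
    have h2 := condExp_finsetSum (s := Finset.univ) (fun n _ => hYR t n) (ℱ t)
    have h3 : ∀ᵐ ω ∂P, ∀ n, (P[Y t n * R (t + 1) n | ℱ t]) ω =
        Y t n ω * (P[R (t + 1) n | ℱ t]) ω := by
      rw [ae_all_iff]; intro n
      exact condExp_mul_of_stronglyMeasurable_left (hYm t n) (hYR t n) (hRi t n)
    filter_upwards [h1, h2, h3, hlae] with ω a b c d
    refine a.trans (le_of_eq ?_)
    rw [b, Finset.sum_apply]
    have : ∀ n, (P[Y t n * R (t + 1) n | ℱ t]) ω = X t ω * tlam (t + 1) n ω := fun n => by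
      rw [c n, ← hlam, mul_assoc, div_mul_cancel₀ _ (hε.trans_le (d t n)).ne']
    simp only [this]
    rw [← Finset.mul_sum, (htlam_simplex t ω).2, mul_one]
  have hint : ∀ t, ∫ ω, X t ω ∂P ≤ ∫ ω, X 0 ω ∂P := fun t => by
    have := hsuper.setIntegral_le (Nat.zero_le t) (MeasurableSet.univ)
    simpa using this
  have hbdd : ∀ t, eLpNorm ((-X) t) 1 P ≤ ((∫ ω, X 0 ω ∂P).toNNReal : ℝ≥0∞) := fun t => by
    rw [Pi.neg_apply, eLpNorm_neg, eLpNorm_one_eq_lintegral_enorm,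
      ← ofReal_integral_norm_eq_lintegral_enorm (hXi t)]
    refine ENNReal.ofReal_le_ofReal (le_trans (le_of_eq ?_) (hint t))
    refine integral_congr_ae ?_
    filter_upwards [hX0] with ω h
    exact abs_of_nonneg (h t)
  filter_upwards [hsuper.neg.exists_ae_tendsto_of_bdd hbdd, hr01, hX0] with ω ⟨c, hc⟩ h1 h2
  have hc' : Tendsto (fun t => (r t ω)⁻¹) atTop (nhds (-c + 1)) := by
    have := hc.neg.add_const 1
    refine this.congr fun t => ?_
    simp [X]
  have hpos : 1 ≤ -c + 1 := ge_of_tendsto' hc' fun t => by linarith [h2 t]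
  refine ⟨⟨-Real.log (-c + 1), ?_⟩, ?_⟩
  · have := (hc'.log (by linarith)).neg
    refine this.congr fun t => ?_
    rw [Real.log_inv, neg_neg]
  · obtain ⟨B, hB⟩ := hc'.bddAbove_range
    have hB' : ∀ t, (r t ω)⁻¹ ≤ B := fun t => hB ⟨t, rfl⟩
    have hBp : 0 < B := (inv_pos.2 (h1 0).1).trans_le (hB' 0)
    refine (inv_pos.2 hBp).trans_le (le_ciInf fun t => ?_)
    exact inv_le_of_inv_le₀ (h1 t).1 (hB' t)
end

section
/- Suppose Assumption A holds, investor 1 uses the strategy λ* with components λ*ₜⁿ = E(Rₜⁿ | F_{t-1}), and let θ = E ln ρ₁ > 0 and Wₜ = ∑ₙ Xₜⁿ with W₀ = ∑ₘ Y₀ᵐ. Then for any investor m whose hitting time satisfies E τₗᵐ < ∞, one has ln l ≤ θ E τₗᵐ + ln W₀; in particular E τₗᵐ ≥ θ⁻¹ ln(l / W₀). -/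
open MeasureTheory ProbabilityTheory Filter
open scoped ENNReal BigOperators

theorem aux_hitTime {Ω : Type*} (Y : ℕ → Ω → ℝ) (l : ℝ) (ω : Ω) (k : ℕ)
    (hk : l ≤ Y k ω) (hk' : ∀ j < k, Y j ω < l) : hitTime Y l ω = k := by
  unfold hitTime
  apply le_antisymm
  · exact sInf_le ⟨k, hk, rfl⟩
  · apply le_sInf
    rintro _ ⟨j, hj, rfl⟩
    simp only [Nat.cast_le]
    by_contra h
    exact absurd (hk' j (by omega)) (not_lt.mpr hj)

theorem aux_cases {Ω : Type*} (Y : ℕ → Ω → ℝ) (l : ℝ) (ω : Ω) :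
    (hitTime Y l ω = ∞ ∧ ∀ j, Y j ω < l) ∨
      ∃ k : ℕ, hitTime Y l ω = k ∧ l ≤ Y k ω ∧ ∀ j < k, Y j ω < l := by
  classical
  by_cases h : ∃ k, l ≤ Y k ω
  · right
    have h2 : ∀ j < Nat.find h, Y j ω < l := fun j hj => not_le.mp (Nat.find_min h hj)
    exact ⟨Nat.find h, aux_hitTime Y l ω _ (Nat.find_spec h) h2, Nat.find_spec h, h2⟩
  · left
    push Not at h
    refine ⟨?_, h⟩
    unfold hitTime
    have : {t : ℕ | l ≤ Y t ω} = ∅ := by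
      ext t; simp [h t]
    rw [this]; simp

/-- The event that the level has not been reached up to time `s`. -/
def notHit {Ω : Type*} (Y : ℕ → Ω → ℝ) (l : ℝ) (s : ℕ) : Set Ω := {ω | ∀ j ≤ s, Y j ω < l}

theorem mem_notHit_iff {Ω : Type*} (Y : ℕ → Ω → ℝ) (l : ℝ) (ω : Ω) (k : ℕ)
    (hk : l ≤ Y k ω) (hk' : ∀ j < k, Y j ω < l) (s : ℕ) : ω ∈ notHit Y l s ↔ s < k := by
  constructor
  · intro h
    by_contra h2
    exact absurd (h k (by omega)) (not_lt.mpr hk)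
  · intro h j hj
    exact hk' j (by omega)

theorem hitTime_eq_tsum {Ω : Type*} (Y : ℕ → Ω → ℝ) (l : ℝ) (ω : Ω) :
    hitTime Y l ω = ∑' s, (notHit Y l s).indicator (fun _ => (1 : ℝ≥0∞)) ω := by
  rcases aux_cases Y l ω with ⟨h, h'⟩ | ⟨k, h, hk, hk'⟩
  · rw [h]
    have : ∀ s, (notHit Y l s).indicator (fun _ => (1 : ℝ≥0∞)) ω = 1 := fun s =>
      Set.indicator_of_mem (show ω ∈ notHit Y l s from fun j _ => h' j) _
    simp only [this]
    exact (ENNReal.tsum_const_eq_top_of_ne_zero one_ne_zero).symm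
  · rw [h, tsum_eq_sum (s := Finset.range k)]
    · rw [Finset.sum_congr rfl (g := fun _ => (1 : ℝ≥0∞))]
      · simp
      · intro s hs
        exact Set.indicator_of_mem ((mem_notHit_iff Y l ω k hk hk' s).2 (Finset.mem_range.1 hs)) _
    · intro s hs
      exact Set.indicator_of_notMem
        (fun h => hs (Finset.mem_range.2 ((mem_notHit_iff Y l ω k hk hk' s).1 h))) _

theorem aux_indep_s7 {Ω : Type*} (m2 : MeasurableSpace Ω) {m0 : MeasurableSpace Ω}
    (P : Measure Ω) [IsProbabilityMeasure P] (hm2 : m2 ≤ m0) (r r1 : Ω → ℝ) (hr : Measurable r)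
    (hid : IdentDistrib r r1 P P)
    (hind : Indep (MeasurableSpace.comap r inferInstance) m2 P)
    (g : ℝ → ℝ) (hg : Measurable g) (hint : Integrable (fun ω => g (r1 ω)) P)
    (A : Set Ω) (hA : MeasurableSet[m2] A) :
    Integrable (fun ω => g (r ω)) P ∧
      ∫ ω in A, g (r ω) ∂P = P.real A * ∫ ω, g (r1 ω) ∂P := by
  have hid' : IdentDistrib (fun ω => g (r ω)) (fun ω => g (r1 ω)) P P := hid.comp hg
  have hi : Integrable (fun ω => g (r ω)) P := hid'.integrable_iff.2 hint
  refine ⟨hi, ?_⟩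
  have hsm : StronglyMeasurable[MeasurableSpace.comap r inferInstance] (fun ω => g (r ω)) :=
    (hg.comp (comap_measurable r)).stronglyMeasurable
  have hc := condExp_indep_eq hr.comap_le hm2 hsm hind
  rw [← setIntegral_condExp hm2 hi hA, setIntegral_congr_ae (g := fun _ => ∫ ω, g (r ω) ∂P)
    (hm2 _ hA) (hc.mono fun ω h _ => h)]
  rw [hid'.integral_eq]
  simp

theorem wald_bound {Ω : Type*} {m0 : MeasurableSpace Ω} (P : Measure Ω) [IsProbabilityMeasure P]
    (ℱ : Filtration ℕ m0) (ρ : ℕ → Ω → ℝ)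
    (hρ_adapted : ∀ t, StronglyMeasurable[ℱ (t + 1)] (ρ (t + 1)))
    (hρ_ident : ∀ t, IdentDistrib (ρ (t + 1)) (ρ 1) P P)
    (hρ_indep : ∀ t, Indep (MeasurableSpace.comap (ρ (t + 1)) inferInstance) (ℱ t) P)
    (hρ_L2 : Integrable (fun ω => (Real.log (ρ 1 ω)) ^ 2) P)
    (hρ_growth : 0 < ∫ ω, Real.log (ρ 1 ω) ∂P)
    (Y : ℕ → Ω → ℝ) (hY : ∀ t, StronglyMeasurable[ℱ t] (Y t)) (l w : ℝ) (hl : 0 < l)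
    (hYW : ∀ t ω, 0 < Y t ω → Real.log (Y t ω) ≤
      w + ∑ s ∈ Finset.range t, Real.log (ρ (s + 1) ω))
    (hfin : ∫⁻ ω, hitTime Y l ω ∂P ≠ ∞) :
    Real.log l ≤ (∫ ω, Real.log (ρ 1 ω) ∂P) * (∫⁻ ω, hitTime Y l ω ∂P).toReal + w := by
  set θ := ∫ ω, Real.log (ρ 1 ω) ∂P with hθ
  have hlog : Integrable (fun ω => Real.log (ρ 1 ω)) P := Integrable.of_integral_ne_zero hρ_growth.ne'
  have hρm : ∀ t, Measurable (ρ (t + 1)) := fun t =>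
    ((hρ_adapted t).mono (ℱ.le _)).measurable
  have hA : ∀ s, MeasurableSet[ℱ s] (notHit Y l s) := by
    intro s
    have : notHit Y l s = ⋂ j, ⋂ (_ : j ≤ s), {ω | Y j ω < l} := by
      ext ω; simp [notHit]
    rw [this]
    refine MeasurableSet.iInter fun j => MeasurableSet.iInter fun hj => ?_
    exact ((hY j).mono (ℱ.mono hj)).measurable measurableSet_Iio
  have hA0 : ∀ s, MeasurableSet (notHit Y l s) := fun s => ℱ.le s _ (hA s)
  have hT : ∫⁻ ω, hitTime Y l ω ∂P = ∑' s, P (notHit Y l s) := by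
    simp only [hitTime_eq_tsum]
    rw [lintegral_tsum]
    · simp [lintegral_indicator, hA0]
    · exact fun s => (measurable_const.indicator (hA0 s)).aemeasurable
  have hTr : HasSum (fun s => P.real (notHit Y l s)) (∫⁻ ω, hitTime Y l ω ∂P).toReal := by
    rw [hT] at hfin ⊢
    rw [ENNReal.tsum_toReal_eq (ENNReal.ne_top_of_tsum_ne_top hfin)]
    exact ENNReal.hasSum_toReal hfin
  have hmt : Measurable (hitTime Y l) := by
    have : hitTime Y l = fun ω => ∑' s, (notHit Y l s).indicator (fun _ => (1 : ℝ≥0∞)) ω :=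
      funext fun ω => hitTime_eq_tsum Y l ω
    rw [this]
    exact Measurable.tsum fun s => measurable_const.indicator (hA0 s)
  set T := (∫⁻ ω, hitTime Y l ω ∂P).toReal with hTdef
  let f : ℕ → Ω → ℝ := fun s => (notHit Y l s).indicator (fun ω => Real.log (ρ (s + 1) ω))
  have h1 := fun s => aux_indep_s7 (ℱ s) P (ℱ.le s) (ρ (s + 1)) (ρ 1) (hρm s) (hρ_ident s)
    (hρ_indep s) Real.log Real.measurable_log hlog _ (hA s)
  have h2 := fun s => aux_indep_s7 (ℱ s) P (ℱ.le s) (ρ (s + 1)) (ρ 1) (hρm s) (hρ_ident s)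
    (hρ_indep s) (fun x => |Real.log x|) (by fun_prop) hlog.abs _ (hA s)
  have hfi : ∀ s, Integrable (f s) P := fun s => (h1 s).1.indicator (hA0 s)
  have hfint : ∀ s, ∫ ω, f s ω ∂P = P.real (notHit Y l s) * θ := fun s => by
    rw [← (h1 s).2]; exact integral_indicator (hA0 s)
  have hfnorm : ∀ s, ∫ ω, ‖f s ω‖ ∂P = P.real (notHit Y l s) * ∫ ω, |Real.log (ρ 1 ω)| ∂P :=
    fun s => by
      rw [← (h2 s).2, ← integral_indicator (hA0 s)]
      congr 1; ext ω
      simp only [f, norm_indicator_eq_indicator_norm, Real.norm_eq_abs]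
  have hsum : HasSum (fun s => ∫ ω, f s ω ∂P) (∫ ω, ∑' s, f s ω ∂P) := by
    apply hasSum_integral_of_summable_integral_norm hfi
    simp only [hfnorm]
    exact hTr.summable.mul_right _
  have hval : ∫ ω, ∑' s, f s ω ∂P = T * θ := by
    simp only [hfint] at hsum
    exact hsum.unique (hTr.mul_right θ)
  have hpt : ∀ ω (k : ℕ), hitTime Y l ω = k → Real.log l - w ≤ ∑' s, f s ω ∧
      ∑' s, f s ω = ∑ s ∈ Finset.range k, Real.log (ρ (s + 1) ω) := by
    intro ω k hk
    rcases aux_cases Y l ω with ⟨h, h'⟩ | ⟨k', h, hk1, hk2⟩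
    · simp [h] at hk
    · have : k' = k := by rw [h] at hk; exact_mod_cast hk
      subst this
      have e : ∑' s, f s ω = ∑ s ∈ Finset.range k', Real.log (ρ (s + 1) ω) := by
        rw [tsum_eq_sum (s := Finset.range k')]
        · refine Finset.sum_congr rfl fun s hs => ?_
          exact Set.indicator_of_mem
            ((mem_notHit_iff Y l ω k' hk1 hk2 s).2 (Finset.mem_range.1 hs)) _
        · intro s hs
          exact Set.indicator_of_notMem
            (fun h => hs (Finset.mem_range.2 ((mem_notHit_iff Y l ω k' hk1 hk2 s).1 h))) _
      refine ⟨?_, e⟩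
      rw [e]
      have := hYW k' ω (hl.trans_le hk1)
      have := Real.log_le_log hl hk1
      linarith
  by_cases hz : T = 0
  · have h0 : ∫⁻ ω, hitTime Y l ω ∂P = 0 := by
      rcases (ENNReal.toReal_eq_zero_iff _).1 (hTdef ▸ hz) with h | h
      · exact h
      · exact absurd h hfin
    have h0' := (lintegral_eq_zero_iff hmt).1 h0
    obtain ⟨ω, hω⟩ := h0'.exists
    have := hpt ω 0 (by simpa using hω)
    simp only [Finset.range_zero, Finset.sum_empty] at this
    rw [hz]
    linarith [this.1, this.2]
  · have hFi : Integrable (fun ω => ∑' s, f s ω) P := by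
      apply Integrable.of_integral_ne_zero
      rw [hval]
      exact mul_ne_zero hz hρ_growth.ne'
    have hae : ∀ᵐ ω ∂P, Real.log l - w ≤ ∑' s, f s ω := by
      filter_upwards [ae_lt_top hmt hfin] with ω hω
      rcases aux_cases Y l ω with ⟨h, h'⟩ | ⟨k', h, hk1, hk2⟩
      · simp [h] at hω
      · exact (hpt ω k' h).1
    have := integral_mono_ae (integrable_const (Real.log l - w)) hFi hae
    rw [hval] at this
    simp at this
    linarith

/-- Under Assumption A, with investor 1 using `λ*`, `θ = E ln ρ₁ > 0` and
`W₀ = ∑ₘ Y₀ᵐ`: for any investor `m` whose hitting time satisfies `E τₗᵐ < ∞`,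
`ln l ≤ θ E τₗᵐ + ln W₀`; in particular `E τₗᵐ ≥ θ⁻¹ ln(l / W₀)`. -/
theorem lower_bound_expected_hitting_time
    {Ω : Type*} {m0 : MeasurableSpace Ω} (P : Measure Ω) [IsProbabilityMeasure P]
    (ℱ : Filtration ℕ m0) {M N : ℕ} (hM : 2 ≤ M) (hN : 2 ≤ N)
    -- Assumption (A.1): the growth factors ρₜ
    (ρ : ℕ → Ω → ℝ)
    (hρ_adapted : ∀ t, StronglyMeasurable[ℱ (t + 1)] (ρ (t + 1)))
    (hρ_pos : ∀ t ω, 0 < ρ (t + 1) ω)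
    (hρ_ident : ∀ t, IdentDistrib (ρ (t + 1)) (ρ 1) P P)
    (hρ_indep : ∀ t, Indep (MeasurableSpace.comap (ρ (t + 1)) inferInstance) (ℱ t) P)
    (hρ_L2 : Integrable (fun ω => (Real.log (ρ 1 ω)) ^ 2) P)
    (hρ_growth : 0 < ∫ ω, Real.log (ρ 1 ω) ∂P)
    -- Assumption (A.2): the relative payoffs Rₜ
    (R : ℕ → Fin N → Ω → ℝ) (ε : ℝ) (hε : 0 < ε)
    (hR_adapted : ∀ t n, StronglyMeasurable[ℱ (t + 1)] (R (t + 1) n))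
    (hR_simplex : ∀ t ω, (fun n => R (t + 1) n ω) ∈ stdSimplex' N)
    (hR_cond : ∀ t n, ∀ᵐ ω ∂P, ε ≤ (P[R (t + 1) n | ℱ t]) ω)
    -- initial wealths and investment proportions (predictable, Δ-valued)
    (Y0 : Fin M → ℝ) (hY0 : ∀ m, 0 < Y0 m)
    (lam : Fin M → ℕ → Fin N → Ω → ℝ)
    (hlam_adapted : ∀ m t n, StronglyMeasurable[ℱ t] (lam m (t + 1) n))
    (hlam_simplex : ∀ m t ω, (fun n => lam m (t + 1) n ω) ∈ stdSimplex' N)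
    -- the payoffs, generated as in Assumption A
    (X : ℕ → Fin N → Ω → ℝ)
    (hX1 : ∀ n ω, X 1 n ω = ρ 1 ω * R 1 n ω * ∑ m, Y0 m)
    (hXt : ∀ t n ω, X (t + 2) n ω = ρ (t + 2) ω * R (t + 2) n ω * ∑ i, X (t + 1) i ω)
    -- the wealth dynamics
    (Y : Fin M → ℕ → Ω → ℝ)
    (hYinit : ∀ m ω, Y m 0 ω = Y0 m)
    (hYrec : ∀ m t ω, Y m (t + 1) ω =
      ∑ n, lam m (t + 1) n ω * Y m t ω / (∑ k, lam k (t + 1) n ω * Y k t ω) *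
        X (t + 1) n ω)
    -- investor 1 uses the strategy λ*
    (m1 : Fin M) (hm1 : (m1 : ℕ) = 0)
    (hlamstar : ∀ t n ω, lam m1 (t + 1) n ω = (P[R (t + 1) n | ℱ t]) ω) :
    ∀ m : Fin M, ∀ l : ℝ, 0 < l → ∫⁻ ω, hitTime (Y m) l ω ∂P ≠ ∞ →
      Real.log l ≤ (∫ ω, Real.log (ρ 1 ω) ∂P) * (∫⁻ ω, hitTime (Y m) l ω ∂P).toReal +
          Real.log (∑ k, Y0 k) ∧
      (∫ ω, Real.log (ρ 1 ω) ∂P)⁻¹ * Real.log (l / ∑ k, Y0 k) ≤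
        (∫⁻ ω, hitTime (Y m) l ω ∂P).toReal := by
  have hW0 : 0 < ∑ k, Y0 k := by
    refine Finset.sum_pos (fun k _ => hY0 k) ⟨m1, Finset.mem_univ _⟩
  -- total payoff
  have hX : ∀ t n ω, X (t + 1) n ω =
      R (t + 1) n ω * ((∏ s ∈ Finset.range (t + 1), ρ (s + 1) ω) * ∑ k, Y0 k) := by
    intro t
    induction t with
    | zero => intro n ω; simp [hX1]; ring
    | succ t ih =>
      intro n ω
      rw [hXt, Finset.sum_congr rfl (fun i _ => ih i ω), ← Finset.sum_mul, (hR_simplex t ω).2,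
        Finset.prod_range_succ _ (t + 1)]
      ring
  have hXnn : ∀ t n ω, 0 ≤ X (t + 1) n ω := by
    intro t n ω
    rw [hX]
    exact mul_nonneg ((hR_simplex t ω).1 n)
      (mul_nonneg (Finset.prod_nonneg fun s _ => (hρ_pos s ω).le) hW0.le)
  have hYnn : ∀ t m ω, 0 ≤ Y m t ω := by
    intro t
    induction t with
    | zero => intro m ω; rw [hYinit]; exact (hY0 m).le
    | succ t ih =>
      intro m ω
      rw [hYrec]
      refine Finset.sum_nonneg fun n _ => mul_nonneg (div_nonneg
        (mul_nonneg ((hlam_simplex m t ω).1 n) (ih m ω))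
        (Finset.sum_nonneg fun k _ => mul_nonneg ((hlam_simplex k t ω).1 n) (ih k ω))) (hXnn t n ω)
  have hYle : ∀ t m ω, Y m t ω ≤ (∏ s ∈ Finset.range t, ρ (s + 1) ω) * ∑ k, Y0 k := by
    intro t m ω
    cases t with
    | zero =>
      simp only [hYinit, Finset.range_zero, Finset.prod_empty, one_mul]
      exact Finset.single_le_sum (fun k _ => (hY0 k).le) (Finset.mem_univ m)
    | succ t =>
      rw [hYrec]
      calc _ ≤ ∑ n, X (t + 1) n ω := by
            refine Finset.sum_le_sum fun n _ => mul_le_of_le_one_left (hXnn t n ω) ?_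
            have hnn : ∀ k, 0 ≤ lam k (t + 1) n ω * Y k t ω := fun k =>
              mul_nonneg ((hlam_simplex k t ω).1 n) (hYnn t k ω)
            exact div_le_one_of_le₀
              (Finset.single_le_sum (f := fun k => lam k (t + 1) n ω * Y k t ω)
                (fun k _ => hnn k) (Finset.mem_univ m))
              (Finset.sum_nonneg fun k _ => hnn k)
        _ = _ := by
            rw [Finset.sum_congr rfl (fun i _ => hX t i ω), ← Finset.sum_mul,
              (hR_simplex t ω).2, one_mul]
  have hXm : ∀ t n, Measurable[ℱ (t + 1)] (X (t + 1) n) := by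
    intro t n
    have : X (t + 1) n = fun ω => R (t + 1) n ω *
        ((∏ s ∈ Finset.range (t + 1), ρ (s + 1) ω) * ∑ k, Y0 k) := funext fun ω => hX t n ω
    rw [this]
    refine (hR_adapted t n).measurable.mul (Measurable.mul_const ?_ _)
    refine Finset.measurable_fun_prod _ fun s hs => ?_
    exact ((hρ_adapted s).mono (ℱ.mono (by have := Finset.mem_range.1 hs; omega))).measurable
  have hYm : ∀ t m, Measurable[ℱ t] (Y m t) := by
    intro t
    induction t with
    | zero =>
      intro m
      have : Y m 0 = fun _ => Y0 m := funext fun ω => hYinit m ω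
      rw [this]; exact measurable_const
    | succ t ih =>
      intro m
      have : Y m (t + 1) = fun ω => ∑ n, lam m (t + 1) n ω * Y m t ω /
        (∑ k, lam k (t + 1) n ω * Y k t ω) * X (t + 1) n ω := funext fun ω => hYrec m t ω
      rw [this]
      have hle : ℱ t ≤ ℱ (t + 1) := ℱ.mono (Nat.le_succ t)
      have hp : ∀ k n, Measurable[ℱ (t + 1)] (fun ω => lam k (t + 1) n ω * Y k t ω) := fun k n =>
        ((hlam_adapted k t n).mono hle).measurable.mul ((ih k).mono hle le_rfl)
      refine Finset.measurable_fun_sum _ fun n _ => ?_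
      exact ((hp m n).div (Finset.measurable_fun_sum _ fun k _ => hp k n)).mul (hXm t n)
  intro m l hl hfin
  have key := wald_bound P ℱ ρ hρ_adapted hρ_ident hρ_indep hρ_L2 hρ_growth (Y m)
    (fun t => (hYm t m).stronglyMeasurable) l (Real.log (∑ k, Y0 k)) hl (by
      intro t ω hpos
      refine (Real.log_le_log hpos (hYle t m ω)).trans (le_of_eq ?_)
      rw [Real.log_mul (Finset.prod_pos fun s _ => hρ_pos s ω).ne' hW0.ne',
        Real.log_prod (fun s _ => (hρ_pos s ω).ne')]
      ring) hfin
  refine ⟨key, ?_⟩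
  rw [Real.log_div hl.ne' hW0.ne', inv_mul_le_iff₀ hρ_growth]
  linarith
end

section
/- In the two-investor relative wealth dynamics, set δ = ε²/256 and define recursively r₀' = r₀, λ̃ₜ' = λ̃ₜ + δ λₜ · 1{minₙ λ̃ₜⁿ ≤ ε/2 and r'_{t-1} ≤ 1/2}, and rₜ' = ∑ₙ λₜⁿ r'_{t-1} Rₜⁿ / (λₜⁿ r'_{t-1} + λ̃ₜ'ⁿ (1 − r'_{t-1})). Then: (i) rₜ' ≤ rₜ for all t ≥ 0; (ii) ln rₜ' is a non-positive submartingale; and (iii) rₜ' ≤ r'_{t-1} / (δ ε) for all t ≥ 1. -/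
open MeasureTheory ProbabilityTheory Filter
open scoped ENNReal BigOperators Classical

lemma aux_log_quad {y : ℝ} (hy : 0 < y) (hy1 : y ≤ 1) : Real.log y ≤ y - 1 - (1 - y) ^ 2 / 4 := by
  have hs : 0 < Real.sqrt y := Real.sqrt_pos.2 hy
  have hsq : Real.sqrt y ^ 2 = y := Real.sq_sqrt hy.le
  have hs1 : Real.sqrt y ≤ 1 := Real.sqrt_le_one.2 hy1
  have h1 : Real.log y = 2 * Real.log (Real.sqrt y) := by
    rw [Real.log_sqrt hy.le]; ring
  have h2 := Real.log_le_sub_one_of_pos hs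
  rw [h1]
  generalize Real.sqrt y = s at *
  subst hsq
  have : (1 - s ^ 2) ^ 2 ≤ 4 * (1 - s) ^ 2 := by
    have : (1 - s ^ 2) ^ 2 = (1 + s) ^ 2 * (1 - s) ^ 2 := by ring
    rw [this]
    apply mul_le_mul_of_nonneg_right _ (sq_nonneg _)
    nlinarith
  nlinarith

lemma aux_mul_log {l q : ℝ} (hl : 0 < l) (hq : 0 < q) : l * Real.log (q / l) ≤ q - l := by
  have h := Real.log_le_sub_one_of_pos (div_pos hq hl)
  calc l * Real.log (q / l) ≤ l * (q / l - 1) := mul_le_mul_of_nonneg_left h hl.le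
    _ = q - l := by field_simp

lemma aux_mul_log2 {l q ε : ℝ} (hl : 0 < l) (hl1 : l ≤ 1) (hq : 0 < q) (hε : 0 < ε)
    (h : ε / 8 ≤ l - q) : l * Real.log (q / l) ≤ q - l - ε ^ 2 / 256 := by
  have h0 := aux_log_quad (div_pos hq hl) ((div_le_one hl).2 (by linarith))
  have h1 : l * Real.log (q / l) ≤ l * (q / l - 1 - (1 - q / l) ^ 2 / 4) :=
    mul_le_mul_of_nonneg_left h0 hl.le
  have h2 : l * (q / l - 1 - (1 - q / l) ^ 2 / 4) = q - l - (l - q) ^ 2 / l / 4 := by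
    field_simp
  have h3 : (ε / 8) ^ 2 ≤ (l - q) ^ 2 / l := by
    rw [le_div_iff₀ hl]
    have : (ε / 8) ^ 2 ≤ (l - q) ^ 2 := by gcongr
    nlinarith [sq_nonneg (ε / 8)]
  nlinarith

/-- KL bound -/
lemma aux_kl_s9 {N : ℕ} {l p : Fin N → ℝ} {ε x c : ℝ} (hε : 0 < ε) (hε2 : ε ≤ 1 / 2)
    (hl : ∀ n, ε ≤ l n) (hl1 : ∑ n, l n = 1) (hp : ∀ n, 0 ≤ p n) (hp1 : ∑ n, p n = 1)
    (hx : 0 < x) (hx1 : x ≤ 1)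
    (hc : c = 0 ∨ (c = ε ^ 2 / 256 ∧ (∃ k, p k ≤ ε / 2) ∧ x ≤ 1 / 2)) :
    Real.log x ≤ ∑ n, Real.log (l n * x / (l n * x + (p n + c * l n) * (1 - x))) * l n := by
  have hc0 : 0 ≤ c := by
    rcases hc with h | h
    · exact h.ge
    · rw [h.1]; positivity
  have hlp : ∀ n, 0 < l n := fun n => hε.trans_le (hl n)
  have hq : ∀ n, 0 < l n * x + (p n + c * l n) * (1 - x) := fun n => by
    have := mul_pos (hlp n) hx
    have := mul_nonneg (add_nonneg (hp n) (mul_nonneg hc0 (hlp n).le)) (sub_nonneg.2 hx1)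
    linarith
  set q : Fin N → ℝ := fun n => l n * x + (p n + c * l n) * (1 - x) with hqdef
  have hqs : ∑ n, (q n - l n) = c * (1 - x) := by
    have : ∀ n, q n - l n = (x - 1 + c * (1 - x)) * l n + (1 - x) * p n := fun n => by
      simp only [hqdef]; ring
    simp_rw [this]
    rw [Finset.sum_add_distrib, ← Finset.mul_sum, ← Finset.mul_sum, hl1, hp1]; ring
  have key : ∑ n, l n * Real.log (q n / l n) ≤ 0 := by
    rcases hc with h | ⟨h, ⟨k, hk⟩, hx2⟩
    · calc _ ≤ ∑ n, (q n - l n) := Finset.sum_le_sum fun n _ => aux_mul_log (hlp n) (hq n)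
        _ = 0 := by rw [hqs, h]; ring
    · have hlk1 : l k ≤ 1 := by
        rw [← hl1]; exact Finset.single_le_sum (fun n _ => (hlp n).le) (Finset.mem_univ k)
      have hk2 : ε / 8 ≤ l k - q k := by
        have e : l k - q k = (1 - x) * (l k - p k - c * l k) := by simp only [hqdef]; ring
        have hc1 : c ≤ 1 / 4 := by rw [h]; nlinarith
        have := hl k
        have h4 : ε / 4 ≤ l k - p k - c * l k := by nlinarith [hlp k]
        rw [e]; nlinarith
      calc _ ≤ ∑ n, ((q n - l n) - if n = k then ε ^ 2 / 256 else 0) := by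
            refine Finset.sum_le_sum fun n _ => ?_
            split_ifs with hnk
            · subst hnk
              exact aux_mul_log2 (hlp n) hlk1 (hq n) hε hk2
            · rw [sub_zero]; exact aux_mul_log (hlp n) (hq n)
        _ = c * (1 - x) - ε ^ 2 / 256 := by
            rw [Finset.sum_sub_distrib, hqs]; simp
        _ ≤ 0 := by rw [← h]; nlinarith
  have e : ∀ n, Real.log (l n * x / q n) * l n
      = l n * Real.log x - l n * Real.log (q n / l n) := fun n => by
    have := (hlp n).ne'
    have := (hq n).ne'
    rw [Real.log_div (mul_pos (hlp n) hx).ne' (hq n).ne', Real.log_mul (hlp n).ne' hx.ne',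
      Real.log_div (hq n).ne' (hlp n).ne']
    ring
  calc Real.log x ≤ Real.log x - ∑ n, l n * Real.log (q n / l n) := by linarith
    _ = _ := by
      rw [Finset.sum_congr rfl fun n _ => e n, Finset.sum_sub_distrib, ← Finset.sum_mul, hl1,
        one_mul]

lemma aux_b_bounds {l p ε x : ℝ} (hε : 0 < ε) (hl : ε ≤ l) (hl1 : l ≤ 1) (hp : 0 ≤ p)
    (hp2 : p ≤ 2) (hx : 0 < x) (hx1 : x ≤ 1) :
    ε / 2 * x ≤ l * x / (l * x + p * (1 - x)) ∧ l * x / (l * x + p * (1 - x)) ≤ 1 := by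
  have hlx : 0 < l * x := mul_pos (hε.trans_le hl) hx
  have h2 : 0 ≤ p * (1 - x) := mul_nonneg hp (sub_nonneg.2 hx1)
  constructor
  · rw [le_div_iff₀ (by linarith)]
    have h3 : l * x + p * (1 - x) ≤ 2 := by nlinarith
    have : ε / 2 * x * (l * x + p * (1 - x)) ≤ ε / 2 * x * 2 :=
      mul_le_mul_of_nonneg_left h3 (by positivity)
    nlinarith
  · rw [div_le_one (by linarith)]; linarith

lemma aux_b_mono {l p p' x y : ℝ} (hl : 0 < l) (hp : 0 ≤ p) (hpp : p ≤ p') (hx : 0 < x)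
    (hxy : x ≤ y) (hy1 : y ≤ 1) :
    l * x / (l * x + p' * (1 - x)) ≤ y * l / (y * l + (1 - y) * p) := by
  have hlx : 0 < l * x := mul_pos hl hx
  have hly : 0 < y * l := mul_pos (hx.trans_le hxy) hl
  have h1 : 0 ≤ p' * (1 - x) := mul_nonneg (hp.trans hpp) (by linarith)
  have h2 : 0 ≤ (1 - y) * p := mul_nonneg (by linarith) hp
  rw [div_le_div_iff₀ (by linarith) (by linarith)]
  have h3 : x * ((1 - y) * p) ≤ y * (p' * (1 - x)) := by
    have : (1 - y) * p ≤ p' * (1 - x) := by nlinarith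
    exact mul_le_mul hxy this h2 (hx.le.trans hxy)
  nlinarith

lemma aux_b_upper {l p ε x c : ℝ} (hε : 0 < ε) (hε2 : ε ≤ 1 / 2) (hl : ε ≤ l)
    (hl1 : l ≤ 1)
    (hp : 0 ≤ p) (hx : 0 < x) (hx1 : x ≤ 1) 
    (hc : (c = 0 ∧ (1 / 2 < x ∨ ε / 2 < p)) ∨ c = ε ^ 2 / 256) :
    l * x / (l * x + (p + c * l) * (1 - x)) ≤ x / ((ε ^ 2 / 256) * ε) := by
  have hl0 : 0 < l := hε.trans_le hl
  have hlx : 0 < l * x := mul_pos hl0 hx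
  have hx0 : 0 ≤ 1 - x := by linarith
  have hpx : 0 ≤ p * (1 - x) := mul_nonneg hp hx0
  have hd : ε ^ 2 / 256 ≤ 1 / 4 := by nlinarith
  have hd0 : 0 < ε ^ 2 / 256 := by positivity
  generalize ε ^ 2 / 256 = d at *
  have hdpos : 0 < d * ε := by positivity
  rw [le_div_iff₀ hdpos]
  rcases hc with ⟨rfl, h | h⟩ | rfl
  · have : l * x / (l * x + (p + 0 * l) * (1 - x)) ≤ 1 := by
      rw [div_le_one (by linarith)]; linarith
    nlinarith
  · rw [div_mul_eq_mul_div, div_le_iff₀ (by linarith)]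
    have h5 : d * ε ≤ l * x + (p + 0 * l) * (1 - x) := by nlinarith
    have h6 : x * (d * ε) ≤ x * (l * x + (p + 0 * l) * (1 - x)) :=
      mul_le_mul_of_nonneg_left h5 hx.le
    have h7 : l * (x * (d * ε)) ≤ 1 * (x * (d * ε)) :=
      mul_le_mul_of_nonneg_right hl1 (by positivity)
    linarith
  · have hcl : 0 ≤ c * l * (1 - x) := by positivity
    rw [div_mul_eq_mul_div, div_le_iff₀ (by linarith)]
    have : l * (c * ε) ≤ l * x + (p + c * l) * (1 - x) := by
      have : c * ε ≤ x + c * (1 - x) := by nlinarith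
      nlinarith
    nlinarith

/-- In the two-investor relative wealth dynamics, set `δ = ε²/256` and define recursively
`r₀' = r₀`, `λ̃ₜ' = λ̃ₜ + δ λₜ · 1{minₙ λ̃ₜⁿ ≤ ε/2 and r'_{t-1} ≤ 1/2}`, and
`rₜ' = ∑ₙ λₜⁿ r'_{t-1} Rₜⁿ / (λₜⁿ r'_{t-1} + λ̃ₜ'ⁿ (1 − r'_{t-1}))`.  Then:
(i) `rₜ' ≤ rₜ` for all `t ≥ 0`; (ii) `ln rₜ'` is a non-positive submartingale; and
(iii) `rₜ' ≤ r'_{t-1} / (δ ε)` for all `t ≥ 1`. -/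
theorem modified_relative_wealth_properties
    {Ω : Type*} {m0 : MeasurableSpace Ω} (P : Measure Ω) [IsProbabilityMeasure P]
    (ℱ : Filtration ℕ m0) {N : ℕ} (hN : 2 ≤ N)
    (R : ℕ → Fin N → Ω → ℝ) (ε : ℝ) (hε : 0 < ε)
    (hRadapted : ∀ t n, StronglyMeasurable[ℱ (t + 1)] (R (t + 1) n))
    (hRsimplex : ∀ t ω, (fun n => R (t + 1) n ω) ∈ stdSimplex' N)
    (hRcond : ∀ t n, ∀ᵐ ω ∂P, ε ≤ (P[R (t + 1) n | ℱ t]) ω)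
    -- investor 1 uses the strategy `λₜⁿ = E(Rₜⁿ | F_{t-1})`
    (lam : ℕ → Fin N → Ω → ℝ)
    (hlam : ∀ t n ω, lam (t + 1) n ω = (P[R (t + 1) n | ℱ t]) ω)
    -- investor 2 uses an adapted Δ-valued sequence `λ̃ₜ`
    (tlam : ℕ → Fin N → Ω → ℝ)
    (htlam_adapted : ∀ t n, StronglyMeasurable[ℱ t] (tlam (t + 1) n))
    (htlam_simplex : ∀ t ω, (fun n => tlam (t + 1) n ω) ∈ stdSimplex' N)
    -- relative wealth of investor 1
    (r : ℕ → Ω → ℝ) (r0 : ℝ) (hr0pos : 0 < r0) (hr0lt : r0 < 1)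
    (hr0 : ∀ ω, r 0 ω = r0)
    (hrec : ∀ t ω, r (t + 1) ω =
      r t ω * ∑ n, lam (t + 1) n ω * R (t + 1) n ω /
        (r t ω * lam (t + 1) n ω + (1 - r t ω) * tlam (t + 1) n ω))
    -- the modified sequences `λ̃'` and `r'`, with `δ = ε²/256`
    (tlam' : ℕ → Fin N → Ω → ℝ) (r' : ℕ → Ω → ℝ)
    (hr'0 : ∀ ω, r' 0 ω = r0)
    (htlam' : ∀ t n ω, tlam' (t + 1) n ω = tlam (t + 1) n ω +
      (if (∃ k, tlam (t + 1) k ω ≤ ε / 2) ∧ r' t ω ≤ 1 / 2 then (ε ^ 2 / 256) * lam (t + 1) n ω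
       else 0))
    (hrec' : ∀ t ω, r' (t + 1) ω =
      ∑ n, lam (t + 1) n ω * r' t ω * R (t + 1) n ω /
        (lam (t + 1) n ω * r' t ω + tlam' (t + 1) n ω * (1 - r' t ω))) :
    (∀ t : ℕ, ∀ᵐ ω ∂P, r' t ω ≤ r t ω) ∧
    (Submartingale (fun t ω => Real.log (r' t ω)) ℱ P ∧
      ∀ t : ℕ, ∀ᵐ ω ∂P, Real.log (r' t ω) ≤ 0) ∧
    (∀ t : ℕ, ∀ᵐ ω ∂P, r' (t + 1) ω ≤ r' t ω / ((ε ^ 2 / 256) * ε)) := by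
  -- measurability
  have hlam_meas : ∀ t n, Measurable[ℱ t] (lam (t + 1) n) := fun t n => by
    have : lam (t + 1) n = P[R (t + 1) n | ℱ t] := funext (hlam t n)
    rw [this]; exact stronglyMeasurable_condExp.measurable
  have hset : ∀ t, Measurable[ℱ t] (r' t) →
      MeasurableSet[ℱ t] {ω | (∃ k, tlam (t + 1) k ω ≤ ε / 2) ∧ r' t ω ≤ 1 / 2} := by
    intro t ht
    refine MeasurableSet.inter ?_ ?_
    · have : {ω | ∃ k, tlam (t + 1) k ω ≤ ε / 2} = ⋃ k, {ω | tlam (t + 1) k ω ≤ ε / 2} := by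
        ext; simp
      change MeasurableSet[ℱ t] {ω | ∃ k, tlam (t + 1) k ω ≤ ε / 2}
      rw [this]
      exact MeasurableSet.iUnion fun k =>
        measurableSet_le (htlam_adapted t k).measurable measurable_const
    · exact measurableSet_le ht measurable_const
  have htl'_meas : ∀ t, Measurable[ℱ t] (r' t) → ∀ n, Measurable[ℱ t] (tlam' (t + 1) n) := by
    intro t ht n
    have : tlam' (t + 1) n = fun ω => tlam (t + 1) n ω +
      (if (∃ k, tlam (t + 1) k ω ≤ ε / 2) ∧ r' t ω ≤ 1 / 2 then (ε ^ 2 / 256) * lam (t + 1) n ω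
       else 0) := funext (htlam' t n)
    rw [this]
    exact (htlam_adapted t n).measurable.add
      (Measurable.ite (hset t ht) ((hlam_meas t n).const_mul _) measurable_const)
  have hr'_meas : ∀ t, Measurable[ℱ t] (r' t) := by
    intro t
    induction t with
    | zero =>
      have : r' 0 = fun _ => r0 := funext hr'0
      rw [this]; exact measurable_const
    | succ t ih =>
      have hle := ℱ.mono (Nat.le_succ t)
      have h1 : Measurable[ℱ (t + 1)] (r' t) := ih.mono hle le_rfl
      have h2 : ∀ n, Measurable[ℱ (t + 1)] (lam (t + 1) n) :=
        fun n => (hlam_meas t n).mono hle le_rfl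
      have h3 : ∀ n, Measurable[ℱ (t + 1)] (tlam' (t + 1) n) :=
        fun n => (htl'_meas t ih n).mono hle le_rfl
      rw [funext (hrec' t)]
      refine Finset.measurable_sum _ fun n _ => ?_
      exact (((h2 n).mul h1).mul (hRadapted t n).measurable).div
        (((h2 n).mul h1).add ((h3 n).mul (measurable_const.sub h1)))
  -- R facts
  have hR1 : ∀ t n ω, R (t + 1) n ω ≤ 1 := fun t n ω => by
    rw [← (hRsimplex t ω).2]
    exact Finset.single_le_sum (f := fun n => R (t + 1) n ω)
      (fun k _ => (hRsimplex t ω).1 k) (Finset.mem_univ n)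
  have hR0 : ∀ t n ω, 0 ≤ R (t + 1) n ω := fun t n ω => (hRsimplex t ω).1 n
  have hRm : ∀ t n, AEStronglyMeasurable (R (t + 1) n) P := fun t n =>
    ((hRadapted t n).mono (ℱ.le _)).aestronglyMeasurable
  have hRint : ∀ t n, Integrable (R (t + 1) n) P := fun t n =>
    Integrable.of_bound (hRm t n) 1 (Eventually.of_forall fun ω => by
      rw [Real.norm_eq_abs, abs_of_nonneg (hR0 t n ω)]; exact hR1 t n ω)
  have hlamsum : ∀ t, ∀ᵐ ω ∂P, ∑ n, lam (t + 1) n ω = 1 := by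
    intro t
    have h1 := condExp_finsetSum (μ := P) (s := Finset.univ) (f := fun n => R (t + 1) n)
      (fun n _ => hRint t n) (ℱ t)
    have h2 : (∑ n, R (t + 1) n) = fun _ => (1 : ℝ) := by
      ext ω; rw [Finset.sum_apply]; exact (hRsimplex t ω).2
    rw [h2, condExp_const (ℱ.le t)] at h1
    filter_upwards [h1] with ω hω
    rw [Finset.sum_apply] at hω
    simp_rw [hlam]; exact hω.symm
  have hgood : ∀ᵐ ω ∂P, ∀ t, (∀ n, ε ≤ lam (t + 1) n ω) ∧ ∑ n, lam (t + 1) n ω = 1 := by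
    rw [ae_all_iff]; intro t
    have : ∀ᵐ ω ∂P, ∀ n, ε ≤ (P[R (t + 1) n | ℱ t]) ω := ae_all_iff.2 (hRcond t)
    filter_upwards [this, hlamsum t] with ω h1 h2
    exact ⟨fun n => by rw [hlam]; exact h1 n, h2⟩
  have hε2 : ε ≤ 1 / 2 := by
    obtain ⟨ω, hω⟩ := hgood.exists
    have h1 : ∑ _n : Fin N, ε ≤ 1 := by
      rw [← (hω 0).2]; exact Finset.sum_le_sum fun n _ => (hω 0).1 n
    simp at h1
    have : (2 : ℝ) ≤ N := by exact_mod_cast hN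
    nlinarith
  have hd4 : ε ^ 2 / 256 ≤ 1 / 4 := by nlinarith
  -- pointwise facts about tlam and lam
  have hlam1 : ∀ ω, (∀ t, (∀ n, ε ≤ lam (t + 1) n ω) ∧ ∑ n, lam (t + 1) n ω = 1) →
      ∀ t n, lam (t + 1) n ω ≤ 1 := fun ω hω t n => by
    rw [← (hω t).2]
    exact Finset.single_le_sum (f := fun n => lam (t + 1) n ω)
      (fun k _ => hε.le.trans ((hω t).1 k)) (Finset.mem_univ n)
  have htl1 : ∀ ω t n, tlam (t + 1) n ω ≤ 1 := fun ω t n => by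
    rw [← (htlam_simplex t ω).2]
    exact Finset.single_le_sum (f := fun n => tlam (t + 1) n ω)
      (fun k _ => (htlam_simplex t ω).1 k) (Finset.mem_univ n)
  have htl0 : ∀ ω t n, 0 ≤ tlam (t + 1) n ω := fun ω t n => (htlam_simplex t ω).1 n
  have htl' : ∀ ω, (∀ t, (∀ n, ε ≤ lam (t + 1) n ω) ∧ ∑ n, lam (t + 1) n ω = 1) →
      ∀ t n, tlam (t + 1) n ω ≤ tlam' (t + 1) n ω ∧ tlam' (t + 1) n ω ≤ 2 := fun ω hω t n => by
    have h1 := hlam1 ω hω t n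
    have h2 := htl1 ω t n
    have h3 := hε.le.trans ((hω t).1 n)
    have h4 : 0 ≤ ε ^ 2 / 256 := by positivity
    rw [htlam']
    split_ifs
    · constructor <;> nlinarith
    · constructor <;> linarith
  have hterm : ∀ t ω, r' (t + 1) ω = ∑ n, R (t + 1) n ω * (lam (t + 1) n ω * r' t ω /
        (lam (t + 1) n ω * r' t ω + tlam' (t + 1) n ω * (1 - r' t ω))) := fun t ω => by
    rw [hrec']; exact Finset.sum_congr rfl fun n _ => by ring
  have hterm2 : ∀ t ω, r (t + 1) ω = ∑ n, R (t + 1) n ω * (r t ω * lam (t + 1) n ω /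
        (r t ω * lam (t + 1) n ω + (1 - r t ω) * tlam (t + 1) n ω)) := fun t ω => by
    rw [hrec, Finset.mul_sum]; exact Finset.sum_congr rfl fun n _ => by ring
  have hmain : ∀ᵐ ω ∂P, ∀ t, r0 * (ε / 2) ^ t ≤ r' t ω ∧ r' t ω ≤ r t ω ∧ r t ω ≤ 1 := by
    filter_upwards [hgood] with ω hω t
    induction t with
    | zero => rw [hr0, hr'0]; simp [hr0lt.le]
    | succ t ih =>
      obtain ⟨i1, i2, i3⟩ := ih
      have hx : 0 < r' t ω := lt_of_lt_of_le (by positivity) i1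
      have hRs := (hRsimplex t ω).2
      have hpos : ∀ n, 0 < lam (t + 1) n ω := fun n => hε.trans_le ((hω t).1 n)
      refine ⟨?_, ?_, ?_⟩
      · rw [hterm]
        calc r0 * (ε / 2) ^ (t + 1) = ε / 2 * (r0 * (ε / 2) ^ t) := by ring
          _ ≤ ε / 2 * r' t ω := by gcongr
          _ = ∑ n, R (t + 1) n ω * (ε / 2 * r' t ω) := by
            rw [← Finset.sum_mul, hRs, one_mul]
          _ ≤ _ := Finset.sum_le_sum fun n _ => mul_le_mul_of_nonneg_left
            (aux_b_bounds hε ((hω t).1 n) (hlam1 ω hω t n)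
              ((htl0 ω t n).trans (htl' ω hω t n).1) (htl' ω hω t n).2 hx (i2.trans i3)).1
            (hR0 t n ω)
      · rw [hterm, hterm2]
        exact Finset.sum_le_sum fun n _ => mul_le_mul_of_nonneg_left
          (aux_b_mono (hpos n) (htl0 ω t n) (htl' ω hω t n).1 hx i2 i3) (hR0 t n ω)
      · rw [hterm2]
        calc _ ≤ ∑ n, R (t + 1) n ω * 1 := Finset.sum_le_sum fun n _ =>
              mul_le_mul_of_nonneg_left (by
                have h1 := mul_pos (hx.trans_le i2) (hpos n)
                have h2 := mul_nonneg (sub_nonneg.2 i3) (htl0 ω t n)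
                rw [div_le_one (by linarith)]; linarith) (hR0 t n ω)
          _ = 1 := by simp only [mul_one]; exact hRs
  have hlow : ∀ t, 0 < r0 * (ε / 2) ^ t := fun t => by positivity
  -- log bounded
  have hlogmeas : ∀ t, StronglyMeasurable[ℱ t] (fun ω => Real.log (r' t ω)) := fun t =>
    (Real.measurable_log.comp (hr'_meas t)).stronglyMeasurable
  have hlogint : ∀ t, Integrable (fun ω => Real.log (r' t ω)) P := by
    intro t
    refine Integrable.of_bound ((hlogmeas t).mono (ℱ.le t)).aestronglyMeasurable
      (-Real.log (r0 * (ε / 2) ^ t)) ?_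
    filter_upwards [hmain] with ω hω
    obtain ⟨h1, h2, h3⟩ := hω t
    have hx := (hlow t).trans_le h1
    rw [Real.norm_eq_abs, abs_of_nonpos (Real.log_nonpos hx.le (h2.trans h3))]
    exact neg_le_neg (Real.log_le_log (hlow t) h1)
  refine ⟨fun t => hmain.mono fun ω h => (h t).2.1, ⟨?_, fun t => ?_⟩, fun t => ?_⟩
  · refine submartingale_nat hlogmeas hlogint fun t => ?_
    set L : Fin N → Ω → ℝ := fun n ω => Real.log (lam (t + 1) n ω * r' t ω /
        (lam (t + 1) n ω * r' t ω + tlam' (t + 1) n ω * (1 - r' t ω))) with hL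
    have hLm : ∀ n, StronglyMeasurable[ℱ t] (L n) := fun n =>
      (Real.measurable_log.comp (((hlam_meas t n).mul (hr'_meas t)).div
        (((hlam_meas t n).mul (hr'_meas t)).add ((htl'_meas t (hr'_meas t) n).mul
          (measurable_const.sub (hr'_meas t)))))).stronglyMeasurable
    have hbd : ∀ᵐ ω ∂P, ∀ n, r0 * (ε / 2) ^ (t + 1) ≤ lam (t + 1) n ω * r' t ω /
        (lam (t + 1) n ω * r' t ω + tlam' (t + 1) n ω * (1 - r' t ω)) ∧ lam (t + 1) n ω * r' t ω /
        (lam (t + 1) n ω * r' t ω + tlam' (t + 1) n ω * (1 - r' t ω)) ≤ 1 := by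
      filter_upwards [hgood, hmain] with ω hω hm n
      obtain ⟨i1, i2, i3⟩ := hm t
      have := aux_b_bounds hε ((hω t).1 n) (hlam1 ω hω t n)
              ((htl0 ω t n).trans (htl' ω hω t n).1) (htl' ω hω t n).2 ((hlow t).trans_le i1)
              (i2.trans i3)
      refine ⟨le_trans ?_ this.1, this.2⟩
      calc r0 * (ε / 2) ^ (t + 1) = ε / 2 * (r0 * (ε / 2) ^ t) := by ring
          _ ≤ ε / 2 * r' t ω := by gcongr
    have hLR : ∀ n, Integrable (L n * R (t + 1) n) P := by
      intro n
      refine Integrable.of_bound (((hLm n).mono (ℱ.le t)).aestronglyMeasurable.mul (hRm t n))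
        (-Real.log (r0 * (ε / 2) ^ (t + 1))) ?_
      filter_upwards [hbd] with ω hω
      obtain ⟨h1, h2⟩ := hω n
      have hx := (hlow _).trans_le h1
      have hneg : L n ω ≤ 0 := Real.log_nonpos hx.le h2
      have hge : Real.log (r0 * (ε / 2) ^ (t + 1)) ≤ L n ω := Real.log_le_log (hlow _) h1
      rw [Pi.mul_apply, Real.norm_eq_abs, abs_mul, abs_of_nonpos hneg,
        abs_of_nonneg (hR0 t n ω)]
      nlinarith [hR1 t n ω, hR0 t n ω]
    have hsum : Integrable (∑ n, L n * R (t + 1) n) P := integrable_finsetSum' _ fun n _ => hLR n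
    have hJ : (∑ n, L n * R (t + 1) n) ≤ᵐ[P] fun ω => Real.log (r' (t + 1) ω) := by
      filter_upwards [hbd] with ω hω
      have := strictConcaveOn_log_Ioi.concaveOn.le_map_sum (t := Finset.univ)
        (w := fun n => R (t + 1) n ω) (p := fun n => lam (t + 1) n ω * r' t ω /
        (lam (t + 1) n ω * r' t ω + tlam' (t + 1) n ω * (1 - r' t ω)))
        (fun n _ => hR0 t n ω) (hRsimplex t ω).2 (fun n _ => (hlow _).trans_le (hω n).1)
      rw [hterm, Finset.sum_apply]
      simp only [smul_eq_mul] at this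
      refine le_trans (le_of_eq ?_) this
      exact Finset.sum_congr rfl fun n _ => mul_comm _ _
    have h1 := condExp_mono (m := ℱ t) hsum (hlogint (t + 1)) hJ
    have h2 := condExp_finsetSum (μ := P) (s := Finset.univ) (f := fun n => L n * R (t + 1) n)
      (fun n _ => hLR n) (ℱ t)
    have h3 : ∀ᵐ ω ∂P, ∀ n, (P[L n * R (t + 1) n | ℱ t]) ω = L n ω * lam (t + 1) n ω := by
      rw [ae_all_iff]; intro n
      filter_upwards [condExp_mul_of_stronglyMeasurable_left (hLm n) (hLR n) (hRint t n)] with ω h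
      rw [h, Pi.mul_apply, hlam]
    filter_upwards [h1, h2, h3, hgood, hmain] with ω h1 h2 h3 hω hm
    refine le_trans ?_ h1
    rw [h2, Finset.sum_apply]
    simp_rw [h3]
    obtain ⟨i1, i2, i3⟩ := hm t
    have hx := (hlow t).trans_le i1
    by_cases hC : (∃ k, tlam (t + 1) k ω ≤ ε / 2) ∧ r' t ω ≤ 1 / 2
    · have := aux_kl_s9 hε hε2 (hω t).1 (hω t).2 (htl0 ω t) (htlam_simplex t ω).2 hx (i2.trans i3)
        (c := ε ^ 2 / 256) (Or.inr ⟨rfl, hC⟩)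
      simpa only [hL, htlam', if_pos hC] using this
    · have := aux_kl_s9 hε hε2 (hω t).1 (hω t).2 (htl0 ω t) (htlam_simplex t ω).2 hx (i2.trans i3)
        (c := 0) (Or.inl rfl)
      simpa only [hL, htlam', if_neg hC, zero_mul] using this
  · filter_upwards [hmain] with ω hω
    obtain ⟨h1, h2, h3⟩ := hω t
    exact Real.log_nonpos ((hlow t).trans_le h1).le (h2.trans h3)
  · filter_upwards [hgood, hmain] with ω hω hm
    obtain ⟨i1, i2, i3⟩ := hm t
    have hx := (hlow t).trans_le i1
    rw [hterm]
    calc _ ≤ ∑ n, R (t + 1) n ω * (r' t ω / ((ε ^ 2 / 256) * ε)) := by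
          refine Finset.sum_le_sum fun n _ => mul_le_mul_of_nonneg_left ?_ (hR0 t n ω)
          by_cases hC : (∃ k, tlam (t + 1) k ω ≤ ε / 2) ∧ r' t ω ≤ 1 / 2
          · have := aux_b_upper hε hε2 ((hω t).1 n) (hlam1 ω hω t n) (htl0 ω t n) hx
              (i2.trans i3) (c := ε ^ 2 / 256) (Or.inr rfl)
            rw [htlam', if_pos hC]; exact this
          · have := aux_b_upper hε hε2 ((hω t).1 n) (hlam1 ω hω t n) (htl0 ω t n) hx
              (i2.trans i3) (c := 0) (Or.inl ⟨rfl, by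
                by_contra! h
                exact hC ⟨⟨n, h.2⟩, h.1⟩⟩)
            rw [htlam', if_neg hC]; rw [zero_mul] at this; exact this
      _ = _ := by rw [← Finset.sum_mul, (hRsimplex t ω).2, one_mul]
end

section
/- In the two-investor relative wealth dynamics, suppose additionally that ‖λₜ − λ̃ₜ‖ ≥ a almost surely for all t ≥ 1 and some a > 0. Then E ∑_{t=1}^∞ (1 − r_{t-1})² ≤ −4 ln r₀ / a², and consequently, for every c ∈ [0,1), the total occupation time η_c = ∑_{t≥0} 1{rₜ < c} satisfies E η_c ≤ −4 ln r₀ / (a(1−c))² < ∞. -/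
open MeasureTheory ProbabilityTheory Filter
open scoped ENNReal BigOperators

theorem kl_pt (x y : ℝ) (hx : 0 < x) (hy : 0 < y) (hx1 : x ≤ 1) (hy1 : y ≤ 1) :
    x - y + (x - y) ^ 2 / 4 ≤ x * Real.log (x / y) := by
  obtain ⟨u, hu, rfl⟩ : ∃ u, 0 < u ∧ x = u ^ 2 := ⟨√x, by positivity, (Real.sq_sqrt hx.le).symm⟩
  obtain ⟨v, hv, rfl⟩ : ∃ u, 0 < u ∧ y = u ^ 2 := ⟨√y, by positivity, (Real.sq_sqrt hy.le).symm⟩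
  have hu1 : u ≤ 1 := by nlinarith
  have hv1 : v ≤ 1 := by nlinarith
  have h1 : Real.log (v / u) ≤ v / u - 1 := Real.log_le_sub_one_of_pos (by positivity)
  have h2 : Real.log (u ^ 2 / v ^ 2) = -2 * Real.log (v / u) := by
    rw [← div_pow, Real.log_pow, Real.log_div hu.ne' hv.ne', Real.log_div hv.ne' hu.ne']
    push_cast; ring
  have h3 : u ^ 2 * (v / u) = u * v := by field_simp
  have h4 : u ^ 2 * Real.log (v / u) ≤ u * v - u ^ 2 := by
    have := mul_le_mul_of_nonneg_left h1 (sq_nonneg u)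
    rw [mul_sub, h3] at this; linarith
  have h5 : (u ^ 2 - v ^ 2) ^ 2 ≤ 4 * (u - v) ^ 2 := by
    have : (u ^ 2 - v ^ 2) ^ 2 = (u + v) ^ 2 * (u - v) ^ 2 := by ring
    rw [this]
    exact mul_le_mul_of_nonneg_right (by nlinarith) (sq_nonneg _)
  rw [h2]; nlinarith

theorem simplex_le_one {N : ℕ} {x : Fin N → ℝ} (hx : x ∈ stdSimplex' N) (n : Fin N) : x n ≤ 1 := by
  rw [← hx.2]
  exact Finset.single_le_sum (fun i _ => hx.1 i) (Finset.mem_univ n)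

theorem det_step {N : ℕ} (l q R : Fin N → ℝ) (ε r a : ℝ) (hε : 0 < ε) (hr : 0 < r) (hr1 : r ≤ 1)
    (hl : l ∈ stdSimplex' N) (hq : q ∈ stdSimplex' N) (hR : R ∈ stdSimplex' N)
    (hle : ∀ n, ε ≤ l n) (ha : 0 < a) (hfar : a ≤ l2norm (fun n => l n - q n)) :
    (a ^ 2 / 4 * (1 - r) ^ 2 ≤ ∑ n, l n * Real.log (l n / (r * l n + (1 - r) * q n))) ∧
    (Real.log r + ∑ n, R n * Real.log (l n / (r * l n + (1 - r) * q n)) ≤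
      Real.log (r * ∑ n, l n * R n / (r * l n + (1 - r) * q n))) ∧
    (r * ε ≤ r * ∑ n, l n * R n / (r * l n + (1 - r) * q n)) ∧
    (r * ∑ n, l n * R n / (r * l n + (1 - r) * q n) ≤ 1) ∧
    (∀ n, |Real.log (l n / (r * l n + (1 - r) * q n))| ≤ -Real.log r + |Real.log ε|) := by
  have hlpos : ∀ n, 0 < l n := fun n => hε.trans_le (hle n)
  have hl1 := simplex_le_one hl
  have hq1 := simplex_le_one hq
  have h1r : 0 ≤ 1 - r := by linarith
  obtain ⟨ρ, hρ⟩ : ∃ ρ : Fin N → ℝ, ∀ n, ρ n = r * l n + (1 - r) * q n := ⟨_, fun _ => rfl⟩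
  simp_rw [← hρ]
  have hρl : ∀ n, r * l n ≤ ρ n := fun n => by
    rw [hρ]; have := mul_nonneg h1r (hq.1 n); linarith
  have hρpos : ∀ n, 0 < ρ n := fun n => (mul_pos hr (hlpos n)).trans_le (hρl n)
  have hρ1 : ∀ n, ρ n ≤ 1 := fun n => by
    rw [hρ]
    have := mul_le_mul_of_nonneg_left (hl1 n) hr.le
    have := mul_le_mul_of_nonneg_left (hq1 n) h1r
    linarith
  have hρs : ∑ n, ρ n = 1 := by
    simp_rw [hρ]
    rw [Finset.sum_add_distrib, ← Finset.mul_sum, ← Finset.mul_sum, hl.2, hq.2]; ring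
  have hx : ∀ n, 0 < l n / ρ n := fun n => div_pos (hlpos n) (hρpos n)
  have hxlo : ∀ n, ε ≤ l n / ρ n := fun n => by
    rw [le_div_iff₀ (hρpos n)]
    have := mul_le_mul_of_nonneg_left (hρ1 n) hε.le
    linarith [hle n]
  have hxhi : ∀ n, l n / ρ n ≤ 1 / r := fun n => by
    rw [div_le_div_iff₀ (hρpos n) hr]; linarith [hρl n]
  have hform : ∀ n, l n * R n / ρ n = R n * (l n / ρ n) := fun n => by ring
  simp_rw [hform]
  have hlo : ε ≤ ∑ n, R n * (l n / ρ n) := by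
    calc ε = ∑ n, R n * ε := by rw [← Finset.sum_mul, hR.2, one_mul]
      _ ≤ _ := Finset.sum_le_sum fun n _ => mul_le_mul_of_nonneg_left (hxlo n) (hR.1 n)
  have hhi : ∑ n, R n * (l n / ρ n) ≤ 1 / r := by
    calc _ ≤ ∑ n, R n * (1 / r) :=
          Finset.sum_le_sum fun n _ => mul_le_mul_of_nonneg_left (hxhi n) (hR.1 n)
      _ = _ := by rw [← Finset.sum_mul, hR.2, one_mul]
  refine ⟨?_, ?_, ?_, ?_, ?_⟩
  · have h1 : a ^ 2 ≤ ∑ n, (l n - q n) ^ 2 := by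
      unfold l2norm at hfar
      exact (Real.le_sqrt' ha).1 hfar
    have h2 : ∑ n, (l n - ρ n + (l n - ρ n) ^ 2 / 4) ≤ ∑ n, l n * Real.log (l n / ρ n) :=
      Finset.sum_le_sum fun n _ => kl_pt _ _ (hlpos n) (hρpos n) (hl1 n) (hρ1 n)
    refine le_trans ?_ h2
    rw [Finset.sum_add_distrib, Finset.sum_sub_distrib, hl.2, hρs]
    have h3 : ∀ n, (l n - ρ n) ^ 2 / 4 = (1 - r) ^ 2 / 4 * (l n - q n) ^ 2 := fun n => by
      rw [hρ]; ring
    simp_rw [h3]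
    rw [← Finset.mul_sum]
    have := mul_le_mul_of_nonneg_left h1 (show 0 ≤ (1 - r) ^ 2 / 4 by positivity)
    linarith
  · rw [Real.log_mul hr.ne' (hε.trans_le hlo).ne']
    have := strictConcaveOn_log_Ioi.concaveOn.le_map_sum (t := Finset.univ) (w := R)
      (p := fun n => l n / ρ n) (fun i _ => hR.1 i) hR.2 (fun i _ => hx i)
    simp only [smul_eq_mul] at this
    linarith
  · exact mul_le_mul_of_nonneg_left hlo hr.le
  · have := mul_le_mul_of_nonneg_left hhi hr.le
    rwa [mul_one_div_cancel hr.ne'] at this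
  · intro n
    have h1 := Real.log_le_log hε (hxlo n)
    have h2 := Real.log_le_log (hx n) (hxhi n)
    rw [one_div, Real.log_inv] at h2
    have h3 := Real.log_nonpos hr.le hr1
    rw [abs_le]
    constructor
    · linarith [neg_abs_le (Real.log ε)]
    · linarith [abs_nonneg (Real.log ε)]

theorem meas_L {Ω : Type*} [MeasurableSpace Ω] {l q r : Ω → ℝ}
    (hl : Measurable l) (hq : Measurable q) (hr : Measurable r) :
    Measurable fun ω => Real.log (l ω / (r ω * l ω + (1 - r ω) * q ω)) := by
  fun_prop

theorem meas_r {Ω : Type*} [MeasurableSpace Ω] {N : ℕ} {l q R : Fin N → Ω → ℝ} {r : Ω → ℝ}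
    (hl : ∀ n, Measurable (l n)) (hq : ∀ n, Measurable (q n)) (hR : ∀ n, Measurable (R n))
    (hr : Measurable r) :
    Measurable fun ω => r ω * ∑ n, l n ω * R n ω / (r ω * l n ω + (1 - r ω) * q n ω) := by
  fun_prop

/-- In the two-investor relative wealth dynamics, if `‖λₜ − λ̃ₜ‖ ≥ a` a.s. for all
`t ≥ 1` and some `a > 0`, then `E ∑_{t=1}^∞ (1 − r_{t-1})² ≤ −4 ln r₀ / a²`, and for every
`c ∈ [0,1)` the occupation time `η_c = ∑_{t≥0} 1{rₜ < c}` satisfies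
`E η_c ≤ −4 ln r₀ / (a(1−c))² < ∞`. -/
theorem occupation_time_bound
    {Ω : Type*} {m0 : MeasurableSpace Ω} (P : Measure Ω) [IsProbabilityMeasure P]
    (ℱ : Filtration ℕ m0) {N : ℕ} (hN : 2 ≤ N)
    (R : ℕ → Fin N → Ω → ℝ) (ε : ℝ) (hε : 0 < ε)
    (hRadapted : ∀ t n, StronglyMeasurable[ℱ (t + 1)] (R (t + 1) n))
    (hRsimplex : ∀ t ω, (fun n => R (t + 1) n ω) ∈ stdSimplex' N)
    (hRcond : ∀ t n, ∀ᵐ ω ∂P, ε ≤ (P[R (t + 1) n | ℱ t]) ω)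
    -- investor 1 uses the strategy `λₜⁿ = E(Rₜⁿ | F_{t-1})`
    (lam : ℕ → Fin N → Ω → ℝ)
    (hlam : ∀ t n ω, lam (t + 1) n ω = (P[R (t + 1) n | ℱ t]) ω)
    -- investor 2 uses an adapted Δ-valued sequence `λ̃ₜ`
    (tlam : ℕ → Fin N → Ω → ℝ)
    (htlam_adapted : ∀ t n, StronglyMeasurable[ℱ t] (tlam (t + 1) n))
    (htlam_simplex : ∀ t ω, (fun n => tlam (t + 1) n ω) ∈ stdSimplex' N)
    -- relative wealth of investor 1
    (r : ℕ → Ω → ℝ) (r0 : ℝ) (hr0pos : 0 < r0) (hr0lt : r0 < 1)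
    (hr0 : ∀ ω, r 0 ω = r0)
    (hrec : ∀ t ω, r (t + 1) ω =
      r t ω * ∑ n, lam (t + 1) n ω * R (t + 1) n ω /
        (r t ω * lam (t + 1) n ω + (1 - r t ω) * tlam (t + 1) n ω))
    (a : ℝ) (ha : 0 < a)
    (hfar : ∀ t : ℕ, ∀ᵐ ω ∂P, a ≤ l2norm (fun n => lam (t + 1) n ω - tlam (t + 1) n ω)) :
    (∫⁻ ω, ∑' t : ℕ, ENNReal.ofReal ((1 - r t ω) ^ 2) ∂P ≤
        ENNReal.ofReal (-4 * Real.log r0 / a ^ 2)) ∧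
    ∀ c : ℝ, 0 ≤ c → c < 1 →
      (∫⁻ ω, ∑' t : ℕ, (if r t ω < c then (1 : ℝ≥0∞) else 0) ∂P ≤
          ENNReal.ofReal (-4 * Real.log r0 / (a * (1 - c)) ^ 2)) ∧
      (∫⁻ ω, ∑' t : ℕ, (if r t ω < c then (1 : ℝ≥0∞) else 0) ∂P < ∞) := by
  have hRint : ∀ t n, Integrable (R (t + 1) n) P := fun t n => by
    refine Integrable.of_bound
      ((hRadapted t n).mono (ℱ.le _)).aestronglyMeasurable 1 (ae_of_all _ fun ω => ?_)
    rw [Real.norm_eq_abs, abs_of_nonneg ((hRsimplex t ω).1 n)]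
    exact simplex_le_one (hRsimplex t ω) n
  have hlamEq : ∀ t n, lam (t + 1) n = P[R (t + 1) n | ℱ t] := fun t n => funext (hlam t n)
  have hlamM : ∀ t n, Measurable[ℱ t] (lam (t + 1) n) := fun t n => by
    rw [hlamEq]; exact stronglyMeasurable_condExp.measurable
  have hrM : ∀ t, Measurable[ℱ t] (r t) := by
    intro t
    induction t with
    | zero => rw [show r 0 = fun _ => r0 from funext hr0]; exact measurable_const
    | succ t ih =>
      rw [show r (t + 1) = _ from funext (hrec t)]
      have hm : ℱ t ≤ ℱ (t + 1) := ℱ.mono (Nat.le_succ t)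
      exact @meas_r Ω (ℱ (t + 1)) N _ _ _ _ (fun n => (hlamM t n).mono hm le_rfl)
        (fun n => (htlam_adapted t n).measurable.mono hm le_rfl)
        (fun n => (hRadapted t n).measurable) (ih.mono hm le_rfl)
  have hlamS : ∀ t, ∀ᵐ ω ∂P, (fun n => lam (t + 1) n ω) ∈ stdSimplex' N ∧
      ∀ n, ε ≤ lam (t + 1) n ω := by
    intro t
    have h1 := condExp_finsetSum (μ := P) (s := Finset.univ) (f := fun n => R (t + 1) n)
      (fun n _ => hRint t n) (ℱ t)
    have h2 : (∑ n, R (t + 1) n) = fun _ => (1 : ℝ) := by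
      funext ω; rw [Finset.sum_apply]; exact (hRsimplex t ω).2
    rw [h2, condExp_const (ℱ.le t)] at h1
    filter_upwards [h1, ae_all_iff.2 (hRcond t)] with ω h1 h3
    have h4 : ∀ n, ε ≤ lam (t + 1) n ω := fun n => by rw [hlam]; exact h3 n
    refine ⟨⟨fun n => hε.le.trans (h4 n), ?_⟩, h4⟩
    rw [Finset.sum_apply] at h1
    simp_rw [hlam]; exact h1.symm
  have hrB : ∀ t, ∀ᵐ ω ∂P, r0 * ε ^ t ≤ r t ω ∧ r t ω ≤ 1 := by
    intro t
    induction t with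
    | zero => exact ae_of_all _ fun ω => by rw [hr0]; simp [hr0lt.le]
    | succ t ih =>
      filter_upwards [ih, hlamS t, hfar t] with ω h1 h2 h3
      have hrp : 0 < r t ω := lt_of_lt_of_le (by positivity) h1.1
      have := det_step _ _ _ ε (r t ω) a hε hrp h1.2 h2.1 (htlam_simplex t ω) (hRsimplex t ω)
        h2.2 ha h3
      rw [hrec]
      refine ⟨le_trans ?_ this.2.2.1, this.2.2.2.1⟩
      rw [pow_succ, ← mul_assoc]
      exact mul_le_mul_of_nonneg_right h1.1 hε.le
  have hlogInt : ∀ t, Integrable (fun ω => Real.log (r t ω)) P := by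
    intro t
    refine Integrable.of_bound
      (Real.measurable_log.comp ((hrM t).mono (ℱ.le t) le_rfl)).aestronglyMeasurable
      (-Real.log (r0 * ε ^ t)) ?_
    filter_upwards [hrB t] with ω h
    have hp : 0 < r0 * ε ^ t := by positivity
    rw [Real.norm_eq_abs, abs_of_nonpos (Real.log_nonpos (hp.le.trans h.1) h.2)]
    exact neg_le_neg (Real.log_le_log hp h.1)
  have hsqInt : ∀ t, Integrable (fun ω => (1 - r t ω) ^ 2) P := by
    intro t
    refine Integrable.of_bound
      ((((hrM t).mono (ℱ.le t) le_rfl).const_sub 1).pow_const 2).aestronglyMeasurable 1 ?_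
    filter_upwards [hrB t] with ω h
    have hp : 0 < r0 * ε ^ t := by positivity
    rw [Real.norm_eq_abs, abs_of_nonneg (sq_nonneg _)]
    nlinarith
  have hstep : ∀ t, a ^ 2 / 4 * ∫ ω, (1 - r t ω) ^ 2 ∂P ≤
      (∫ ω, Real.log (r (t + 1) ω) ∂P) - ∫ ω, Real.log (r t ω) ∂P := by
    intro t
    obtain ⟨L, hL⟩ : ∃ L : Fin N → Ω → ℝ, ∀ n ω, L n ω = Real.log (lam (t + 1) n ω /
      (r t ω * lam (t + 1) n ω + (1 - r t ω) * tlam (t + 1) n ω)) := ⟨_, fun _ _ => rfl⟩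
    have hLM : ∀ n, Measurable[ℱ t] (L n) := fun n => by
      rw [show L n = _ from funext (hL n)]
      exact @meas_L Ω (ℱ t) _ _ _ (hlamM t n) (htlam_adapted t n).measurable (hrM t)
    have hall : ∀ᵐ ω ∂P, (a ^ 2 / 4 * (1 - r t ω) ^ 2 ≤ ∑ n, lam (t + 1) n ω * L n ω) ∧
        (Real.log (r t ω) + ∑ n, R (t + 1) n ω * L n ω ≤ Real.log (r (t + 1) ω)) ∧
        ∀ n, |L n ω| ≤ -Real.log (r0 * ε ^ t) + |Real.log ε| := by
      filter_upwards [hrB t, hlamS t, hfar t] with ω h1 h2 h3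
      have hp : 0 < r0 * ε ^ t := by positivity
      have hrp : 0 < r t ω := lt_of_lt_of_le hp h1.1
      have := det_step _ _ _ ε (r t ω) a hε hrp h1.2 h2.1 (htlam_simplex t ω) (hRsimplex t ω)
        h2.2 ha h3
      rw [hrec]
      simp_rw [hL]
      refine ⟨this.1, this.2.1, fun n => (this.2.2.2.2 n).trans ?_⟩
      have := Real.log_le_log hp h1.1
      linarith
    have hLb : ∀ n, ∀ᵐ ω ∂P, ‖L n ω‖ ≤ -Real.log (r0 * ε ^ t) + |Real.log ε| := fun n => by
      filter_upwards [hall] with ω h using h.2.2 n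
    have hLam : ∀ n, AEStronglyMeasurable (L n) P := fun n =>
      ((hLM n).mono (ℱ.le t) le_rfl).aestronglyMeasurable
    have hRL : ∀ n, Integrable (fun ω => R (t + 1) n ω * L n ω) P := fun n =>
      (hRint t n).mul_bdd (hLam n) (hLb n)
    have hlL : ∀ n, Integrable (fun ω => lam (t + 1) n ω * L n ω) P := fun n => by
      rw [hlamEq]
      exact (integrable_condExp (μ := P) (m := ℱ t) (f := R (t + 1) n)).mul_bdd (hLam n) (hLb n)
    have heq : ∀ n, ∫ ω, lam (t + 1) n ω * L n ω ∂P = ∫ ω, R (t + 1) n ω * L n ω ∂P := fun n => by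
      have h := condExp_mul_of_stronglyMeasurable_right (μ := P) (m := ℱ t) (f := R (t + 1) n)
        (g := L n) (hLM n).stronglyMeasurable (hRL n) (hRint t n)
      rw [← hlamEq] at h
      have h2 := integral_congr_ae h
      rw [integral_condExp (ℱ.le t)] at h2
      exact h2.symm
    calc a ^ 2 / 4 * ∫ ω, (1 - r t ω) ^ 2 ∂P = ∫ ω, a ^ 2 / 4 * (1 - r t ω) ^ 2 ∂P :=
          (integral_const_mul _ _).symm
      _ ≤ ∫ ω, ∑ n, lam (t + 1) n ω * L n ω ∂P := by
          refine integral_mono_ae ((hsqInt t).const_mul _)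
            (integrable_finsetSum _ fun n _ => hlL n) ?_
          filter_upwards [hall] with ω h using h.1
      _ = ∫ ω, ∑ n, R (t + 1) n ω * L n ω ∂P := by
          rw [integral_finsetSum _ fun n _ => hlL n, integral_finsetSum _ fun n _ => hRL n]
          exact Finset.sum_congr rfl fun n _ => heq n
      _ ≤ ∫ ω, (Real.log (r (t + 1) ω) - Real.log (r t ω)) ∂P := by
          refine integral_mono_ae (integrable_finsetSum _ fun n _ => hRL n)
            ((hlogInt (t + 1)).sub (hlogInt t)) ?_
          filter_upwards [hall] with ω h
          have := h.2.1
          linarith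
      _ = _ := integral_sub (hlogInt _) (hlogInt _)
  have hsum : ∀ T, a ^ 2 / 4 * ∑ t ∈ Finset.range T, ∫ ω, (1 - r t ω) ^ 2 ∂P ≤ -Real.log r0 := by
    intro T
    rw [Finset.mul_sum]
    refine (Finset.sum_le_sum fun t _ => hstep t).trans ?_
    rw [Finset.sum_range_sub (fun t => ∫ ω, Real.log (r t ω) ∂P)]
    have h0 : ∫ ω, Real.log (r 0 ω) ∂P = Real.log r0 := by simp [hr0]
    have hT : ∫ ω, Real.log (r T ω) ∂P ≤ 0 := by
      refine integral_nonpos_of_ae ?_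
      filter_upwards [hrB T] with ω h
      have hp : 0 < r0 * ε ^ T := by positivity
      exact Real.log_nonpos (hp.le.trans h.1) h.2
    rw [h0]; linarith
  have hmeas : ∀ t, Measurable fun ω => ENNReal.ofReal ((1 - r t ω) ^ 2) := fun t =>
    ((((hrM t).mono (ℱ.le t) le_rfl).const_sub 1).pow_const 2).ennreal_ofReal
  have main : ∫⁻ ω, ∑' t : ℕ, ENNReal.ofReal ((1 - r t ω) ^ 2) ∂P ≤
        ENNReal.ofReal (-4 * Real.log r0 / a ^ 2) := by
    rw [lintegral_tsum fun t => (hmeas t).aemeasurable]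
    refine ENNReal.tsum_le_of_sum_range_le fun T => ?_
    have h1 : ∀ t, ∫⁻ ω, ENNReal.ofReal ((1 - r t ω) ^ 2) ∂P =
        ENNReal.ofReal (∫ ω, (1 - r t ω) ^ 2 ∂P) := fun t =>
      (ofReal_integral_eq_lintegral_ofReal (hsqInt t) (ae_of_all _ fun ω => sq_nonneg _)).symm
    simp_rw [h1]
    rw [← ENNReal.ofReal_sum_of_nonneg fun t _ => integral_nonneg fun ω => sq_nonneg _]
    refine ENNReal.ofReal_le_ofReal ?_
    rw [le_div_iff₀ (by positivity)]
    have := hsum T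
    linarith
  refine ⟨main, fun c hc0 hc1 => ?_⟩
  have hc : 0 < 1 - c := by linarith
  have hbd : ∫⁻ ω, ∑' t : ℕ, (if r t ω < c then (1 : ℝ≥0∞) else 0) ∂P ≤
          ENNReal.ofReal (-4 * Real.log r0 / (a * (1 - c)) ^ 2) := by
    calc ∫⁻ ω, ∑' t : ℕ, (if r t ω < c then (1 : ℝ≥0∞) else 0) ∂P
        ≤ ∫⁻ ω, ENNReal.ofReal (1 / (1 - c) ^ 2) *
            ∑' t : ℕ, ENNReal.ofReal ((1 - r t ω) ^ 2) ∂P := by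
          refine lintegral_mono fun ω => ?_
          rw [← ENNReal.tsum_mul_left]
          refine ENNReal.tsum_le_tsum fun t => ?_
          split_ifs with h
          · rw [← ENNReal.ofReal_mul (by positivity), ENNReal.one_le_ofReal, one_div_mul_eq_div,
              one_le_div (by positivity)]
            exact pow_le_pow_left₀ hc.le (by linarith) 2
          · exact zero_le
      _ = ENNReal.ofReal (1 / (1 - c) ^ 2) *
            ∫⁻ ω, ∑' t : ℕ, ENNReal.ofReal ((1 - r t ω) ^ 2) ∂P :=
          lintegral_const_mul _ (Measurable.ennreal_tsum hmeas)
      _ ≤ ENNReal.ofReal (1 / (1 - c) ^ 2) * ENNReal.ofReal (-4 * Real.log r0 / a ^ 2) := by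
          gcongr
      _ = _ := by
          rw [← ENNReal.ofReal_mul (by positivity)]
          congr 1
          field_simp
  exact ⟨hbd, hbd.trans_lt ENNReal.ofReal_lt_top⟩
end

section
/- In the deterministic model with payoffs Xₜⁿ = Rⁿ ρᵗ, suppose investor 1 uses the constant strategy R and investor 2 uses a constant strategy λ̃ ∈ Δ with λ̃ ≠ R. Then the relative wealth rₜ = Yₜ¹/(Yₜ¹ + Yₜ²) of investor 1 is non-decreasing in t and lim_{t→∞} rₜ = 1. -/
open Filter
open scoped ENNReal BigOperators

/-- In the deterministic model with payoffs `Xₜⁿ = Rⁿ ρᵗ`, if investor 1 uses the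
constant strategy `R` and investor 2 uses a constant strategy `λ̃ ∈ Δ`, `λ̃ ≠ R`,
then the relative wealth `rₜ = Yₜ¹/(Yₜ¹ + Yₜ²)` of investor 1 is non-decreasing in `t`
and `lim_{t→∞} rₜ = 1`. -/
theorem deterministic_relative_wealth_tendsto_one
    {N : ℕ} (hN : 2 ≤ N) (ρ : ℝ) (hρ : 1 < ρ)
    (R : Fin N → ℝ) (ε : ℝ) (hε : 0 < ε) (hRε : ∀ n, ε ≤ R n)
    (hRΔ : R ∈ stdSimplex' N)
    -- investor 2's constant strategy
    (tlam : Fin N → ℝ) (htlam : tlam ∈ stdSimplex' N)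
    -- initial wealths, with total initial wealth W₀ = 1
    (Y10 Y20 : ℝ) (hY10 : 0 < Y10) (hY20 : 0 < Y20) (hW0 : Y10 + Y20 = 1)
    -- wealth dynamics: payoffs Xₜⁿ = Rⁿ ρᵗ, investor 1 uses the strategy R
    (Y1 Y2 : ℕ → ℝ) (hY1init : Y1 0 = Y10) (hY2init : Y2 0 = Y20)
    (hY1rec : ∀ t : ℕ, Y1 (t + 1) = ∑ n,
      R n * Y1 t / (R n * Y1 t + tlam n * Y2 t) * (R n * ρ ^ (t + 1)))
    (hY2rec : ∀ t : ℕ, Y2 (t + 1) = ∑ n,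
      tlam n * Y2 t / (R n * Y1 t + tlam n * Y2 t) * (R n * ρ ^ (t + 1)))
    (hne : tlam ≠ R) :
    Monotone (fun t : ℕ => Y1 t / (Y1 t + Y2 t)) ∧
    Filter.Tendsto (fun t : ℕ => Y1 t / (Y1 t + Y2 t)) Filter.atTop (nhds 1) := by
  obtain ⟨hR0, hR1⟩ := hRΔ
  obtain ⟨hl0, hl1⟩ := htlam
  have hRpos : ∀ n, 0 < R n := fun n => lt_of_lt_of_le hε (hRε n)
  have hρ0 : 0 < ρ := by linarith
  have hNe : (Finset.univ : Finset (Fin N)).Nonempty := ⟨⟨0, by omega⟩, Finset.mem_univ _⟩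
  have key : ∀ t, 0 < Y1 t ∧ 0 ≤ Y2 t ∧ Y1 t + Y2 t = ρ ^ t := by
    intro t
    induction t with
    | zero => rw [hY1init, hY2init]; exact ⟨hY10, hY20.le, by simpa using hW0⟩
    | succ t ih =>
      obtain ⟨h1, h2, h3⟩ := ih
      have hd : ∀ n, 0 < R n * Y1 t + tlam n * Y2 t := fun n =>
        add_pos_of_pos_of_nonneg (mul_pos (hRpos n) h1) (mul_nonneg (hl0 n) h2)
      refine ⟨?_, ?_, ?_⟩
      · rw [hY1rec]
        refine Finset.sum_pos (fun n _ => ?_) hNe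
        have := hd n
        have := hRpos n
        positivity
      · rw [hY2rec]
        refine Finset.sum_nonneg (fun n _ => ?_)
        have := hd n
        have := hRpos n
        have := hl0 n
        positivity
      · rw [hY1rec, hY2rec, ← Finset.sum_add_distrib]
        have : ∀ n ∈ (Finset.univ : Finset (Fin N)),
            R n * Y1 t / (R n * Y1 t + tlam n * Y2 t) * (R n * ρ ^ (t + 1))
            + tlam n * Y2 t / (R n * Y1 t + tlam n * Y2 t) * (R n * ρ ^ (t + 1))
            = R n * ρ ^ (t + 1) := by
          intro n _
          rw [← add_mul, ← add_div, div_self (hd n).ne', one_mul]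
        rw [Finset.sum_congr rfl this, ← Finset.sum_mul, hR1, one_mul]
  set r : ℕ → ℝ := fun t => Y1 t / (Y1 t + Y2 t) with hr
  have hrpos : ∀ t, 0 < r t := by
    intro t
    obtain ⟨h1, h2, h3⟩ := key t
    exact div_pos h1 (by linarith)
  have hrle : ∀ t, r t ≤ 1 := by
    intro t
    obtain ⟨h1, h2, h3⟩ := key t
    exact (div_le_one (by linarith)).2 (by linarith)
  set C : ℝ := ∑ n, (R n - tlam n) ^ 2 with hC
  have hCpos : 0 < C := by
    obtain ⟨n, hn⟩ := Function.ne_iff.1 hne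
    refine Finset.sum_pos' (fun n _ => sq_nonneg _) ⟨n, Finset.mem_univ _, ?_⟩
    have : R n - tlam n ≠ 0 := sub_ne_zero.2 (Ne.symm hn)
    positivity
  have hRle : ∀ n, R n ≤ 1 := fun n => by
    rw [← hR1]; exact Finset.single_le_sum (fun i _ => hR0 i) (Finset.mem_univ n)
  have hlle : ∀ n, tlam n ≤ 1 := fun n => by
    rw [← hl1]; exact Finset.single_le_sum (fun i _ => hl0 i) (Finset.mem_univ n)
  have hstep : ∀ t, r t + r t * (C * (1 - r t) ^ 2) ≤ r (t + 1) := by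
    intro t
    obtain ⟨h1, h2, h3⟩ := key t
    have hp : 0 < ρ ^ t := pow_pos hρ0 t
    have hy1 : Y1 t = r t * ρ ^ t := by
      simp only [hr]; rw [h3]; field_simp
    have hy2 : Y2 t = (1 - r t) * ρ ^ t := by linarith
    have hx0 := hrpos t
    have hx1 := hrle t
    have hq : ∀ n, 0 < R n * r t + tlam n * (1 - r t) := fun n =>
      add_pos_of_pos_of_nonneg (mul_pos (hRpos n) hx0) (mul_nonneg (hl0 n) (by linarith))
    have hrs : r (t + 1) = r t * ∑ n, R n ^ 2 / (R n * r t + tlam n * (1 - r t)) := by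
      have e : r (t + 1) = Y1 (t + 1) / ρ ^ (t + 1) := by
        simp only [hr]; rw [(key (t + 1)).2.2]
      rw [e, hY1rec, Finset.sum_div, Finset.mul_sum]
      refine Finset.sum_congr rfl (fun n _ => ?_)
      have hqn := hq n
      have hdn : R n * Y1 t + tlam n * Y2 t = (R n * r t + tlam n * (1 - r t)) * ρ ^ t := by
        rw [hy1, hy2]; ring
      rw [hdn, hy1]
      have hqn' := hqn.ne'
      generalize R n * r t + tlam n * (1 - r t) = q at hqn'
      field_simp
    have hsum : 1 + C * (1 - r t) ^ 2 ≤ ∑ n, R n ^ 2 / (R n * r t + tlam n * (1 - r t)) := by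
      have e : 1 + C * (1 - r t) ^ 2 = ∑ n, (2 * R n - (R n * r t + tlam n * (1 - r t))
          + (R n - tlam n) ^ 2 * (1 - r t) ^ 2) := by
        rw [Finset.sum_add_distrib, Finset.sum_sub_distrib, Finset.sum_add_distrib,
          ← Finset.mul_sum, ← Finset.sum_mul, ← Finset.sum_mul, ← Finset.sum_mul, hR1, hl1]
        ring
      rw [e]
      refine Finset.sum_le_sum (fun n _ => ?_)
      have hqn := hq n
      have hq1 : R n * r t + tlam n * (1 - r t) ≤ 1 := by
        nlinarith [hRle n, hlle n]
      have e2 : (R n - tlam n) ^ 2 * (1 - r t) ^ 2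
          = (R n - (R n * r t + tlam n * (1 - r t))) ^ 2 := by ring
      rw [e2]
      generalize R n * r t + tlam n * (1 - r t) = q at hqn hq1
      rw [le_div_iff₀ hqn]
      nlinarith [mul_nonneg (sq_nonneg (R n - q)) (sub_nonneg.2 hq1)]
    rw [hrs]
    nlinarith [mul_le_mul_of_nonneg_left hsum hx0.le]
  have hmono : Monotone r := monotone_nat_of_le_succ (fun t => by
    have h := hstep t
    have : 0 ≤ r t * (C * (1 - r t) ^ 2) := by
      have := hrpos t
      positivity
    linarith)
  refine ⟨hmono, ?_⟩
  have hbdd : BddAbove (Set.range r) := ⟨1, by rintro _ ⟨t, rfl⟩; exact hrle t⟩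
  have hlim := tendsto_atTop_ciSup hmono hbdd
  set L := ⨆ t, r t with hL
  have hLpos : 0 < L := lt_of_lt_of_le (hrpos 0) (le_ciSup hbdd 0)
  have hlim1 : Tendsto (fun t => r (t + 1)) atTop (nhds L) := (tendsto_add_atTop_iff_nat 1).2 hlim
  have hlim2 : Tendsto (fun t => r t + r t * (C * (1 - r t) ^ 2)) atTop
      (nhds (L + L * (C * (1 - L) ^ 2))) :=
    hlim.add (hlim.mul (((tendsto_const_nhds.sub hlim).pow 2).const_mul C))
  have hle := le_of_tendsto_of_tendsto' hlim2 hlim1 hstep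
  have hL1 : L = 1 := by
    by_contra h
    have h' : 1 - L ≠ 0 := fun h2 => h (by linarith)
    have : 0 < L * (C * (1 - L) ^ 2) := by positivity
    linarith
  rw [hL1] at hlim
  exact hlim
end
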